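/- An ℝ-building (Λ,F) is metrically complete (i.e., (Λ,d) is a complete metric space) if and only if for every direction m of a wall of Λ, the union K(m) of all apartments of Λ that contain a wall with direction m is a complete metric subspace of Λ. -/

import Mathlib

open Set

noncomputable section

/-- The model space `𝔸`: Euclidean `n`-space. -/
abbrev ModelSpace (n : ℕ) : Type := EuclideanSpace ℝ (Fin n)

/-- A linear reflection of the model space: an involutive isometry, different from the
identity, whose fixed-point set is a linear hyperplane (the kernel of a nonzero linear
functional). -/
def IsLinearReflection {n : ℕ} (s : ModelSpace n ≃ᵢ ModelSpace n) : Prop :=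
  s * s = 1 ∧ s ≠ 1 ∧
    ∃ p : ModelSpace n →ₗ[ℝ] ℝ, p ≠ 0 ∧ {x | s x = x} = {x | p x = 0}

/-- A spherical Coxeter system of rank `n`, realized as a finite reflection group acting
on the model space `ℝⁿ`: a finite set `S` of linear reflections generating a finite
group `W̄`. -/
structure SphericalCoxeterSystem (n : ℕ) where
  S : Set (ModelSpace n ≃ᵢ ModelSpace n)
  finiteS : S.Finite
  refl : ∀ s ∈ S, IsLinearReflection s
  finiteW : Finite ↥(Subgroup.closure S)

namespace SphericalCoxeterSystem

variable {n : ℕ}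

/-- The finite reflection group `W̄` generated by `S`. -/
def Wbar (cs : SphericalCoxeterSystem n) : Subgroup (ModelSpace n ≃ᵢ ModelSpace n) :=
  Subgroup.closure cs.S

/-- A translation of the model space. -/
def IsTranslation (t : ModelSpace n ≃ᵢ ModelSpace n) : Prop :=
  ∃ v : ModelSpace n, ∀ x, t x = x + v

/-- The group `W` of affine transformations generated by `W̄` and all translations. -/
def W (cs : SphericalCoxeterSystem n) : Subgroup (ModelSpace n ≃ᵢ ModelSpace n) :=
  Subgroup.closure (cs.S ∪ {t | IsTranslation t})

/-- An affine reflection: a `W`-conjugate of a generator in `S`. -/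
def IsAffineReflection (cs : SphericalCoxeterSystem n)
    (r : ModelSpace n ≃ᵢ ModelSpace n) : Prop :=
  ∃ s ∈ cs.S, ∃ w ∈ cs.W, r = w * s * w⁻¹

/-- A wall of the model space: the fixed-point set of an affine reflection. -/
def IsModelWall (cs : SphericalCoxeterSystem n) (M : Set (ModelSpace n)) : Prop :=
  ∃ r, cs.IsAffineReflection r ∧ M = {x | r x = x}

/-- A half-apartment of the model space: a closed half-space `H` bounded by the
wall `M` (fixed-point set of the affine reflection `r`). -/
def IsModelHalf (cs : SphericalCoxeterSystem n) (M H : Set (ModelSpace n)) : Prop :=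
  ∃ r, cs.IsAffineReflection r ∧ M = {x | r x = x} ∧
    IsClosed H ∧ Convex ℝ H ∧ H ∪ (⇑r '' H) = univ ∧ H ∩ (⇑r '' H) = M

/-- A sector-face of the model space based at `x`: a closed cell of the arrangement of
all walls through `x` (for each wall through `x` one chooses either the wall itself or
one of its two half-apartments, and takes the intersection of the choices). -/
def IsModelSectorFace (cs : SphericalCoxeterSystem n) (x : ModelSpace n)
    (F : Set (ModelSpace n)) : Prop :=
  F.Nonempty ∧ ∃ σ : Set (ModelSpace n) → Set (ModelSpace n),
    (∀ M, cs.IsModelWall M → x ∈ M → (σ M = M ∨ cs.IsModelHalf M (σ M))) ∧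
    F = ⋂ M ∈ {M | cs.IsModelWall M ∧ x ∈ M}, σ M

/-- A sector of the model space based at `x`: a maximal sector-face based at `x`. -/
def IsModelSector (cs : SphericalCoxeterSystem n) (x : ModelSpace n)
    (F : Set (ModelSpace n)) : Prop :=
  cs.IsModelSectorFace x F ∧ ∀ F', cs.IsModelSectorFace x F' → F ⊆ F' → F' = F

/-- A sector-panel of the model space based at `x`: a sector-face of codimension one. -/
def IsModelSectorPanel (cs : SphericalCoxeterSystem n) (x : ModelSpace n)
    (F : Set (ModelSpace n)) : Prop :=
  cs.IsModelSectorFace x F ∧ Module.finrank ℝ (affineSpan ℝ F).direction = n - 1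

/-- The word length on `W̄` with respect to the generating set `S`. -/
def wordLength (cs : SphericalCoxeterSystem n) (w : ModelSpace n ≃ᵢ ModelSpace n) : ℕ :=
  sInf {k | ∃ l : List (ModelSpace n ≃ᵢ ModelSpace n),
    l.length = k ∧ (∀ s ∈ l, s ∈ cs.S) ∧ l.prod = w}

/-- The longest element of `W̄`. -/
def IsLongest (cs : SphericalCoxeterSystem n) (w : ModelSpace n ≃ᵢ ModelSpace n) : Prop :=
  w ∈ cs.Wbar ∧ ∀ v ∈ cs.Wbar, cs.wordLength v ≤ cs.wordLength w

end SphericalCoxeterSystem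

section Building

variable {n : ℕ} {X : Type*} [MetricSpace X]

/-- Two subsets of a metric space are parallel if their Hausdorff distance is finite. -/
def Par (S T : Set X) : Prop := EMetric.hausdorffEdist S T ≠ ⊤

/-- Two sets locally coincide at `α` (have the same germ at `α`) if their intersection
is a neighbourhood of `α` in both of them. -/
def LocCoin (α : X) (F F' : Set X) : Prop :=
  F ∩ F' ∈ nhdsWithin α F ∧ F ∩ F' ∈ nhdsWithin α F'

variable (cs : SphericalCoxeterSystem n)

/-- An apartment: the image of a chart. -/
def IsApartment (Fc : Set (ModelSpace n → X)) (A : Set X) : Prop :=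
  ∃ f ∈ Fc, A = range f

/-- A sector-face based at `α` : the image under a chart of a sector-face of the model
space, with base point mapped to `α`. -/
def IsSectorFaceAt (Fc : Set (ModelSpace n → X)) (α : X) (F : Set X) : Prop :=
  ∃ f ∈ Fc, ∃ x s, cs.IsModelSectorFace x s ∧ f x = α ∧ F = f '' s

/-- A sector based at `α`. -/
def IsSectorAt (Fc : Set (ModelSpace n → X)) (α : X) (F : Set X) : Prop :=
  ∃ f ∈ Fc, ∃ x s, cs.IsModelSector x s ∧ f x = α ∧ F = f '' s

/-- A sector-panel based at `α`. -/
def IsSectorPanelAt (Fc : Set (ModelSpace n → X)) (α : X) (F : Set X) : Prop :=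
  ∃ f ∈ Fc, ∃ x s, cs.IsModelSectorPanel x s ∧ f x = α ∧ F = f '' s

/-- A sector-face. -/
def IsSectorFace (Fc : Set (ModelSpace n → X)) (F : Set X) : Prop :=
  ∃ α, IsSectorFaceAt cs Fc α F

/-- A sector. -/
def IsSector (Fc : Set (ModelSpace n → X)) (F : Set X) : Prop :=
  ∃ α, IsSectorAt cs Fc α F

/-- A sector-panel. -/
def IsSectorPanel (Fc : Set (ModelSpace n → X)) (F : Set X) : Prop :=
  ∃ α, IsSectorPanelAt cs Fc α F

/-- A wall: the image of a wall of the model space under a chart. -/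
def IsWall (Fc : Set (ModelSpace n → X)) (M : Set X) : Prop :=
  ∃ f ∈ Fc, ∃ m, cs.IsModelWall m ∧ M = f '' m

/-- A half-apartment: the image of a half-apartment of the model space under a chart. -/
def IsHalfApartment (Fc : Set (ModelSpace n → X)) (H : Set X) : Prop :=
  ∃ f ∈ Fc, ∃ m h, cs.IsModelHalf m h ∧ H = f '' h

/-- An ℝ-building of type `(W̄,S)` with set of points `Λ` inside the ambient metric
space `X` (taking `Λ` a subset of an ambient metric space makes it possible to speak of
one ℝ-building being contained in another): a set of isometric charts from the model
space satisfying the axioms (A1)–(A5). -/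
structure RBuilding (cs : SphericalCoxeterSystem n) (X : Type*) [MetricSpace X]
    (Λ : Set X) : Type _ where
  charts : Set (ModelSpace n → X)
  isom : ∀ f ∈ charts, Isometry f
  into : ∀ f ∈ charts, range f ⊆ Λ
  A1 : ∀ f ∈ charts, ∀ w ∈ cs.W, (f ∘ ⇑w) ∈ charts
  A2 : ∀ f ∈ charts, ∀ g ∈ charts,
        IsClosed {x | f x ∈ range g} ∧ Convex ℝ {x | f x ∈ range g} ∧
        ∃ w ∈ cs.W, ∀ x, f x ∈ range g → f x = g (w x)
  A3 : ∀ p ∈ Λ, ∀ q ∈ Λ, ∃ f ∈ charts, p ∈ range f ∧ q ∈ range f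
  A4 : ∀ S₁ S₂, IsSector cs charts S₁ → IsSector cs charts S₂ →
        ∃ T₁ T₂ f, f ∈ charts ∧ IsSector cs charts T₁ ∧ IsSector cs charts T₂ ∧
          T₁ ⊆ S₁ ∧ T₂ ⊆ S₂ ∧ T₁ ⊆ range f ∧ T₂ ⊆ range f
  A5 : ∀ f₁ ∈ charts, ∀ f₂ ∈ charts, ∀ f₃ ∈ charts,
        IsHalfApartment cs charts (range f₁ ∩ range f₂) →
        IsHalfApartment cs charts (range f₂ ∩ range f₃) →
        IsHalfApartment cs charts (range f₁ ∩ range f₃) →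
        (range f₁ ∩ range f₂ ∩ range f₃).Nonempty

/-- The Weyl distance, inside the apartment given by the chart `f`, from the sector `S`
to the sector `S'` (both contained in that apartment): the element `w ∈ W̄` mapping the
sector of the model space based at the origin parallel to `f⁻¹(S)` to the one parallel
to `f⁻¹(S')`. -/
def WeylDistIn (f : ModelSpace n → X) (S S' : Set X)
    (w : ModelSpace n ≃ᵢ ModelSpace n) : Prop :=
  w ∈ cs.Wbar ∧ ∃ s s', cs.IsModelSector 0 s ∧ cs.IsModelSector 0 s' ∧
    Par (f '' s) S ∧ Par (f '' s') S' ∧ ⇑w '' s = s'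

/-- `w` is the Weyl distance from the germ at `α` of the sector `S` to the germ at `α`
of the sector `S'` (both based at `α`): computed via sectors based at `α` with the same
germs lying in a common apartment. -/
def GermWeylDist (Fc : Set (ModelSpace n → X)) (α : X) (S S' : Set X)
    (w : ModelSpace n ≃ᵢ ModelSpace n) : Prop :=
  ∃ f ∈ Fc, ∃ T T', IsSectorAt cs Fc α T ∧ IsSectorAt cs Fc α T' ∧
    T ⊆ range f ∧ T' ⊆ range f ∧ LocCoin α S T ∧ LocCoin α S' T' ∧
    WeylDistIn cs f T T' w

/-- `w` is the Weyl distance between the chambers at infinity represented by the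
sectors `S` and `S'`: computed via parallel sectors lying in a common apartment. -/
def ChamberWeylDist (Fc : Set (ModelSpace n → X)) (S S' : Set X)
    (w : ModelSpace n ≃ᵢ ModelSpace n) : Prop :=
  ∃ f ∈ Fc, ∃ T T', IsSector cs Fc T ∧ IsSector cs Fc T' ∧
    T ⊆ range f ∧ T' ⊆ range f ∧ Par T S ∧ Par T' S' ∧ WeylDistIn cs f T T' w

/-- The germs at `α` of two sectors based at `α` are opposite if their Weyl distance is
the longest element of `W̄`. -/
def OppositeGerms (Fc : Set (ModelSpace n → X)) (α : X) (S S' : Set X) : Prop :=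
  ∃ w, GermWeylDist cs Fc α S S' w ∧ cs.IsLongest w

/-- Two chambers at infinity (represented by the sectors `C`, `D`) are adjacent if they
are distinct and their Weyl distance lies in `S`. -/
def AdjacentChambers (Fc : Set (ModelSpace n → X)) (C D : Set X) : Prop :=
  ¬ Par C D ∧ ∃ s ∈ cs.S, ChamberWeylDist cs Fc C D s

/-- Two sector-panels are asymptotic if they contain a common subset which is itself a
sector-panel. -/
def Asymptotic (Fc : Set (ModelSpace n → X)) (P P' : Set X) : Prop :=
  ∃ Q, IsSectorPanel cs Fc Q ∧ Q ⊆ P ∧ Q ⊆ P'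

/-- An automorphism of an ℝ-building: an isometry `g` of `Λ` with `g ∘ f` a chart for
every chart `f`. -/
def RBuilding.IsAuto {Λ : Set X} (B : RBuilding cs X Λ) (g : ↥Λ ≃ᵢ ↥Λ) : Prop :=
  ∀ f (hf : f ∈ B.charts),
    (fun a : ModelSpace n =>
      ((g ⟨f a, B.into f hf (mem_range_self a)⟩ : ↥Λ) : X)) ∈ B.charts

end Building

section CAT0

/-- `G` is a geodesic segment from `x` to `y`: an isometric image of a closed real
interval with endpoints `x` and `y`. -/
def IsGeodesicSegment {Y : Type*} [MetricSpace Y] (x y : Y) (G : Set Y) : Prop :=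
  ∃ (a b : ℝ) (γ : ℝ → Y), a ≤ b ∧ γ a = x ∧ γ b = y ∧
    (∀ s ∈ Set.Icc a b, ∀ t ∈ Set.Icc a b, dist (γ s) (γ t) = |s - t|) ∧
    G = γ '' Set.Icc a b

/-- A CAT(0) space: a geodesic metric space in which every geodesic triangle satisfies
the CAT(0) comparison inequality with respect to comparison triangles in the Euclidean
plane. -/
def IsCAT0Space (Y : Type*) [MetricSpace Y] : Prop :=
  (∀ x y : Y, ∃ G, IsGeodesicSegment x y G) ∧
  ∀ (x y z : Y) (G : Set Y), IsGeodesicSegment x y G → ∀ a ∈ G,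
    ∀ x' y' z' : EuclideanSpace ℝ (Fin 2),
      dist x' y' = dist x y → dist y' z' = dist y z → dist x' z' = dist x z →
      ∀ a' ∈ segment ℝ x' y', dist x' a' = dist x a → dist z a ≤ dist z' a'

end CAT0

section Geometry

open Filter Topology
open scoped RealInnerProductSpace

variable {V : Type*} [NormedAddCommGroup V] [InnerProductSpace ℝ V]

/-- If an interval is covered by finitely many closed sets, then any transitive relation which
holds between points of the interval lying in a common member of the cover relates its
endpoints. -/
theorem rel_of_finite_closed_cover {ι : Type*} (P : ℝ → ℝ → Prop)
    (trans : ∀ r s t, P r s → P s t → P r t) (J : Finset ι) (I : ι → Set ℝ)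
    (hI : ∀ j ∈ J, IsClosed (I j)) {a b : ℝ} (hab : a ≤ b)
    (hcov : ∀ s ∈ Icc a b, ∃ j ∈ J, s ∈ I j)
    (hP : ∀ j ∈ J, ∀ s ∈ Icc a b, ∀ t ∈ Icc a b, s ∈ I j → t ∈ I j → s ≤ t → P s t) :
    P a b := by
  classical
  induction J using Finset.strongInduction generalizing a with
  | H J ih =>
    obtain ⟨j, hj, haj⟩ := hcov a ⟨le_rfl, hab⟩
    have hcomp : IsCompact (I j ∩ Icc a b) := isCompact_Icc.inter_left (hI j hj)
    obtain ⟨s, ⟨hsj, hs⟩, hmax⟩ :=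
      hcomp.exists_isMaxOn ⟨a, haj, le_rfl, hab⟩ continuous_id.continuousOn
    have has : P a s := hP j hj a ⟨le_rfl, hab⟩ s hs haj hsj hs.1
    rcases hs.2.eq_or_lt with h | h
    · exact h ▸ has
    refine trans _ _ _ has (ih (J.erase j) (Finset.erase_ssubset hj)
      (fun i hi => hI i (Finset.mem_of_mem_erase hi)) hs.2 ?_ ?_)
    · have hcl : IsClosed (⋃ i ∈ J.erase j, I i) :=
        isClosed_biUnion_finset fun i hi => hI i (Finset.mem_of_mem_erase hi)
      have hsub : Ioc s b ⊆ ⋃ i ∈ J.erase j, I i := by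
        intro t ht
        obtain ⟨i, hi, hti⟩ := hcov t ⟨hs.1.trans ht.1.le, ht.2⟩
        have hij : i ≠ j := by
          rintro rfl
          exact absurd (hmax ⟨hti, hs.1.trans ht.1.le, ht.2⟩) (not_le.2 ht.1)
        exact mem_biUnion (Finset.mem_erase.2 ⟨hij, hi⟩) hti
      intro t ht
      have := hcl.closure_subset_iff.2 hsub
      rw [closure_Ioc h.ne] at this
      simpa using this ht
    · intro i hi r hr t ht
      exact hP i (Finset.mem_of_mem_erase hi) r ⟨hs.1.trans hr.1, hr.2⟩ t ⟨hs.1.trans ht.1, ht.2⟩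

/-- A closed convex set containing a translate of a cone is stable under translation by
elements of the cone. -/
theorem add_mem_of_ray_subset {Z : Set V} (hc : IsClosed Z) (hconv : Convex ℝ Z) {x y u : V}
    (hx : ∀ t : ℝ, 0 ≤ t → x + t • u ∈ Z) (hy : y ∈ Z) : y + u ∈ Z := by
  have hlim : Tendsto (fun s : ℝ => (1 - s) • y + s • (x + s⁻¹ • u)) (𝓝[>] 0) (𝓝 (y + u)) := by
    have h1 : Tendsto (fun s : ℝ => (1 - s) • y + (s • x + u)) (𝓝[>] 0)
        (𝓝 ((1 - 0 : ℝ) • y + ((0 : ℝ) • x + u))) := by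
      have : Continuous fun s : ℝ => (1 - s) • y + (s • x + u) := by fun_prop
      exact (this.tendsto 0).mono_left nhdsWithin_le_nhds
    have h2 : (1 - 0 : ℝ) • y + ((0 : ℝ) • x + u) = y + u := by simp
    rw [h2] at h1
    refine h1.congr' ?_
    filter_upwards [self_mem_nhdsWithin] with s hs
    rw [smul_add, smul_smul, mul_inv_cancel₀ (ne_of_gt hs), one_smul]
  refine hc.mem_of_tendsto hlim ?_
  have h01 : Ioo (0 : ℝ) 1 ∈ 𝓝[>] (0 : ℝ) := Ioo_mem_nhdsGT one_pos
  filter_upwards [h01] with s hs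
  exact hconv hy (hx _ (inv_nonneg.2 hs.1.le)) (by linarith [hs.2]) hs.1.le (by ring)

/-- A proper closed set stable under translation by a closed half-space is a closed
half-space. -/
theorem eq_halfSpace {Z : Set V} (hc : IsClosed Z) {a : V} (ha : ‖a‖ = 1)
    (hne : Z.Nonempty) (hproper : Z ≠ univ) (hrec : ∀ x ∈ Z, ∀ u, 0 ≤ ⟪a, u⟫ → x + u ∈ Z) :
    ∃ c : ℝ, Z = {x | c ≤ ⟪a, x⟫} := by
  have haa : ⟪a, a⟫ = 1 := by rw [real_inner_self_eq_norm_sq, ha]; norm_num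
  have hup : ∀ x ∈ Z, ∀ y, ⟪a, x⟫ ≤ ⟪a, y⟫ → y ∈ Z := fun x hx y hxy => by
    have := hrec x hx (y - x) (by rw [inner_sub_right]; linarith)
    rwa [add_sub_cancel] at this
  set T : Set ℝ := {t | t • a ∈ Z} with hT
  have hval : ∀ t : ℝ, ⟪a, t • a⟫ = t := fun t => by rw [inner_smul_right, haa, mul_one]
  have hTc : IsClosed T := hc.preimage (by fun_prop)
  obtain ⟨z, hz⟩ := hne
  have hTne : T.Nonempty := ⟨⟪a, z⟫, hup z hz _ (by rw [hval])⟩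
  obtain ⟨y, hy⟩ := (ne_univ_iff_exists_notMem Z).1 hproper
  have hTb : BddBelow T := ⟨⟪a, y⟫, fun t ht => by
    by_contra h
    exact hy (hup _ ht y (by rw [hval]; exact (not_le.1 h).le))⟩
  have hmem := hTc.csInf_mem hTne hTb
  refine ⟨sInf T, Subset.antisymm (fun x hx => ?_) fun x hx => ?_⟩
  · exact csInf_le hTb (hup x hx _ (by rw [hval]))
  · exact hup _ hmem x (by rw [hval]; exact hx)

/-- A point is not moved by a map into a strictly convex space that does not increase
the distances to two points between which it lies. -/
theorem eq_of_dist_le_of_mem_segment {x y z r : V} (hz : z ∈ segment ℝ x y)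
    (h1 : dist x r ≤ dist x z) (h2 : dist r y ≤ dist z y) : r = z := by
  have hzz : dist x z + dist z y = dist x y := dist_add_dist_of_mem_segment hz
  have hr : dist x r + dist r y = dist x y :=
    le_antisymm (by linarith) (dist_triangle _ _ _)
  have h1' : dist x r = dist x z := by linarith
  have h2' : dist r y = dist z y := by linarith
  obtain ⟨s, t, hs, ht, hst, rfl⟩ := hz
  have hxz : dist x (s • x + t • y) = t * dist x y := by
    have : x - (s • x + t • y) = t • (x - y) := by
      rw [← eq_sub_iff_add_eq] at hst; subst hst; module
    rw [dist_eq_norm, this, norm_smul, Real.norm_of_nonneg ht, dist_eq_norm]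
  have hzy : dist (s • x + t • y) y = (1 - t) * dist x y := by
    have : (s • x + t • y) - y = s • (x - y) := by
      rw [← eq_sub_iff_add_eq'] at hst; subst hst; module
    rw [dist_eq_norm, this, norm_smul, Real.norm_of_nonneg hs, dist_eq_norm]
    congr 1; linarith
  have := eq_lineMap_of_dist_eq_mul_of_dist_eq_mul (h1'.trans hxz) (h2'.trans hzy)
  rw [this, AffineMap.lineMap_apply_module]
  congr 2; linarith

/-- The reflection in the hyperplane orthogonal to `a`. -/
def hyperplaneReflection (a : V) : V ≃ₗᵢ[ℝ] V := (ℝ ∙ a)ᗮ.reflection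

theorem hyperplaneReflection_apply {a : V} (ha : ‖a‖ = 1) (x : V) :
    hyperplaneReflection a x = x - (2 * ⟪a, x⟫) • a := by
  rw [hyperplaneReflection, Submodule.reflection_orthogonal_apply, Submodule.reflection_apply,
    Submodule.starProjection_unit_singleton ℝ ha]
  module

theorem inner_hyperplaneReflection {a : V} (ha : ‖a‖ = 1) (x : V) :
    ⟪a, hyperplaneReflection a x⟫ = -⟪a, x⟫ := by
  rw [hyperplaneReflection_apply ha, inner_sub_right, inner_smul_right,
    real_inner_self_eq_norm_sq, ha]
  ring

theorem hyperplaneReflection_of_inner_eq_zero {a x : V} (ha : ‖a‖ = 1) (h : ⟪a, x⟫ = 0) :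
    hyperplaneReflection a x = x := by
  rw [hyperplaneReflection_apply ha, h]; simp

theorem hyperplaneReflection_involutive (a x : V) :
    hyperplaneReflection a (hyperplaneReflection a x) = x :=
  Submodule.reflection_reflection _ _

/-- A linear isometry fixing the hyperplane orthogonal to `a` pointwise is the identity or the
reflection in that hyperplane. -/
theorem eq_id_or_eq_hyperplaneReflection {a : V} (ha : ‖a‖ = 1) (L : V ≃ₗᵢ[ℝ] V)
    (h : ∀ w, ⟪a, w⟫ = 0 → L w = w) :
    (∀ w, L w = w) ∨ ∀ w, L w = hyperplaneReflection a w := by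
  have haa : ⟪a, a⟫ = 1 := by rw [real_inner_self_eq_norm_sq, ha]; norm_num
  have hdec : ∀ w, ⟪a, w - ⟪a, w⟫ • a⟫ = 0 := fun w => by
    rw [inner_sub_right, inner_smul_right, haa]; ring
  have hLa : L a = ⟪a, L a⟫ • a := by
    have h0 : ⟪L a - ⟪a, L a⟫ • a, L a - ⟪a, L a⟫ • a⟫ = 0 := by
      have h1 := h _ (hdec (L a))
      conv_lhs => rw [inner_sub_left]
      conv_lhs => arg 1; rw [← h1]
      rw [L.inner_map_map, inner_smul_left, hdec]; simp
    exact sub_eq_zero.1 (inner_self_eq_zero.1 h0)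
  have hn : ⟪a, L a⟫ * ⟪a, L a⟫ = 1 := by
    have : ⟪L a, L a⟫ = 1 := by rw [L.inner_map_map, haa]
    rw [hLa, inner_smul_left, inner_smul_right, haa] at this
    simpa using this
  have key : ∀ w, L w = (w - ⟪a, w⟫ • a) + ⟪a, w⟫ • L a := fun w => by
    conv_lhs => rw [← sub_add_cancel w (⟪a, w⟫ • a), map_add, map_smul, h _ (hdec w)]
  rcases mul_self_eq_one_iff.1 hn with h1 | h1
  · left; intro w; rw [key, hLa, h1]; simp
  · right; intro w; rw [key, hLa, h1, hyperplaneReflection_apply ha]; module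

end Geometry

section Cones

open Filter Topology
open scoped RealInnerProductSpace

variable {V : Type*} [NormedAddCommGroup V] [InnerProductSpace ℝ V]

/-- A vector is regular for a set of roots if it lies on none of the hyperplanes orthogonal
to the roots. -/
def RegularVector (R : Set V) (v : V) : Prop := ∀ a ∈ R, ⟪a, v⟫ ≠ 0

/-- The closed cone of all vectors lying weakly on the same side as `v` of every hyperplane
orthogonal to a root; for `v` regular it is a closed Weyl chamber. -/
def weylCone (R : Set V) (v : V) : Set V := {u | ∀ a ∈ R, 0 ≤ ⟪a, v⟫ * ⟪a, u⟫}

variable {R : Set V} {u v w : V}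

theorem self_mem_weylCone (v : V) : v ∈ weylCone R v := fun _ _ => mul_self_nonneg _

theorem zero_mem_weylCone (v : V) : (0 : V) ∈ weylCone R v := fun _ _ => by simp

theorem smul_mem_weylCone {t : ℝ} (ht : 0 ≤ t) (hu : u ∈ weylCone R v) :
    t • u ∈ weylCone R v := fun a ha => by
  rw [inner_smul_right, mul_left_comm]
  exact mul_nonneg ht (hu a ha)

theorem neg_mem_weylCone_neg (hu : u ∈ weylCone R v) : -u ∈ weylCone R (-v) := fun a ha => by
  simpa [inner_neg_right] using hu a ha

theorem RegularVector.neg (hv : RegularVector R v) : RegularVector R (-v) := fun a ha => by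
  simpa [inner_neg_right] using hv a ha

theorem isClosed_weylCone (v : V) : IsClosed (weylCone R v) := by
  have : weylCone R v = ⋂ a ∈ R, {u | 0 ≤ ⟪a, v⟫ * ⟪a, u⟫} := by
    ext; simp [weylCone]
  rw [this]
  exact isClosed_biInter fun a _ => isClosed_le continuous_const (by fun_prop)

theorem add_mem_weylCone (hu : u ∈ weylCone R v) (hw : w ∈ weylCone R v) :
    u + w ∈ weylCone R v := fun a ha => by
  rw [inner_add_right, mul_add]
  exact add_nonneg (hu a ha) (hw a ha)

theorem convex_weylCone (v : V) : Convex ℝ (weylCone R v) := fun _ hx _ hy _ _ hs ht _ =>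
  add_mem_weylCone (smul_mem_weylCone hs hx) (smul_mem_weylCone ht hy)

theorem weylCone_eq_of_pos (h : ∀ a ∈ R, 0 < ⟪a, v⟫ * ⟪a, w⟫) :
    weylCone R v = weylCone R w := by
  have aux : ∀ x y z : ℝ, 0 < x * y → (0 ≤ x * z ↔ 0 ≤ y * z) := by
    intro x y z hxy
    rcases pos_and_pos_or_neg_and_neg_of_mul_pos hxy with ⟨h1, h2⟩ | ⟨h1, h2⟩
    · rw [mul_nonneg_iff_of_pos_left h1, mul_nonneg_iff_of_pos_left h2]
    · constructor <;> intro h3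
      · exact mul_nonneg_of_nonpos_of_nonpos h2.le (by nlinarith)
      · exact mul_nonneg_of_nonpos_of_nonpos h1.le (by nlinarith)
  ext u
  exact forall₂_congr fun a ha => aux _ _ _ (h a ha)

theorem RegularVector.mul_pos (hv : RegularVector R v) (hw : RegularVector R w)
    (h : w ∈ weylCone R v) {a : V} (ha : a ∈ R) : 0 < ⟪a, v⟫ * ⟪a, w⟫ :=
  lt_of_le_of_ne (h a ha) (mul_ne_zero (hv a ha) (hw a ha)).symm

theorem exists_forall_add_smul_mem_weylCone (hR : R.Finite) {p : V}
    (h : ∀ a ∈ R, 0 < ⟪a, v⟫ * ⟪a, p⟫ ∨ 0 ≤ ⟪a, v⟫ * ⟪a, w⟫ ∧ 0 ≤ ⟪a, v⟫ * ⟪a, p⟫) :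
    ∃ T : ℝ, 0 ≤ T ∧ ∀ t, T ≤ t → w + t • p ∈ weylCone R v := by
  have : ∀ a ∈ R, ∀ᶠ t : ℝ in atTop, 0 ≤ ⟪a, v⟫ * ⟪a, w + t • p⟫ := by
    intro a ha
    have e : ∀ t : ℝ, ⟪a, v⟫ * ⟪a, w + t • p⟫ = ⟪a, v⟫ * ⟪a, w⟫ + t * (⟪a, v⟫ * ⟪a, p⟫) := by
      intro t; rw [inner_add_right, inner_smul_right]; ring
    rcases h a ha with h1 | ⟨h1, h2⟩
    · have := tendsto_atTop_add_const_left atTop (⟪a, v⟫ * ⟪a, w⟫)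
        (tendsto_id.atTop_mul_const h1)
      filter_upwards [this.eventually_ge_atTop 0] with t ht
      rw [e]; exact ht
    · filter_upwards [eventually_ge_atTop 0] with t ht
      rw [e]; positivity
  obtain ⟨T, hT⟩ := eventually_atTop.1 ((eventually_all_finite hR).2 this)
  exact ⟨max T 0, le_max_right _ _, fun t ht a ha => hT t ((le_max_left _ _).trans ht) a ha⟩

theorem RegularVector.exists_forall_add_smul_mem (hR : R.Finite) (hv : RegularVector R v)
    (w : V) : ∃ T : ℝ, 0 ≤ T ∧ ∀ t, T ≤ t → w + t • v ∈ weylCone R v :=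
  exists_forall_add_smul_mem_weylCone hR fun a ha => Or.inl (mul_self_pos.2 (hv a ha))

theorem RegularVector.eventually_add_smul (hR : R.Finite) {g : V} (hg : RegularVector R g)
    (u : V) : ∀ᶠ ε : ℝ in 𝓝[>] 0,
      RegularVector R (u + ε • g) ∧ u ∈ weylCone R (u + ε • g) ∧
        ∀ a ∈ R, ⟪a, u⟫ = 0 → 0 < ⟪a, g⟫ * ⟪a, u + ε • g⟫ := by
  have : ∀ a ∈ R, ∀ᶠ ε : ℝ in 𝓝[>] 0, ⟪a, u + ε • g⟫ ≠ 0 ∧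
      0 ≤ ⟪a, u + ε • g⟫ * ⟪a, u⟫ ∧ (⟪a, u⟫ = 0 → 0 < ⟪a, g⟫ * ⟪a, u + ε • g⟫) := by
    intro a ha
    by_cases h0 : ⟪a, u⟫ = 0
    · filter_upwards [self_mem_nhdsWithin] with ε hε
      have hε' : (0 : ℝ) < ε := hε
      rw [inner_add_right, inner_smul_right, h0]
      refine ⟨by simpa using ⟨hε'.ne', hg a ha⟩, by simp, fun _ => ?_⟩
      have := mul_self_pos.2 (hg a ha)
      nlinarith
    · have hc : Tendsto (fun ε : ℝ => ⟪a, u + ε • g⟫ * ⟪a, u⟫) (𝓝[>] 0)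
          (𝓝 (⟪a, u + (0 : ℝ) • g⟫ * ⟪a, u⟫)) := by
        have : Continuous fun ε : ℝ => ⟪a, u + ε • g⟫ * ⟪a, u⟫ := by fun_prop
        exact (this.tendsto 0).mono_left nhdsWithin_le_nhds
      have hpos : 0 < ⟪a, u + (0 : ℝ) • g⟫ * ⟪a, u⟫ := by
        simpa using mul_self_pos.2 h0
      filter_upwards [hc.eventually (lt_mem_nhds hpos)] with ε hε
      exact ⟨fun h => by simp [h] at hε, hε.le, fun h => absurd h h0⟩
  filter_upwards [(eventually_all_finite hR).2 this] with ε hε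
  exact ⟨fun a ha => (hε a ha).1, fun a ha => (hε a ha).2.1, fun a ha => (hε a ha).2.2⟩

theorem exists_regularVector (hR : R.Finite) (h0 : ∀ a ∈ R, a ≠ 0) :
    ∃ g, RegularVector R g := by
  induction R, hR using Set.Finite.induction_on with
  | empty => exact ⟨0, fun a ha => ha.elim⟩
  | @insert a R _ hR ih =>
    obtain ⟨g, hg⟩ := ih fun b hb => h0 b (mem_insert_of_mem _ hb)
    have ha : (0 : ℝ) < ⟪a, a⟫ := real_inner_self_pos.2 (h0 a (mem_insert _ _))
    have hc : Tendsto (fun ε : ℝ => ⟪a, a + ε • g⟫) (𝓝[>] 0) (𝓝 ⟪a, a + (0 : ℝ) • g⟫) := by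
      have : Continuous fun ε : ℝ => ⟪a, a + ε • g⟫ := by fun_prop
      exact (this.tendsto 0).mono_left nhdsWithin_le_nhds
    rw [zero_smul, add_zero] at hc
    obtain ⟨ε, h1, h2⟩ :=
      ((hg.eventually_add_smul hR a).and (hc.eventually (lt_mem_nhds ha))).exists
    refine ⟨a + ε • g, fun b hb => ?_⟩
    rcases hb with rfl | hb
    · exact h2.ne'
    · exact h1.1 b hb

theorem exists_regularVector_mem_weylCone (hR : R.Finite) (h0 : ∀ a ∈ R, a ≠ 0) (u : V) :
    ∃ v, RegularVector R v ∧ u ∈ weylCone R v := by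
  obtain ⟨g, hg⟩ := exists_regularVector hR h0
  obtain ⟨ε, h1, h2, -⟩ := (hg.eventually_add_smul hR u).exists
  exact ⟨_, h1, h2⟩

theorem exists_finset_weylCone_cover (hR : R.Finite) (h0 : ∀ a ∈ R, a ≠ 0) :
    ∃ F : Finset V, (∀ v ∈ F, RegularVector R v) ∧ ∀ u, ∃ v ∈ F, u ∈ weylCone R v := by
  classical
  let T : Set V → Set V := fun P =>
    {u | ∀ a ∈ R, (a ∈ P → 0 ≤ ⟪a, u⟫) ∧ (a ∉ P → ⟪a, u⟫ ≤ 0)}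
  have hfin : (weylCone R '' {v | RegularVector R v}).Finite := by
    refine (hR.finite_subsets.image T).subset ?_
    rintro _ ⟨v, hv, rfl⟩
    refine ⟨{a ∈ R | 0 < ⟪a, v⟫}, sep_subset _ _, ?_⟩
    ext u
    refine forall₂_congr fun a ha => ?_
    rcases lt_or_gt_of_ne (hv a ha) with h | h
    · simp only [mem_ofPred_eq, ha, true_and, h.not_gt, false_implies, not_false_eq_true,
        true_implies]
      exact ⟨fun h' => by nlinarith, fun h' => by nlinarith⟩
    · simp only [mem_ofPred_eq, ha, h, not_true_eq_false, false_implies,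
        true_implies, and_true]
      exact (mul_nonneg_iff_of_pos_left h).symm
  obtain ⟨s, hs, hsi⟩ := exists_subset_bijOn {v | RegularVector R v} (weylCone R)
  have hsf : s.Finite := by
    refine Finite.of_finite_image ?_ hsi.injOn
    rwa [hsi.image_eq]
  refine ⟨hsf.toFinset, fun v hv => hs (hsf.mem_toFinset.1 hv), fun u => ?_⟩
  obtain ⟨v, hv, hu⟩ := exists_regularVector_mem_weylCone hR h0 u
  obtain ⟨w, hw, hwv⟩ := hsi.surjOn (mem_image_of_mem _ hv)
  exact ⟨w, hsf.mem_toFinset.2 hw, hwv ▸ hu⟩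

theorem eq_of_dist_eq_on_weylCone (hR : R.Finite) (hv : RegularVector R v) {r s : V}
    (h : ∀ c ∈ weylCone R v, dist c r = dist c s) : r = s := by
  have key : ∀ c ∈ weylCone R v, ⟪c, r - s⟫ = 0 := by
    have h0 := h 0 (zero_mem_weylCone v)
    rw [dist_zero_left, dist_zero_left] at h0
    intro c hc
    have h1 := h c hc
    rw [dist_eq_norm, dist_eq_norm] at h1
    have h2 := norm_sub_sq_real c r
    have h3 := norm_sub_sq_real c s
    rw [h1, h3, h0] at h2
    rw [inner_sub_right]
    linarith
  obtain ⟨T, hT, h1⟩ := hv.exists_forall_add_smul_mem hR (r - s)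
  have h2 := key _ (h1 T le_rfl)
  rw [inner_add_left, key _ (smul_mem_weylCone hT (self_mem_weylCone v)), add_zero] at h2
  exact sub_eq_zero.1 (inner_self_eq_zero.1 h2)

theorem linearIsometryEquiv_eq_of_eqOn_weylCone (hR : R.Finite) (hv : RegularVector R v)
    {L : V ≃ₗᵢ[ℝ] V} (h : ∀ c ∈ weylCone R v, L c = c) (x : V) : L x = x := by
  obtain ⟨T, hT, h1⟩ := hv.exists_forall_add_smul_mem hR x
  have h2 := h _ (h1 T le_rfl)
  rw [map_add, h _ (smul_mem_weylCone hT (self_mem_weylCone v))] at h2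
  exact add_right_cancel h2

theorem map_mem_weylCone_iff {L : V ≃ₗᵢ[ℝ] V} (hL : ∀ a ∈ R, L.symm a ∈ R)
    (hL' : ∀ a ∈ R, L a ∈ R) : L u ∈ weylCone R (L v) ↔ u ∈ weylCone R v := by
  constructor
  · intro h a ha
    simpa using h (L a) (hL' a ha)
  · intro h a ha
    have := h (L.symm a) (hL a ha)
    rwa [← L.inner_map_map, ← L.inner_map_map (L.symm a), L.apply_symm_apply] at this

theorem RegularVector.map {L : V ≃ₗᵢ[ℝ] V} (hL : ∀ a ∈ R, L.symm a ∈ R)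
    (hv : RegularVector R v) : RegularVector R (L v) := fun a ha => by
  have := hv (L.symm a) (hL a ha)
  rwa [← L.inner_map_map, L.apply_symm_apply] at this

end Cones

section Systems

open Filter Topology
open scoped RealInnerProductSpace

/-- A family of isometric charts from a Euclidean space to a metric space, modelled on a finite
root system, with the properties of the charts of a Euclidean building, written in terms of
roots, Weyl cones and affine maps. -/
structure ChartSystem (V X : Type*) [NormedAddCommGroup V] [InnerProductSpace ℝ V]
    [MetricSpace X] where
  roots : Set V
  finite_roots : roots.Finite
  norm_root : ∀ a ∈ roots, ‖a‖ = 1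
  G : Subgroup (V ≃ₗᵢ[ℝ] V)
  finite_G : Finite G
  map_root : ∀ L ∈ G, ∀ a ∈ roots, L a ∈ roots
  reflection_mem : ∀ a ∈ roots, hyperplaneReflection a ∈ G
  charts : Set (V → X)
  isom : ∀ f ∈ charts, Isometry f
  comp_mem : ∀ f ∈ charts, ∀ L ∈ G, ∀ b : V, (fun x => f (L x + b)) ∈ charts
  isClosed_preimage : ∀ f ∈ charts, ∀ g ∈ charts, IsClosed {x | f x ∈ range g}
  convex_preimage : ∀ f ∈ charts, ∀ g ∈ charts, Convex ℝ {x | f x ∈ range g}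
  exists_transition : ∀ f ∈ charts, ∀ g ∈ charts,
    ∃ L ∈ G, ∃ b : V, ∀ z, f z ∈ range g → f z = g (L z + b)
  exists_joint : ∀ f ∈ charts, ∀ g ∈ charts, ∀ x y,
    ∃ h ∈ charts, f x ∈ range h ∧ g y ∈ range h
  exists_subsectors : ∀ f ∈ charts, ∀ g ∈ charts, ∀ v u, RegularVector roots v →
    RegularVector roots u → ∃ h ∈ charts, ∃ x y,
      (∀ c ∈ weylCone roots v, f (x + c) ∈ range h) ∧
        ∀ c ∈ weylCone roots u, g (y + c) ∈ range h
  exists_common_point : ∀ f ∈ charts, ∀ g ∈ charts, ∀ h ∈ charts,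
    (∃ a ∈ roots, ∃ c : ℝ, {x | f x ∈ range g} = {x | c ≤ ⟪a, x⟫}) →
    (∃ a ∈ roots, ∃ c : ℝ, {x | g x ∈ range h} = {x | c ≤ ⟪a, x⟫}) →
    (∃ a ∈ roots, ∃ c : ℝ, {x | f x ∈ range h} = {x | c ≤ ⟪a, x⟫}) →
    (range f ∩ range g ∩ range h).Nonempty

/-- Two charts coincide on a translate of the Weyl cone of `v`. -/
def EqOnSubcone {V X : Type*} [NormedAddCommGroup V] [InnerProductSpace ℝ V] (R : Set V)
    (v : V) (f g : V → X) : Prop :=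
  ∃ x, ∀ c ∈ weylCone R v, f (x + c) = g (x + c)

/-- The rate of divergence of the rays with directions `v` and `u` of two charts. -/
def asympDist {V X : Type*} [NormedAddCommGroup V] [InnerProductSpace ℝ V] [MetricSpace X]
    (f : V → X) (v : V) (g : V → X) (u : V) : ℝ :=
  limUnder atTop fun t : ℝ => dist (f (t • v)) (g (t • u)) / t

/-- Two charts map the rays with direction `u` to rays with the same point at infinity. -/
def SameEnd {V X : Type*} [NormedAddCommGroup V] [InnerProductSpace ℝ V] [MetricSpace X]
    (f g : V → X) (u : V) : Prop :=
  asympDist f u g u = 0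

namespace ChartSystem

variable {V X : Type*} [NormedAddCommGroup V] [InnerProductSpace ℝ V] [MetricSpace X]
  (Φ : ChartSystem V X)

/-- The Weyl cone of a vector with respect to the roots of a chart system. -/
abbrev cone (v : V) : Set V := weylCone Φ.roots v

/-- Regularity of vectors with respect to the roots of a chart system. -/
abbrev Reg (v : V) : Prop := RegularVector Φ.roots v

variable {Φ} {f g h k : V → X} {u v w a : V}

theorem ne_zero_of_mem_roots (ha : a ∈ Φ.roots) : a ≠ 0 := by
  rintro rfl
  simpa using Φ.norm_root 0 ha

theorem neg_mem_roots (ha : a ∈ Φ.roots) : -a ∈ Φ.roots := by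
  have h := Φ.map_root _ (Φ.reflection_mem a ha) a ha
  rw [hyperplaneReflection_apply (Φ.norm_root a ha), real_inner_self_eq_norm_sq,
    Φ.norm_root a ha] at h
  convert h using 1
  module

theorem exists_reg_mem_cone (Φ : ChartSystem V X) (u : V) : ∃ v, Φ.Reg v ∧ u ∈ Φ.cone v :=
  exists_regularVector_mem_weylCone Φ.finite_roots (fun _ => ne_zero_of_mem_roots) u

theorem exists_cone_cover (Φ : ChartSystem V X) :
    ∃ F : Finset V, (∀ v ∈ F, Φ.Reg v) ∧ ∀ u, ∃ v ∈ F, u ∈ Φ.cone v :=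
  exists_finset_weylCone_cover Φ.finite_roots fun _ => ne_zero_of_mem_roots

theorem symm_mem {L : V ≃ₗᵢ[ℝ] V} (hL : L ∈ Φ.G) : L.symm ∈ Φ.G := Φ.G.inv_mem hL

theorem trans_mem {L M : V ≃ₗᵢ[ℝ] V} (hL : L ∈ Φ.G) (hM : M ∈ Φ.G) : L.trans M ∈ Φ.G :=
  Φ.G.mul_mem hM hL

theorem reg_map {L : V ≃ₗᵢ[ℝ] V} (hL : L ∈ Φ.G) (hv : Φ.Reg v) : Φ.Reg (L v) :=
  hv.map (Φ.map_root _ (symm_mem hL))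

theorem map_mem_cone_iff {L : V ≃ₗᵢ[ℝ] V} (hL : L ∈ Φ.G) :
    L u ∈ Φ.cone (L v) ↔ u ∈ Φ.cone v :=
  map_mem_weylCone_iff (Φ.map_root _ (symm_mem hL)) (Φ.map_root _ hL)

theorem translate_mem (hf : f ∈ Φ.charts) (b : V) : (fun x => f (x + b)) ∈ Φ.charts :=
  Φ.comp_mem f hf 1 Φ.G.one_mem b

theorem comp_linear_mem (hf : f ∈ Φ.charts) {L : V ≃ₗᵢ[ℝ] V} (hL : L ∈ Φ.G) :
    (fun x => f (L x)) ∈ Φ.charts := by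
  simpa using Φ.comp_mem f hf L hL 0

/-- Two charts agree up to an affine isometry with linear part in `G` on suitable subcones of
given Weyl cones, through a third chart. -/
theorem exists_joint_eqOnSubcone (hf : f ∈ Φ.charts) (hg : g ∈ Φ.charts) (hv : Φ.Reg v)
    (hu : Φ.Reg u) : ∃ h ∈ Φ.charts, ∃ L ∈ Φ.G, ∃ b : V,
      EqOnSubcone Φ.roots v f h ∧ EqOnSubcone Φ.roots u g fun z => h (L z + b) := by
  obtain ⟨h, hh, x, y, hx, hy⟩ := Φ.exists_subsectors f hf g hg v u hv hu
  obtain ⟨L₁, hL₁, b₁, h₁⟩ := Φ.exists_transition f hf h hh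
  obtain ⟨L₂, hL₂, b₂, h₂⟩ := Φ.exists_transition g hg h hh
  refine ⟨fun z => h (L₁ z + b₁), Φ.comp_mem h hh L₁ hL₁ b₁, L₂.trans L₁.symm,
    trans_mem hL₂ (symm_mem hL₁), L₁.symm (b₂ - b₁), ⟨x, fun c hc => h₁ _ (hx c hc)⟩, y,
    fun c hc => ?_⟩
  simp only [h₂ _ (hy c hc), LinearIsometryEquiv.trans_apply, ← map_add,
    LinearIsometryEquiv.apply_symm_apply]
  congr 1
  abel

theorem _root_.EqOnSubcone.dist_le {R : Set V} (hf : Isometry f) (hg : Isometry g)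
    (h : EqOnSubcone R v f g) : ∃ C, ∀ c ∈ weylCone R v, dist (f c) (g c) ≤ C := by
  obtain ⟨x, hx⟩ := h
  refine ⟨‖x‖ + ‖x‖, fun c hc => ?_⟩
  have h1 : dist (f c) (f (x + c)) = ‖x‖ := by rw [hf.dist_eq, dist_eq_norm]; simp
  have h2 : dist (g (x + c)) (g c) = ‖x‖ := by rw [hg.dist_eq, dist_eq_norm]; simp
  have h3 := dist_triangle (f c) (f (x + c)) (g c)
  rw [hx c hc] at h3 h1
  linarith

/-- On a pair of Weyl cones the distance between two charts is, up to a bounded error, given by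
an element of `G`. -/
theorem exists_abs_dist_sub_le (hf : f ∈ Φ.charts) (hg : g ∈ Φ.charts) (hv : Φ.Reg v)
    (hu : Φ.Reg u) : ∃ L ∈ Φ.G, ∃ C, ∀ v' ∈ Φ.cone v, ∀ u' ∈ Φ.cone u,
      |dist (f v') (g u') - dist v' (L u')| ≤ C := by
  obtain ⟨h, hh, L, hL, b, h1, h2⟩ := exists_joint_eqOnSubcone hf hg hv hu
  obtain ⟨C₁, hC₁⟩ := h1.dist_le (Φ.isom f hf) (Φ.isom h hh)
  obtain ⟨C₂, hC₂⟩ := h2.dist_le (Φ.isom g hg) (Φ.isom _ (Φ.comp_mem h hh L hL b))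
  refine ⟨L, hL, C₁ + C₂ + ‖b‖, fun v' hv' u' hu' => ?_⟩
  have e1 := hC₁ v' hv'
  have e2 := hC₂ u' hu'
  have e3 : dist (h v') (h (L u' + b)) = dist v' (L u' + b) := (Φ.isom h hh).dist_eq _ _
  have e4 : dist (L u' + b) (L u') = ‖b‖ := by simp [dist_eq_norm]
  have t1 := dist_triangle4 (f v') (h v') (h (L u' + b)) (g u')
  have t2 := dist_triangle4 (h v') (f v') (g u') (h (L u' + b))
  have t3 := dist_triangle v' (L u' + b) (L u')
  have t4 := dist_triangle v' (L u') (L u' + b)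
  rw [dist_comm (g u')] at t2
  rw [dist_comm (h v') (f v')] at t2
  rw [dist_comm (g u')] at e2
  rw [dist_comm (L u')] at t4
  rw [abs_le]
  constructor <;> linarith [dist_comm (g u') (h (L u' + b))]

theorem _root_.tendsto_div_of_abs_sub_le {φ : ℝ → ℝ} {l C : ℝ}
    (h : ∀ t, 0 ≤ t → |φ t - t * l| ≤ C) : Tendsto (fun t => φ t / t) atTop (𝓝 l) := by
  have h1 : Tendsto (fun t : ℝ => C / t) atTop (𝓝 0) := tendsto_const_nhds.div_atTop tendsto_id
  rw [← tendsto_sub_nhds_zero_iff]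
  refine squeeze_zero_norm' ?_ h1
  filter_upwards [eventually_gt_atTop 0] with t ht
  have : φ t / t - l = (φ t - t * l) / t := by field_simp
  rw [this, Real.norm_eq_abs, abs_div, abs_of_pos ht]
  exact div_le_div_of_nonneg_right (h t ht.le) ht.le

theorem exists_tendsto_asympDist (hf : f ∈ Φ.charts) (hg : g ∈ Φ.charts) (hv : Φ.Reg v)
    (hu : Φ.Reg u) : ∃ L ∈ Φ.G, ∀ v' ∈ Φ.cone v, ∀ u' ∈ Φ.cone u,
      Tendsto (fun t : ℝ => dist (f (t • v')) (g (t • u')) / t) atTop (𝓝 (dist v' (L u'))) := by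
  obtain ⟨L, hL, C, hC⟩ := exists_abs_dist_sub_le hf hg hv hu
  refine ⟨L, hL, fun v' hv' u' hu' => tendsto_div_of_abs_sub_le (C := C) fun t ht => ?_⟩
  have := hC _ (smul_mem_weylCone ht hv') _ (smul_mem_weylCone ht hu')
  rwa [map_smul, dist_smul₀, Real.norm_of_nonneg ht] at this

/-- On a pair of Weyl cones the asymptotic distance is given by an element of `G`. -/
theorem exists_asympDist_eq (hf : f ∈ Φ.charts) (hg : g ∈ Φ.charts) (hv : Φ.Reg v)
    (hu : Φ.Reg u) : ∃ L ∈ Φ.G, ∀ v' ∈ Φ.cone v, ∀ u' ∈ Φ.cone u,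
      asympDist f v' g u' = dist v' (L u') := by
  obtain ⟨L, hL, h⟩ := exists_tendsto_asympDist hf hg hv hu
  exact ⟨L, hL, fun v' hv' u' hu' => (h v' hv' u' hu').limUnder_eq⟩

theorem tendsto_asympDist (hf : f ∈ Φ.charts) (hg : g ∈ Φ.charts) (v u : V) :
    Tendsto (fun t : ℝ => dist (f (t • v)) (g (t • u)) / t) atTop (𝓝 (asympDist f v g u)) := by
  obtain ⟨v', hv', hv⟩ := Φ.exists_reg_mem_cone v
  obtain ⟨u', hu', hu⟩ := Φ.exists_reg_mem_cone u
  obtain ⟨L, -, h⟩ := exists_tendsto_asympDist hf hg hv' hu'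
  exact tendsto_nhds_limUnder ⟨_, h v hv u hu⟩

theorem asympDist_nonneg (hf : f ∈ Φ.charts) (hg : g ∈ Φ.charts) (v u : V) :
    0 ≤ asympDist f v g u := by
  refine ge_of_tendsto (tendsto_asympDist hf hg v u) ?_
  filter_upwards [eventually_ge_atTop 0] with t ht
  positivity

theorem asympDist_comm (f : V → X) (v : V) (g : V → X) (u : V) :
    asympDist f v g u = asympDist g u f v := by
  simp only [asympDist, dist_comm]

theorem asympDist_triangle (hf : f ∈ Φ.charts) (hg : g ∈ Φ.charts) (hh : h ∈ Φ.charts)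
    (v u w : V) : asympDist f v h w ≤ asympDist f v g u + asympDist g u h w := by
  refine le_of_tendsto_of_tendsto (tendsto_asympDist hf hh v w)
    ((tendsto_asympDist hf hg v u).add (tendsto_asympDist hg hh u w)) ?_
  filter_upwards [eventually_gt_atTop 0] with t ht
  rw [← add_div]
  exact div_le_div_of_nonneg_right (dist_triangle _ _ _) ht.le

/-- Charts at bounded distance along a pair of rays have the same asymptotic distances. -/
theorem asympDist_eq_zero_of_dist_le {C : ℝ}
    (h : ∀ t : ℝ, 0 ≤ t → dist (f (t • v)) (g (t • u)) ≤ C) : asympDist f v g u = 0 := by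
  refine (tendsto_div_of_abs_sub_le (C := C) fun t ht => ?_).limUnder_eq
  simpa [abs_of_nonneg dist_nonneg] using h t ht

theorem asympDist_self (hf : Isometry f) (v u : V) : asympDist f v f u = dist v u := by
  refine (tendsto_div_of_abs_sub_le (C := 0) fun t ht => ?_).limUnder_eq
  rw [hf.dist_eq, dist_smul₀, Real.norm_of_nonneg ht]
  simp

theorem asympDist_congr_right (hf : f ∈ Φ.charts) (hg : g ∈ Φ.charts) (hh : h ∈ Φ.charts)
    (hz : asympDist g u h w = 0) : asympDist f v g u = asympDist f v h w := by
  refine le_antisymm ?_ ?_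
  · have := asympDist_triangle hf hh hg v w u
    rwa [asympDist_comm h, hz, add_zero] at this
  · have := asympDist_triangle hf hg hh v u w
    rwa [hz, add_zero] at this

theorem asympDist_comp (hf : f ∈ Φ.charts) (hg : g ∈ Φ.charts) {L : V ≃ₗᵢ[ℝ] V}
    (hL : L ∈ Φ.G) (b v u : V) :
    asympDist f v (fun x => g (L x + b)) u = asympDist f v g (L u) := by
  refine asympDist_congr_right hf (Φ.comp_mem g hg L hL b) hg
    (asympDist_eq_zero_of_dist_le (C := ‖b‖) fun t _ => ?_)
  rw [(Φ.isom g hg).dist_eq, dist_eq_norm, map_smul]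
  simp

theorem asympDist_comp_linear (hf : f ∈ Φ.charts) (hg : g ∈ Φ.charts) {L : V ≃ₗᵢ[ℝ] V}
    (hL : L ∈ Φ.G) (v u : V) :
    asympDist f v (fun x => g (L x)) u = asympDist f v g (L u) := by
  simpa using asympDist_comp hf hg hL 0 v u

theorem asympDist_translate (hf : f ∈ Φ.charts) (hg : g ∈ Φ.charts) (b v u : V) :
    asympDist f v (fun x => g (x + b)) u = asympDist f v g u :=
  asympDist_comp hf hg Φ.G.one_mem b v u

theorem _root_.EqOnSubcone.asympDist_eq_zero {R : Set V} (hf : Isometry f) (hg : Isometry g)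
    (h : EqOnSubcone R v f g) (hu : u ∈ weylCone R v) : SameEnd f g u := by
  obtain ⟨C, hC⟩ := h.dist_le hf hg
  exact asympDist_eq_zero_of_dist_le fun t ht => hC _ (smul_mem_weylCone ht hu)

theorem sameEnd_refl (hf : Isometry f) (u : V) : SameEnd f f u := by
  rw [SameEnd, asympDist_self hf, dist_self]

theorem _root_.SameEnd.symm (h : SameEnd f g u) : SameEnd g f u := by
  rw [SameEnd, asympDist_comm]; exact h

theorem sameEnd_trans (hf : f ∈ Φ.charts) (hg : g ∈ Φ.charts) (hh : h ∈ Φ.charts)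
    (h1 : SameEnd f g u) (h2 : SameEnd g h u) : SameEnd f h u := by
  rw [SameEnd, ← asympDist_congr_right hf hg hh h2]; exact h1

theorem sameEnd_translate_left (hf : f ∈ Φ.charts) (hg : g ∈ Φ.charts) (b : V) :
    SameEnd (fun x => f (x + b)) g u ↔ SameEnd f g u := by
  rw [SameEnd, asympDist_comm, asympDist_translate hg hf, asympDist_comm, SameEnd]

/-- If two charts are asymptotic on a Weyl cone, then asymptotic distances between rays of
the cone are the Euclidean ones. -/
theorem asympDist_eq_dist_of_sameEnd (hf : f ∈ Φ.charts) (hg : g ∈ Φ.charts)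
    (h : SameEnd f g u) (v : V) : asympDist f v g u = dist v u := by
  rw [← asympDist_congr_right hf hf hg h, asympDist_self (Φ.isom f hf)]

end ChartSystem

end Systems

section Ends

open Filter Topology
open scoped RealInnerProductSpace

section Subcones

variable {V X : Type*} [NormedAddCommGroup V] [InnerProductSpace ℝ V] {R : Set V}
  {f g h : V → X} {u v : V}

theorem eqOnSubcone_refl (R : Set V) (v : V) (f : V → X) : EqOnSubcone R v f f :=
  ⟨0, fun _ _ => rfl⟩

theorem EqOnSubcone.symm (h : EqOnSubcone R v f g) : EqOnSubcone R v g f :=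
  h.imp fun _ hx c hc => (hx c hc).symm

theorem EqOnSubcone.add {x : V} (hx : ∀ c ∈ weylCone R v, f (x + c) = g (x + c))
    {z c : V} (hz : z - x ∈ weylCone R v) (hc : c ∈ weylCone R v) : f (z + c) = g (z + c) := by
  have := hx _ (add_mem_weylCone hz hc)
  rwa [show x + (z - x + c) = z + c by abel] at this

theorem EqOnSubcone.translate (h : EqOnSubcone R v f g) (b : V) :
    EqOnSubcone R v (fun x => f (x + b)) fun x => g (x + b) := by
  obtain ⟨x, hx⟩ := h
  refine ⟨x - b, fun c hc => ?_⟩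
  have := hx c hc
  rwa [show x + c = x - b + c + b by abel] at this

end Subcones

namespace ChartSystem

variable {V X : Type*} [NormedAddCommGroup V] [InnerProductSpace ℝ V] [MetricSpace X]
  {Φ : ChartSystem V X} {f g h k : V → X} {u v w a p : V}

theorem exists_sub_mem_cone (hv : Φ.Reg v) (x y : V) :
    ∃ z, z - x ∈ Φ.cone v ∧ z - y ∈ Φ.cone v := by
  obtain ⟨T, -, hT⟩ := hv.exists_forall_add_smul_mem Φ.finite_roots (-x)
  obtain ⟨S, -, hS⟩ := hv.exists_forall_add_smul_mem Φ.finite_roots (-y)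
  refine ⟨max T S • v, ?_, ?_⟩
  · rw [sub_eq_neg_add]; exact hT _ (le_max_left _ _)
  · rw [sub_eq_neg_add]; exact hS _ (le_max_right _ _)

theorem eqOnSubcone_trans (hv : Φ.Reg v) (h1 : EqOnSubcone Φ.roots v f g)
    (h2 : EqOnSubcone Φ.roots v g h) : EqOnSubcone Φ.roots v f h := by
  obtain ⟨x, hx⟩ := h1
  obtain ⟨y, hy⟩ := h2
  obtain ⟨z, hzx, hzy⟩ := exists_sub_mem_cone hv x y
  exact ⟨z, fun c hc => (EqOnSubcone.add hx hzx hc).trans (EqOnSubcone.add hy hzy hc)⟩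

/-- Charts that are asymptotic on a Weyl cone agree on a subcone up to a translation. -/
theorem exists_eqOnSubcone_translate (hf : f ∈ Φ.charts) (hg : g ∈ Φ.charts) (hv : Φ.Reg v)
    (hs : ∀ c ∈ Φ.cone v, SameEnd f g c) :
    ∃ b, EqOnSubcone Φ.roots v f fun z => g (z + b) := by
  obtain ⟨h, hh, L, hL, b, h1, h2⟩ := exists_joint_eqOnSubcone hf hg hv hv
  have hid : ∀ x, L x = x := by
    refine linearIsometryEquiv_eq_of_eqOn_weylCone Φ.finite_roots hv fun c hc => ?_
    have e1 : asympDist f c h c = 0 := h1.asympDist_eq_zero (Φ.isom f hf) (Φ.isom h hh) hc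
    have e2 : asympDist g c (fun z => h (L z + b)) c = 0 :=
      h2.asympDist_eq_zero (Φ.isom g hg) (Φ.isom _ (Φ.comp_mem h hh L hL b)) hc
    have e3 : SameEnd f (fun z => h (L z + b)) c :=
      sameEnd_trans hf hg (Φ.comp_mem h hh L hL b) (hs c hc) e2
    rw [SameEnd, asympDist_comp hf hh hL, asympDist_comm,
      asympDist_congr_right hh hf hh e1, asympDist_self (Φ.isom h hh)] at e3
    exact dist_eq_zero.1 e3
  simp only [hid] at h2
  refine ⟨-b, eqOnSubcone_trans hv h1 ?_⟩
  have := (h2.translate (-b)).symm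
  simpa [add_assoc] using this

/-- Charts that are asymptotic on a Weyl cone have a translation as transition map. -/
theorem exists_transition_translate (hf : f ∈ Φ.charts) (hg : g ∈ Φ.charts) (hv : Φ.Reg v)
    (hs : ∀ c ∈ Φ.cone v, SameEnd f g c) :
    ∃ b, (∀ z, f z ∈ range g → f z = g (z + b)) ∧
      ∃ x, ∀ c ∈ Φ.cone v, f (x + c) = g (x + c + b) := by
  obtain ⟨b, x, hx⟩ := exists_eqOnSubcone_translate hf hg hv hs
  obtain ⟨L, hL, b', h1⟩ := Φ.exists_transition f hf g hg
  have h2 : ∀ c ∈ Φ.cone v, L (x + c) + b' = x + c + b := fun c hc =>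
    (Φ.isom g hg).injective ((h1 _ ⟨_, (hx c hc).symm⟩).symm.trans (hx c hc))
  have h0 : L x + b' = x + b := by simpa using h2 0 (zero_mem_weylCone v)
  have hid : ∀ x, L x = x := by
    refine linearIsometryEquiv_eq_of_eqOn_weylCone Φ.finite_roots hv fun c hc => ?_
    have := h2 c hc
    rw [map_add, add_right_comm, h0, add_right_comm, add_left_inj] at this
    exact add_left_cancel this
  rw [hid] at h0
  have hb := add_left_cancel h0
  refine ⟨b, fun z hz => ?_, x, hx⟩
  rw [h1 z hz, hid, hb]

/-- Charts that are asymptotic on a Weyl cone and agree at a point agree on the Weyl cone based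
at that point. -/
theorem apply_add_eq (hf : f ∈ Φ.charts) (hg : g ∈ Φ.charts) (hv : Φ.Reg v)
    (hs : ∀ c ∈ Φ.cone v, SameEnd f g c) {x y : V} (hxy : f x = g y) {c : V}
    (hc : c ∈ Φ.cone v) : f (x + c) = g (y + c) := by
  obtain ⟨b, h1, x₀, h2⟩ := exists_transition_translate hf hg hv hs
  have hy : y = x + b := (Φ.isom g hg).injective (hxy.symm.trans (h1 x ⟨y, hxy.symm⟩))
  have hmem : x + c ∈ {z | f z ∈ range g} :=
    add_mem_of_ray_subset (Φ.isClosed_preimage f hf g hg) (Φ.convex_preimage f hf g hg)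
      (x := x₀) (fun t ht => ⟨_, (h2 _ (smul_mem_weylCone ht hc)).symm⟩) ⟨y, hxy.symm⟩
  rw [h1 _ hmem, hy, add_right_comm]

theorem sameEnd_smul (hf : f ∈ Φ.charts) (hg : g ∈ Φ.charts) {t : ℝ} (ht : 0 ≤ t)
    (h : SameEnd f g u) : SameEnd f g (t • u) := by
  obtain ⟨v, hv, hu⟩ := Φ.exists_reg_mem_cone u
  obtain ⟨L, -, hL⟩ := exists_asympDist_eq hf hg hv hv
  rw [SameEnd, hL u hu u hu] at h
  rw [SameEnd, hL _ (smul_mem_weylCone ht hu) _ (smul_mem_weylCone ht hu), map_smul,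
    ← dist_eq_zero.1 h, dist_self]

/-- The set of common directions of two charts is convex. -/
theorem sameEnd_of_mem_segment (hf : f ∈ Φ.charts) (hg : g ∈ Φ.charts) {y q z : V}
    (hy : SameEnd f g y) (hq : SameEnd f g q) (hz : z ∈ segment ℝ y q) : SameEnd f g z := by
  obtain ⟨v, hv, hzv⟩ := Φ.exists_reg_mem_cone z
  obtain ⟨F, hF, hcov⟩ := Φ.exists_cone_cover
  have hL : ∀ w ∈ F, ∃ L : V ≃ₗᵢ[ℝ] V, ∀ v' ∈ Φ.cone v, ∀ u' ∈ Φ.cone w,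
      asympDist f v' g u' = dist v' (L u') := fun w hw =>
    (exists_asympDist_eq hf hg hv (hF w hw)).imp fun _ h => h.2
  choose! L hL using hL
  have hR : ∀ u, ∃ r, ∀ v' ∈ Φ.cone v, asympDist f v' g u = dist v' r := fun u => by
    obtain ⟨w, hw, huw⟩ := hcov u
    exact ⟨L w u, fun v' hv' => hL w hw v' hv' u huw⟩
  choose R hR using hR
  have hRL : ∀ w ∈ F, ∀ u ∈ Φ.cone w, R u = L w u := fun w hw u hu =>
    eq_of_dist_eq_on_weylCone Φ.finite_roots hv fun c hc => by rw [← hR u c hc, hL w hw c hc u hu]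
  have hfix : ∀ u, SameEnd f g u → R u = u := fun u hu =>
    eq_of_dist_eq_on_weylCone Φ.finite_roots hv fun c hc => by
      rw [← hR u c hc, asympDist_eq_dist_of_sameEnd hf hg hu]
  rw [segment_eq_image_lineMap] at hz
  obtain ⟨s₀, hs₀, rfl⟩ := hz
  set γ : ℝ → V := fun s => AffineMap.lineMap y q s with hγ
  have hγc : Continuous γ := AffineMap.lineMap_continuous
  have hγd : ∀ s t, s ≤ t → dist (γ s) (γ t) = (t - s) * dist y q := fun s t hst => by
    rw [hγ, dist_lineMap_lineMap, Real.dist_eq, abs_sub_comm, abs_of_nonneg (sub_nonneg.2 hst)]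
  have key : ∀ s t, s ≤ t → dist (R (γ s)) (R (γ t)) ≤ (t - s) * dist y q := fun s t hst => by
    refine rel_of_finite_closed_cover
      (fun s t => dist (R (γ s)) (R (γ t)) ≤ (t - s) * dist y q) (fun r s t h1 h2 => ?_) F
      (fun w => γ ⁻¹' Φ.cone w) (fun w _ => (isClosed_weylCone w).preimage hγc) hst
      (fun r _ => hcov (γ r)) fun w hw r _ r' _ hr hr' hrr' => ?_
    · have := dist_triangle (R (γ r)) (R (γ s)) (R (γ t))
      linarith
    · rw [hRL w hw _ hr, hRL w hw _ hr', (L w).dist_map, hγd r r' hrr']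
  have h0 : γ 0 = y := AffineMap.lineMap_apply_zero _ _
  have h1 : γ 1 = q := AffineMap.lineMap_apply_one _ _
  have hz : R (γ s₀) = γ s₀ := by
    refine eq_of_dist_le_of_mem_segment (x := y) (y := q) ?_ ?_ ?_
    · rw [segment_eq_image_lineMap]; exact ⟨s₀, hs₀, rfl⟩
    · have := key 0 s₀ hs₀.1
      rwa [← hγd 0 s₀ hs₀.1, h0, hfix y hy] at this
    · have := key s₀ 1 hs₀.2
      rwa [← hγd s₀ 1 hs₀.2, h1, hfix q hq] at this
  rw [SameEnd, hR _ _ hzv]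
  exact dist_eq_zero.2 hz.symm

theorem sameEnd_add (hf : f ∈ Φ.charts) (hg : g ∈ Φ.charts) (hu : SameEnd f g u)
    (hw : SameEnd f g w) : SameEnd f g (u + w) := by
  have h1 : SameEnd f g ((1 / 2 : ℝ) • u + (1 / 2 : ℝ) • w) :=
    sameEnd_of_mem_segment hf hg hu hw ⟨1 / 2, 1 / 2, by norm_num, by norm_num, by norm_num, rfl⟩
  have h2 := sameEnd_smul hf hg (t := 2) (by norm_num) h1
  convert h2 using 1
  module

end ChartSystem

section Panels

variable {V : Type*} [NormedAddCommGroup V] [InnerProductSpace ℝ V] {R : Set V} {a p v w u : V}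

/-- A vector in the hyperplane orthogonal to a root `a` which is orthogonal to no root other
than `a` and `-a`. -/
structure IsPanelVector (R : Set V) (a p : V) : Prop where
  mem : a ∈ R
  inner_eq_zero : ⟪a, p⟫ = 0
  inner_ne_zero : ∀ b ∈ R, b ≠ a → b ≠ -a → ⟪b, p⟫ ≠ 0

theorem IsPanelVector.neg (h : IsPanelVector R a p) : IsPanelVector R a (-p) :=
  ⟨h.mem, by simp [h.inner_eq_zero], fun b hb h1 h2 => by simpa using h.inner_ne_zero b hb h1 h2⟩

theorem IsPanelVector.neg_root (h : IsPanelVector R a p) (ha : -a ∈ R) :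
    IsPanelVector R (-a) p :=
  ⟨ha, by simp [h.inner_eq_zero], fun b hb h1 h2 =>
    h.inner_ne_zero b hb (by simpa using h2) h1⟩

theorem exists_isPanelVector (hR : R.Finite) (hnorm : ∀ b ∈ R, ‖b‖ = 1) (ha : a ∈ R) :
    ∃ p, IsPanelVector R a p := by
  have haa : ⟪a, a⟫ = 1 := by rw [real_inner_self_eq_norm_sq, hnorm a ha]; norm_num
  obtain ⟨g, hg⟩ := exists_regularVector
    (R := (fun b : V => b - ⟪a, b⟫ • a) '' {b ∈ R | b ≠ a ∧ b ≠ -a})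
    ((hR.subset (sep_subset _ _)).image _) (by
      rintro _ ⟨b, ⟨hb, h1, h2⟩, rfl⟩ h0
      have hb' : b = ⟪a, b⟫ • a := sub_eq_zero.1 h0
      have hn : |⟪a, b⟫| = 1 := by
        have := congrArg norm hb'
        rwa [norm_smul, hnorm a ha, hnorm b hb, mul_one, Real.norm_eq_abs, eq_comm] at this
      rcases (abs_eq zero_le_one).1 hn with h | h
      · exact h1 (by rw [hb', h, one_smul])
      · exact h2 (by rw [hb', h, neg_one_smul]))
  refine ⟨g - ⟪a, g⟫ • a, ha, ?_, fun b hb h1 h2 h0 => hg _ ⟨b, ⟨hb, h1, h2⟩, rfl⟩ ?_⟩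
  · rw [inner_sub_right, inner_smul_right, haa]; ring
  · rw [inner_sub_right, inner_smul_right] at h0
    rw [real_inner_comm a b] at h0
    rw [inner_sub_left, real_inner_smul_left]
    linarith

theorem IsPanelVector.mul_pos (h : IsPanelVector R a p) (hv : RegularVector R v)
    (hp : p ∈ weylCone R v) {b : V} (hb : b ∈ R) (h1 : b ≠ a) (h2 : b ≠ -a) :
    0 < ⟪b, v⟫ * ⟪b, p⟫ :=
  lt_of_le_of_ne (hp b hb) (mul_ne_zero (hv b hb) (h.inner_ne_zero b hb h1 h2)).symm

theorem IsPanelVector.exists_forall_add_smul_mem (h : IsPanelVector R a p) (hR : R.Finite)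
    (hv : RegularVector R v) (hp : p ∈ weylCone R v) (hu : 0 ≤ ⟪a, v⟫ * ⟪a, u⟫) :
    ∃ T : ℝ, 0 ≤ T ∧ ∀ t, T ≤ t → u + t • p ∈ weylCone R v := by
  refine exists_forall_add_smul_mem_weylCone hR fun b hb => ?_
  by_cases h1 : b = a
  · right; rw [h1, h.inner_eq_zero]; exact ⟨hu, by simp⟩
  by_cases h2 : b = -a
  · right; rw [h2]; simpa [h.inner_eq_zero] using hu
  exact Or.inl (h.mul_pos hv hp hb h1 h2)

end Panels

namespace ChartSystem

variable {V X : Type*} [NormedAddCommGroup V] [InnerProductSpace ℝ V] [MetricSpace X]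
  {Φ : ChartSystem V X} {f g h k : V → X} {u v w a p : V}

theorem sameEnd_halfSpace (hf : f ∈ Φ.charts) (hg : g ∈ Φ.charts) (hv : Φ.Reg v)
    (hp : IsPanelVector Φ.roots a p) (hpv : -p ∈ Φ.cone v) (hs : ∀ c ∈ Φ.cone v, SameEnd f g c)
    (hsp : SameEnd f g p) (hu : 0 ≤ ⟪a, v⟫ * ⟪a, u⟫) : SameEnd f g u := by
  obtain ⟨T, hT, h⟩ := hp.neg.exists_forall_add_smul_mem Φ.finite_roots hv hpv hu
  have := sameEnd_add hf hg (hs _ (h T le_rfl)) (sameEnd_smul hf hg hT hsp)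
  simpa using this

end ChartSystem

end Ends

section Folding

open Filter Topology
open scoped RealInnerProductSpace

theorem hyperplaneReflection_neg {V : Type*} [NormedAddCommGroup V] [InnerProductSpace ℝ V]
    (a : V) : hyperplaneReflection (-a) = hyperplaneReflection a := by
  simp only [hyperplaneReflection]
  congr 2
  rw [← Set.neg_singleton, Submodule.span_neg]

namespace ChartSystem

variable {V X : Type*} [NormedAddCommGroup V] [InnerProductSpace ℝ V] [MetricSpace X]
  {Φ : ChartSystem V X} {f g h k : V → X} {u v w m a p : V}

theorem exists_reg_mem_cone_of_inner_nonneg (ha : a ∈ Φ.roots) (hu : 0 ≤ ⟪a, u⟫) :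
    ∃ w, Φ.Reg w ∧ u ∈ Φ.cone w ∧ 0 < ⟪a, w⟫ := by
  obtain ⟨g, hg, hag⟩ : ∃ g, Φ.Reg g ∧ 0 < ⟪a, g⟫ := by
    obtain ⟨g, hg, -⟩ := Φ.exists_reg_mem_cone 0
    rcases lt_or_gt_of_ne (hg a ha) with h | h
    · exact ⟨-g, hg.neg, by simpa using h⟩
    · exact ⟨g, hg, h⟩
  obtain ⟨ε, h1, h2, h3⟩ := (hg.eventually_add_smul Φ.finite_roots u).exists
  refine ⟨_, h1, h2, ?_⟩
  rcases hu.eq_or_lt with h0 | h0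
  · exact pos_of_mul_pos_right (h3 a ha h0.symm) hag.le
  · refine lt_of_le_of_ne ?_ (h1 a ha).symm
    exact nonneg_of_mul_nonneg_left (h2 a ha) h0

/-- Charts asymptotic on a half-space which agree at a point agree on the half-space based at
that point. -/
theorem apply_add_eq_of_halfSpace (hf : f ∈ Φ.charts) (hg : g ∈ Φ.charts) (ha : a ∈ Φ.roots)
    (hs : ∀ u, 0 ≤ ⟪a, u⟫ → SameEnd f g u) {x y : V} (hxy : f x = g y) (hu : 0 ≤ ⟪a, u⟫) :
    f (x + u) = g (y + u) := by
  obtain ⟨w, hw, huw, haw⟩ := exists_reg_mem_cone_of_inner_nonneg ha hu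
  exact apply_add_eq hf hg hw
    (fun c hc => hs c (nonneg_of_mul_nonneg_right (hc a ha) haw)) hxy huw

/-- Charts asymptotic in all directions which meet have the same image. -/
theorem mem_range_of_sameEnd (hf : f ∈ Φ.charts) (hg : g ∈ Φ.charts)
    (hs : ∀ u, SameEnd f g u) (x : V) : f x ∈ range g := by
  obtain ⟨v, hv, -⟩ := Φ.exists_reg_mem_cone 0
  obtain ⟨b, -, y, hy⟩ := exists_transition_translate hf hg hv fun c _ => hs c
  obtain ⟨w, hw, hxw⟩ := Φ.exists_reg_mem_cone (x - y)
  have h0 : f y = g (y + b) := by simpa using hy 0 (zero_mem_weylCone v)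
  have := apply_add_eq hf hg hw (fun c _ => hs c) h0 hxw
  rw [add_sub_cancel] at this
  exact ⟨_, this.symm⟩

theorem preimage_eq_univ_or_halfSpace (hf : f ∈ Φ.charts) (hg : g ∈ Φ.charts)
    (ha : a ∈ Φ.roots) (hs : ∀ u, 0 ≤ ⟪a, u⟫ → SameEnd f g u) :
    (∀ x, f x ∈ range g) ∨ ∃ c : ℝ, {x | f x ∈ range g} = {x | c ≤ ⟪a, x⟫} := by
  by_cases hall : {x | f x ∈ range g} = univ
  · exact Or.inl fun x => (eq_univ_iff_forall.1 hall) x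
  right
  refine eq_halfSpace (Φ.isClosed_preimage f hf g hg) (Φ.norm_root a ha) ?_ hall ?_
  · obtain ⟨w, hw, -, haw⟩ := exists_reg_mem_cone_of_inner_nonneg ha (u := 0) (by simp)
    obtain ⟨b, -, y, hy⟩ := exists_transition_translate hf hg hw
      fun c hc => hs c (nonneg_of_mul_nonneg_right (hc a ha) haw)
    exact ⟨_, _, (hy 0 (zero_mem_weylCone w)).symm⟩
  · rintro x ⟨y, hy⟩ u hu
    exact ⟨_, (apply_add_eq_of_halfSpace hf hg ha hs hy.symm hu).symm⟩

theorem reg_reflection (ha : a ∈ Φ.roots) (hv : Φ.Reg v) :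
    Φ.Reg (hyperplaneReflection a v) := reg_map (Φ.reflection_mem a ha) hv

theorem mem_cone_reflection_iff (ha : a ∈ Φ.roots) :
    u ∈ Φ.cone (hyperplaneReflection a v) ↔ hyperplaneReflection a u ∈ Φ.cone v := by
  rw [← map_mem_cone_iff (v := v) (Φ.reflection_mem a ha), hyperplaneReflection_involutive]

theorem mem_cone_reflection_of_inner_eq_zero (ha : a ∈ Φ.roots) (hu : ⟪a, u⟫ = 0) :
    u ∈ Φ.cone (hyperplaneReflection a v) ↔ u ∈ Φ.cone v := by
  rw [mem_cone_reflection_iff ha,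
    hyperplaneReflection_of_inner_eq_zero (Φ.norm_root a ha) hu]

/-- Folding along a panel at infinity: a chart whose boundary contains a panel at infinity of a
chamber can be modified on one half-space so that its boundary contains that chamber. -/
theorem exists_fold (hf : f ∈ Φ.charts) (hk : k ∈ Φ.charts) (hp : IsPanelVector Φ.roots a p)
    (hm : Φ.Reg m) (ham : ⟪a, m⟫ < 0) (hpm : p ∈ Φ.cone m)
    (hs : ∀ q ∈ Φ.cone m, ⟪a, q⟫ = 0 → SameEnd f k q) :
    ∃ g ∈ Φ.charts, (∀ u, 0 ≤ ⟪a, u⟫ → SameEnd f g u) ∧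
      ((∀ u ∈ Φ.cone m, SameEnd g k u) ∨
        ∀ u ∈ Φ.cone m, asympDist g (hyperplaneReflection a u) k u = 0) := by
  obtain ⟨h, hh, L, hL, b, h1, h2⟩ := exists_joint_eqOnSubcone hf hk hm.neg hm
  have e1 : ∀ c ∈ Φ.cone (-m), SameEnd f h c := fun c hc =>
    h1.asympDist_eq_zero (Φ.isom f hf) (Φ.isom h hh) hc
  have e2 : ∀ c ∈ Φ.cone m, asympDist k c h (L c) = 0 := fun c hc => by
    rw [← asympDist_comp hk hh hL b]
    exact h2.asympDist_eq_zero (Φ.isom k hk) (Φ.isom _ (Φ.comp_mem h hh L hL b)) hc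
  have hfix : ∀ q ∈ Φ.cone m, ⟪a, q⟫ = 0 → L q = q := fun q hq haq => by
    have d1 : asympDist f (-q) k q = dist (-q) q :=
      asympDist_eq_dist_of_sameEnd hf hk (hs q hq haq) _
    have d2 : asympDist f (-q) k q = dist (-q) (L q) := by
      rw [asympDist_congr_right hf hk hh (e2 q hq), asympDist_comm,
        asympDist_congr_right hh hf hh (e1 _ (neg_mem_weylCone_neg hq)),
        asympDist_self (Φ.isom h hh), dist_comm]
    have d3 : ‖q + L q‖ = 2 * ‖q‖ := by
      have d4 := d2.symm.trans d1
      rw [dist_eq_norm, dist_eq_norm] at d4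
      rw [show q + L q = -(-q - L q) by abel, norm_neg, d4,
        show -q - q = (-2 : ℝ) • q by module, norm_smul]
      norm_num
    have d5 := parallelogram_law_with_norm ℝ q (L q)
    rw [d3, L.norm_map] at d5
    have d6 : ‖q - L q‖ = 0 := by nlinarith [norm_nonneg (q - L q)]
    exact (sub_eq_zero.1 (norm_eq_zero.1 d6)).symm
  have hfix' : ∀ q, ⟪a, q⟫ = 0 → L q = q := fun q hq => by
    obtain ⟨T, hT, h3⟩ := hp.exists_forall_add_smul_mem Φ.finite_roots hm hpm (u := q)
      (by simp [hq])
    have h4 := hfix _ (h3 T le_rfl)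
      (by rw [inner_add_right, inner_smul_right, hq, hp.inner_eq_zero]; simp)
    rw [map_add, map_smul, hfix p hpm hp.inner_eq_zero] at h4
    exact add_right_cancel h4
  have hsp : SameEnd f h p := by
    refine sameEnd_trans hf hk hh (hs p hpm hp.inner_eq_zero) ?_
    have := e2 p hpm
    rwa [hfix p hpm hp.inner_eq_zero] at this
  refine ⟨h, hh, fun u hu => ?_, ?_⟩
  · refine sameEnd_halfSpace hf hh hm.neg hp (neg_mem_weylCone_neg hpm) e1 hsp ?_
    rw [inner_neg_right]
    exact mul_nonneg (neg_nonneg.2 ham.le) hu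
  · rcases eq_id_or_eq_hyperplaneReflection (Φ.norm_root a hp.mem) L hfix' with h3 | h3
    · refine Or.inl fun u hu => SameEnd.symm ?_
      have := e2 u hu
      rwa [h3] at this
    · refine Or.inr fun u hu => ?_
      have := e2 u hu
      rwa [h3, asympDist_comm] at this

/-- If in the situation of `exists_fold` the chart is also asymptotic to `k` on the opposite
side of the panel, then the folded chart is asymptotic to `k` on the chamber. -/
theorem exists_fold_of_sameEnd (hf : f ∈ Φ.charts) (hk : k ∈ Φ.charts)
    (hp : IsPanelVector Φ.roots a p) (hv : Φ.Reg v) (hav : 0 < ⟪a, v⟫) (hpv : p ∈ Φ.cone v)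
    (hs : ∀ q ∈ Φ.cone v, SameEnd f k q) :
    ∃ g ∈ Φ.charts, (∀ u, 0 ≤ ⟪a, u⟫ → SameEnd f g u) ∧
      ∀ u ∈ Φ.cone (hyperplaneReflection a v), SameEnd g k u := by
  have hn := Φ.norm_root a hp.mem
  obtain ⟨g, hg, h1, h2⟩ := exists_fold hf hk hp (reg_reflection hp.mem hv)
    (by rw [inner_hyperplaneReflection hn]; linarith)
    ((mem_cone_reflection_of_inner_eq_zero hp.mem hp.inner_eq_zero).2 hpv)
    fun q hq haq => hs q ((mem_cone_reflection_of_inner_eq_zero hp.mem haq).1 hq)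
  refine ⟨g, hg, h1, h2.resolve_right fun h3 => ?_⟩
  have h4 := h3 _ (self_mem_weylCone _)
  rw [hyperplaneReflection_involutive] at h4
  have h5 : SameEnd k g v := sameEnd_trans hk hf hg (hs v (self_mem_weylCone v)).symm (h1 v hav.le)
  rw [asympDist_comm, ← asympDist_congr_right hk hk hg h5, asympDist_self (Φ.isom k hk)] at h4
  have h6 := inner_hyperplaneReflection hn v
  rw [dist_eq_zero.1 h4] at h6
  linarith

/-- A chart whose boundary contains a panel at infinity of a chamber is covered by two charts
whose boundaries contain that chamber. -/
theorem exists_cover_pair (hf : f ∈ Φ.charts) (hk : k ∈ Φ.charts)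
    (hp : IsPanelVector Φ.roots a p) (hm : Φ.Reg m) (ham : ⟪a, m⟫ < 0) (hpm : p ∈ Φ.cone m)
    (hs : ∀ q ∈ Φ.cone m, ⟪a, q⟫ = 0 → SameEnd f k q) :
    ∃ 𝓖 : Set (V → X), 𝓖.Finite ∧ 𝓖 ⊆ Φ.charts ∧ (∀ x, ∃ g ∈ 𝓖, f x ∈ range g) ∧
      ∀ g ∈ 𝓖, (∀ u ∈ Φ.cone m, SameEnd g k u) ∧
        ∀ x y q, ⟪a, q⟫ = 0 → f x = g y → f (x + q) = g (y + q) := by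
  have ha := hp.mem
  have hn := Φ.norm_root a ha
  have hrefl : ∀ q, ⟪a, q⟫ = 0 → hyperplaneReflection a q = q := fun q =>
    hyperplaneReflection_of_inner_eq_zero hn
  set f' : V → X := fun x => f (hyperplaneReflection a x) with hf'
  have hf'm : f' ∈ Φ.charts := comp_linear_mem hf (Φ.reflection_mem a ha)
  obtain ⟨g, hg, h1, h2 | h2⟩ := exists_fold hf hk hp hm ham hpm hs
  swap
  · refine ⟨{f'}, finite_singleton _, by simpa using hf'm, fun x => ⟨f', rfl, _,
      congrArg f (hyperplaneReflection_involutive a x)⟩, ?_⟩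
    rintro _ rfl
    refine ⟨fun u hu => ?_, fun x y q hq hxy => ?_⟩
    · have h3 : SameEnd f g (hyperplaneReflection a u) := by
        refine h1 _ ?_
        rw [inner_hyperplaneReflection hn]
        have := hu a ha
        nlinarith
      rw [SameEnd, asympDist_comm, asympDist_comp_linear hk hf (Φ.reflection_mem a ha),
        asympDist_congr_right hk hf hg h3, asympDist_comm]
      exact h2 u hu
    · have := (Φ.isom f hf).injective hxy
      simp only [hf', map_add, hrefl q hq, this]
  have hgk : ∀ x y q, ⟪a, q⟫ = 0 → f x = g y → f (x + q) = g (y + q) := fun x y q hq hxy =>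
    apply_add_eq_of_halfSpace hf hg ha h1 hxy hq.ge
  rcases preimage_eq_univ_or_halfSpace hf hg ha h1 with h3 | ⟨α, hα⟩
  · refine ⟨{g}, finite_singleton _, by simpa using hg, fun x => ⟨g, rfl, h3 x⟩, ?_⟩
    rintro _ rfl
    exact ⟨h2, hgk⟩
  by_cases hall : ∀ x, f x ∈ range g
  · refine ⟨{g}, finite_singleton _, by simpa using hg, fun x => ⟨g, rfl, hall x⟩, ?_⟩
    rintro _ rfl
    exact ⟨h2, hgk⟩
  have hna := neg_mem_roots ha
  have hff' : ∀ q, ⟪a, q⟫ = 0 → SameEnd f f' q := fun q hq => by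
    rw [SameEnd, asympDist_comp_linear hf hf (Φ.reflection_mem a ha), hrefl q hq,
      asympDist_self (Φ.isom f hf), dist_self]
  have hap : 0 < ⟪a, hyperplaneReflection a m⟫ := by
    rw [inner_hyperplaneReflection hn]; linarith
  have hreg := reg_reflection ha hm
  have hpm' : p ∈ Φ.cone (hyperplaneReflection a m) :=
    (mem_cone_reflection_of_inner_eq_zero ha hp.inner_eq_zero).2 hpm
  obtain ⟨g', hg', h4, h5⟩ := exists_fold hg hf'm (hp.neg_root hna) hreg
    (by rw [inner_neg_left]; linarith) hpm' fun q _ hq => by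
      have hq : ⟪a, q⟫ = 0 := by simpa using hq
      exact sameEnd_trans hg hf hf'm (h1 q hq.ge).symm (hff' q hq)
  have h4' : ∀ u, ⟪a, u⟫ ≤ 0 → SameEnd g g' u := fun u hu => h4 u (by simpa using hu)
  have hle : ∀ u ∈ Φ.cone m, ⟪a, u⟫ ≤ 0 := fun u hu => by
    have := hu a ha
    nlinarith
  have hnp : ⟪a, -p⟫ = 0 := by simp [hp.inner_eq_zero]
  rcases h5 with h5 | h5
  swap
  · refine absurd (fun x => mem_range_of_sameEnd hf hg (fun u => ?_) x) hall
    rcases le_total 0 ⟪a, u⟫ with hu | hu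
    · exact h1 u hu
    refine sameEnd_halfSpace hf hg hm hp.neg (by simpa using hpm) (fun c hc => ?_)
      (h1 _ hnp.ge) (mul_nonneg_of_nonpos_of_nonpos ham.le hu)
    have h6 := h5 (hyperplaneReflection a c)
      ((mem_cone_reflection_iff ha).2 (by rwa [hyperplaneReflection_involutive]))
    rw [hyperplaneReflection_neg, hyperplaneReflection_involutive,
      asympDist_comp_linear hg' hf (Φ.reflection_mem a ha), hyperplaneReflection_involutive] at h6
    exact (sameEnd_trans hg hg' hf (h4' c (hle c hc)) h6).symm
  have h6 : ∀ u, 0 ≤ ⟪a, u⟫ → SameEnd f' g' u := fun u hu =>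
    sameEnd_halfSpace hf'm hg' hreg hp.neg (by simpa using hpm') (fun c hc => (h5 c hc).symm)
      (sameEnd_trans hf'm hf hg' (hff' _ hnp).symm
        (sameEnd_trans hf hg hg' (h1 _ hnp.ge) (h4' _ hnp.le))) (mul_nonneg hap.le hu)
  have hcover : ∀ x, f x ∈ range g ∨ f x ∈ range g' := by
    by_contra! hx
    obtain ⟨x, hx1, hx2⟩ := hx
    have hfg' : ∀ z, f z ∈ range g' ↔ f' (hyperplaneReflection a z) ∈ range g' := fun z => by
      simp only [hf', hyperplaneReflection_involutive]
    obtain ⟨β, hβ⟩ := (preimage_eq_univ_or_halfSpace hf'm hg' ha h6).resolve_left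
      fun h => hx2 ((hfg' x).2 (h _))
    have hβ' : {z | f z ∈ range g'} = {z | β ≤ ⟪-a, z⟫} := by
      ext z
      have := Set.ext_iff.1 hβ (hyperplaneReflection a z)
      simp only [mem_ofPred_eq, inner_hyperplaneReflection hn] at this
      rw [mem_ofPred_eq, mem_ofPred_eq, hfg', this, inner_neg_left]
    obtain ⟨γ, hγ⟩ := (preimage_eq_univ_or_halfSpace hg hg' hna h4).resolve_left fun h => by
      have hsame : SameEnd g g' (hyperplaneReflection a m) := by
        obtain ⟨b, hb, -⟩ := exists_transition_translate hg hg' hreg.neg fun c hc => h4' c (by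
          have := hc a ha
          rw [inner_neg_right] at this
          nlinarith)
        refine asympDist_eq_zero_of_dist_le (C := ‖b‖) fun t _ => ?_
        rw [hb _ (h _), (Φ.isom g' hg').dist_eq, dist_eq_norm]
        simp
      have h7 : SameEnd f f' (hyperplaneReflection a m) :=
        sameEnd_trans hf hg hf'm (h1 _ hap.le)
          (sameEnd_trans hg hg' hf'm hsame (h6 _ hap.le).symm)
      rw [SameEnd, asympDist_comp_linear hf hf (Φ.reflection_mem a ha),
        asympDist_self (Φ.isom f hf), hyperplaneReflection_involutive] at h7
      rw [dist_eq_zero.1 h7] at hap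
      linarith
    obtain ⟨_, ⟨⟨y, rfl⟩, hy1⟩, hy2⟩ := Φ.exists_common_point f hf g hg g' hg'
      ⟨a, ha, α, hα⟩ ⟨-a, hna, γ, hγ⟩ ⟨-a, hna, β, hβ'⟩
    have y1 : α ≤ ⟪a, y⟫ := (Set.ext_iff.1 hα y).1 hy1
    have y2 : β ≤ ⟪-a, y⟫ := (Set.ext_iff.1 hβ' y).1 hy2
    have x1 : ¬ α ≤ ⟪a, x⟫ := fun h => hx1 ((Set.ext_iff.1 hα x).2 h)
    have x2 : ¬ β ≤ ⟪-a, x⟫ := fun h => hx2 ((Set.ext_iff.1 hβ' x).2 h)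
    rw [inner_neg_left] at y2 x2
    linarith
  refine ⟨{g, g'}, (finite_singleton _).insert _, ?_, fun x => ?_, ?_⟩
  · rintro _ (rfl | rfl)
    exacts [hg, hg']
  · rcases hcover x with hx | hx
    exacts [⟨g, Or.inl rfl, hx⟩, ⟨g', Or.inr rfl, hx⟩]
  · rintro _ (rfl | rfl)
    · exact ⟨h2, hgk⟩
    · refine ⟨fun u hu => sameEnd_trans hg' hg hk (h4' u (hle u hu)).symm (h2 u hu),
        fun x y q hq hxy => ?_⟩
      have h7 : f' (hyperplaneReflection a x) = _ :=
        (congrArg f (hyperplaneReflection_involutive a x)).trans hxy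
      have h8 := apply_add_eq_of_halfSpace hf'm hg' ha h6 h7 hq.ge
      simpa only [hf', map_add, hyperplaneReflection_involutive, hrefl q hq] using h8

end ChartSystem

end Folding

section Galleries

open Filter Topology
open scoped RealInnerProductSpace

namespace ChartSystem

variable {V X : Type*} [NormedAddCommGroup V] [InnerProductSpace ℝ V] [MetricSpace X]
  {Φ : ChartSystem V X} {f g h k : V → X} {u v w m a p : V}

/-- Every regular vector has, in the direction of another one in a different Weyl cone, a
codimension one face separating the two. -/
theorem exists_separating_panel {v' : V} (hv : Φ.Reg v) (hv' : Φ.Reg v')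
    (hsep : ∃ a ∈ Φ.roots, ⟪a, v⟫ * ⟪a, v'⟫ < 0) :
    ∃ a p, IsPanelVector Φ.roots a p ∧ 0 < ⟪a, v⟫ ∧ ⟪a, v'⟫ < 0 ∧ p ∈ Φ.cone v := by
  set D : Set V := {d | ∃ a ∈ Φ.roots, ∃ b ∈ Φ.roots, b ≠ a ∧ b ≠ -a ∧
    d = ⟪b, v'⟫ • a - ⟪a, v'⟫ • b} with hD
  have hDf : D.Finite := by
    refine ((Φ.finite_roots.prod Φ.finite_roots).image
      fun q : V × V => ⟪q.2, v'⟫ • q.1 - ⟪q.1, v'⟫ • q.2).subset ?_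
    rintro _ ⟨a, ha, b, hb, -, -, rfl⟩
    exact ⟨(a, b), ⟨ha, hb⟩, rfl⟩
  have hD0 : ∀ d ∈ D, d ≠ 0 := by
    rintro _ ⟨a, ha, b, hb, h1, h2, rfl⟩ h0
    have h3 : ⟪b, v'⟫ • a = ⟪a, v'⟫ • b := sub_eq_zero.1 h0
    have h4 := congrArg norm h3
    rw [norm_smul, norm_smul, Φ.norm_root a ha, Φ.norm_root b hb, mul_one, mul_one,
      Real.norm_eq_abs, Real.norm_eq_abs, abs_eq_abs] at h4
    have h5 := hv' a ha
    rcases h4 with h4 | h4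
    · rw [h4] at h3
      exact h1 (smul_right_injective V h5 h3).symm
    · rw [h4, neg_smul, ← smul_neg] at h3
      exact h2 (smul_right_injective V h5 h3).symm
  obtain ⟨g, hg⟩ := exists_regularVector (R := Φ.roots ∪ D) (Φ.finite_roots.union hDf) (by
    rintro d (hd | hd)
    exacts [ne_zero_of_mem_roots hd, hD0 d hd])
  obtain ⟨ε, h1, h2, -⟩ := (hg.eventually_add_smul (Φ.finite_roots.union hDf) v).exists
  set v₁ := v + ε • g
  have hv₁ : Φ.Reg v₁ := fun b hb => h1 b (Or.inl hb)
  have hpos : ∀ b ∈ Φ.roots, 0 < ⟪b, v₁⟫ * ⟪b, v⟫ := fun b hb =>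
    hv₁.mul_pos hv (fun b hb => h2 b (Or.inl hb)) hb
  have hcone : Φ.cone v₁ = Φ.cone v := weylCone_eq_of_pos hpos
  have hsgn : ∀ b ∈ Φ.roots, 0 < ⟪b, v⟫ → 0 < ⟪b, v₁⟫ := fun b hb h =>
    pos_of_mul_pos_left (hpos b hb) h.le
  set N : Set V := {b ∈ Φ.roots | 0 < ⟪b, v⟫ ∧ ⟪b, v'⟫ < 0} with hN
  have hNn : N.Nonempty := by
    obtain ⟨a, ha, h⟩ := hsep
    rcases lt_or_gt_of_ne (hv a ha) with h3 | h3
    · exact ⟨-a, neg_mem_roots ha, by simpa using h3, by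
        rw [inner_neg_left]; nlinarith⟩
    · exact ⟨a, ha, h3, by nlinarith⟩
  set τ : V → ℝ := fun b => ⟪b, v₁⟫ / (⟪b, v₁⟫ - ⟪b, v'⟫) with hτ
  obtain ⟨a, haN, hmin⟩ := (Φ.finite_roots.subset (sep_subset _ _) : N.Finite).exists_minimalFor
    τ N hNn
  have hmin' : ∀ b ∈ N, τ a ≤ τ b := fun b hb =>
    (le_total (τ a) (τ b)).elim id fun h => hmin hb h
  obtain ⟨ha, hav, hav'⟩ := haN
  have hav₁ := hsgn a ha hav
  have hden : 0 < ⟪a, v₁⟫ - ⟪a, v'⟫ := by linarith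
  have hτ0 : 0 < τ a := div_pos hav₁ hden
  have hτ1 : τ a < 1 := (div_lt_one hden).2 (by linarith)
  have hval : ∀ b, ⟪b, v₁ + τ a • (v' - v₁)⟫ = (1 - τ a) * ⟪b, v₁⟫ + τ a * ⟪b, v'⟫ := fun b => by
    rw [inner_add_right, inner_smul_right, inner_sub_right]; ring
  have hτa : τ a * (⟪a, v₁⟫ - ⟪a, v'⟫) = ⟪a, v₁⟫ := div_mul_cancel₀ _ hden.ne'
  have hzero : ⟪a, v₁ + τ a • (v' - v₁)⟫ = 0 := by rw [hval]; linarith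
  have hp1 : ∀ b ∈ Φ.roots, b ≠ a → b ≠ -a → 0 < ⟪b, v⟫ → 0 < ⟪b, v₁ + τ a • (v' - v₁)⟫ := by
    intro b hb hba hba' hbv
    have hbv₁ := hsgn b hb hbv
    rw [hval]
    rcases lt_or_gt_of_ne (hv' b hb) with h3 | h3
    · have hden' : 0 < ⟪b, v₁⟫ - ⟪b, v'⟫ := by linarith
      have hτb : τ b * (⟪b, v₁⟫ - ⟪b, v'⟫) = ⟪b, v₁⟫ := div_mul_cancel₀ _ hden'.ne'
      have hlt : τ a < τ b := by
        refine lt_of_le_of_ne (hmin' b ⟨hb, hbv, h3⟩) fun h4 => ?_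
        refine h1 _ (Or.inr ⟨a, ha, b, hb, hba, hba', rfl⟩) ?_
        rw [inner_sub_left, real_inner_smul_left, real_inner_smul_left]
        rw [← h4] at hτb
        have e1 : ⟪a, v'⟫ * τ a = (τ a - 1) * ⟪a, v₁⟫ := by linarith
        have e2 : ⟪b, v'⟫ * τ a = (τ a - 1) * ⟪b, v₁⟫ := by linarith
        have e3 : τ a * (⟪b, v'⟫ * ⟪a, v₁⟫ - ⟪a, v'⟫ * ⟪b, v₁⟫) = 0 := by
          linear_combination ⟪a, v₁⟫ * e2 - ⟪b, v₁⟫ * e1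
        exact (mul_eq_zero.1 e3).resolve_left hτ0.ne'
      nlinarith
    · have := mul_pos (sub_pos.2 hτ1) hbv₁
      have := mul_pos hτ0 h3
      linarith
  have hp2 : ∀ b ∈ Φ.roots, b ≠ a → b ≠ -a → 0 < ⟪b, v⟫ * ⟪b, v₁ + τ a • (v' - v₁)⟫ := by
    intro b hb hba hba'
    rcases lt_or_gt_of_ne (hv b hb) with h3 | h3
    · have := hp1 (-b) (neg_mem_roots hb) (fun h => hba' (by rw [← h, neg_neg]))
        (fun h => hba (neg_injective h)) (by simpa using h3)
      rw [inner_neg_left] at this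
      exact mul_pos_of_neg_of_neg h3 (by linarith)
    · exact mul_pos h3 (hp1 b hb hba hba' h3)
  refine ⟨a, v₁ + τ a • (v' - v₁), ⟨ha, hzero, fun b hb h3 h4 => ?_⟩, hav, hav', fun b hb => ?_⟩
  · exact right_ne_zero_of_mul (hp2 b hb h3 h4).ne'
  · by_cases h3 : b = a
    · rw [h3, hzero, mul_zero]
    by_cases h4 : b = -a
    · rw [h4, inner_neg_left _ (v₁ + _), hzero]; simp
    exact (hp2 b hb h3 h4).le

theorem inner_mul_inner_reflection_pos {b : V} (hp : IsPanelVector Φ.roots a p) (hv : Φ.Reg v)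
    (hpv : p ∈ Φ.cone v) (hb : b ∈ Φ.roots) (h1 : b ≠ a) (h2 : b ≠ -a) :
    0 < ⟪b, v⟫ * ⟪b, hyperplaneReflection a v⟫ := by
  have e1 := hp.mul_pos hv hpv hb h1 h2
  have e2 := hp.mul_pos (reg_reflection hp.mem hv)
    ((mem_cone_reflection_of_inner_eq_zero hp.mem hp.inner_eq_zero).2 hpv) hb h1 h2
  have e3 : 0 < (⟪b, v⟫ * ⟪b, hyperplaneReflection a v⟫) * (⟪b, p⟫ * ⟪b, p⟫) := by nlinarith
  exact pos_of_mul_pos_left e3 (mul_self_nonneg _)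

/-- Induction along a minimal gallery from the Weyl cone of `v` to the Weyl cone of `v'`. -/
theorem gallery_induction {v' : V} (hv' : Φ.Reg v') {P : V → Prop}
    (step : ∀ w a p, Φ.Reg w → IsPanelVector Φ.roots a p → 0 < ⟪a, w⟫ → ⟪a, v'⟫ < 0 →
      p ∈ Φ.cone w → P w → P (hyperplaneReflection a w))
    (hv : Φ.Reg v) (h0 : P v) : ∃ w, Φ.Reg w ∧ Φ.cone w = Φ.cone v' ∧ P w := by
  induction hn : {a ∈ Φ.roots | ⟪a, v⟫ * ⟪a, v'⟫ < 0}.ncard using Nat.strong_induction_on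
    generalizing v with
  | _ n ih =>
    by_cases hsep : ∃ a ∈ Φ.roots, ⟪a, v⟫ * ⟪a, v'⟫ < 0
    · obtain ⟨a, p, hp, hav, hav', hpv⟩ := exists_separating_panel hv hv' hsep
      have hn' := Φ.norm_root a hp.mem
      refine ih _ ?_ (reg_reflection hp.mem hv) (step v a p hv hp hav hav' hpv h0) rfl
      rw [← hn]
      refine ncard_lt_ncard ?_ (Φ.finite_roots.subset (sep_subset _ _))
      refine ssubset_iff_of_subset ?_ |>.2 ⟨a, ⟨hp.mem, mul_neg_of_pos_of_neg hav hav'⟩, ?_⟩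
      · rintro b ⟨hb, hlt⟩
        refine ⟨hb, ?_⟩
        by_cases h1 : b = a
        · rw [h1]; exact mul_neg_of_pos_of_neg hav hav'
        by_cases h2 : b = -a
        · rw [h2, inner_neg_left, inner_neg_left, neg_mul_neg]
          exact mul_neg_of_pos_of_neg hav hav'
        have h3 := inner_mul_inner_reflection_pos hp hv hpv hb h1 h2
        by_contra! h4
        nlinarith [mul_self_nonneg ⟪b, v'⟫, mul_self_nonneg ⟪b, hyperplaneReflection a v⟫,
          mul_nonneg h3.le (mul_self_nonneg ⟪b, v'⟫), mul_pos_of_neg_of_neg hlt hlt,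
          mul_nonpos_of_nonneg_of_nonpos h4 hlt.le, mul_pos h3 (mul_self_pos.2 (hv' b hb))]
      · rintro ⟨-, h⟩
        rw [inner_hyperplaneReflection hn'] at h
        nlinarith
    · push Not at hsep
      exact ⟨v, hv, weylCone_eq_of_pos fun b hb =>
        lt_of_le_of_ne (hsep b hb) (mul_ne_zero (hv b hb) (hv' b hb)).symm, h0⟩

/-- Every apartment is covered by finitely many apartments whose boundary contains a given
chamber at infinity. -/
theorem exists_finite_cover (hf : f ∈ Φ.charts) (hk : k ∈ Φ.charts) (hv : Φ.Reg v) :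
    ∃ 𝓖 : Set (V → X), 𝓖.Finite ∧ 𝓖 ⊆ Φ.charts ∧ (∀ x, ∃ g ∈ 𝓖, f x ∈ range g) ∧
      ∀ g ∈ 𝓖, ∀ c ∈ Φ.cone v, SameEnd g k c := by
  obtain ⟨h, hh, L, hL, b, h1, h2⟩ := exists_joint_eqOnSubcone hf hk hv hv
  let P : V → Prop := fun w => ∃ 𝓖 : Set (V → X), 𝓖.Finite ∧ 𝓖 ⊆ Φ.charts ∧
    (∀ x, ∃ g ∈ 𝓖, f x ∈ range g) ∧ ∀ g ∈ 𝓖, ∀ c ∈ Φ.cone w, SameEnd g h c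
  have step : ∀ w a p, Φ.Reg w → IsPanelVector Φ.roots a p → 0 < ⟪a, w⟫ → ⟪a, L v⟫ < 0 →
      p ∈ Φ.cone w → P w → P (hyperplaneReflection a w) := by
    rintro w a p hw hp haw - hpw ⟨𝓖, h𝓖f, h𝓖, hcov, hsame⟩
    have hn := Φ.norm_root a hp.mem
    have key : ∀ g ∈ 𝓖, ∃ 𝓗 : Set (V → X), 𝓗.Finite ∧ 𝓗 ⊆ Φ.charts ∧
        (∀ x, ∃ g' ∈ 𝓗, g x ∈ range g') ∧
        ∀ g' ∈ 𝓗, ∀ c ∈ Φ.cone (hyperplaneReflection a w), SameEnd g' h c := fun g hg => by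
      obtain ⟨𝓗, e1, e2, e3, e4⟩ := exists_cover_pair (h𝓖 hg) hh hp (reg_reflection hp.mem hw)
        (by rw [inner_hyperplaneReflection hn]; linarith)
        ((mem_cone_reflection_of_inner_eq_zero hp.mem hp.inner_eq_zero).2 hpw)
        fun q hq haq => hsame g hg q ((mem_cone_reflection_of_inner_eq_zero hp.mem haq).1 hq)
      exact ⟨𝓗, e1, e2, e3, fun g' hg' => (e4 g' hg').1⟩
    choose! 𝓗 e1 e2 e3 e4 using key
    refine ⟨⋃ g ∈ 𝓖, 𝓗 g, h𝓖f.biUnion e1, iUnion₂_subset e2, fun x => ?_, ?_⟩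
    · obtain ⟨g, hg, y, hy⟩ := hcov x
      obtain ⟨g', hg', hx⟩ := e3 g hg y
      exact ⟨g', mem_biUnion hg hg', hy ▸ hx⟩
    · intro g' hg'
      obtain ⟨g, hg, hg'⟩ := mem_iUnion₂.1 hg'
      exact e4 g hg g' hg'
  obtain ⟨w, hw, hwv, 𝓖, h𝓖f, h𝓖, hcov, hsame⟩ :=
    gallery_induction (reg_map hL hv) step hv
      ⟨{f}, finite_singleton f, by simpa using hf, fun x => ⟨f, rfl, x, rfl⟩, by
        rintro _ rfl c hc
        exact h1.asympDist_eq_zero (Φ.isom _ hf) (Φ.isom h hh) hc⟩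
  refine ⟨(fun g x => g (L x)) '' 𝓖, h𝓖f.image _, ?_, fun x => ?_, ?_⟩
  · rintro _ ⟨g, hg, rfl⟩
    exact comp_linear_mem (h𝓖 hg) hL
  · obtain ⟨g, hg, y, hy⟩ := hcov x
    exact ⟨_, ⟨g, hg, rfl⟩, L.symm y, by simpa using hy⟩
  · rintro _ ⟨g, hg, rfl⟩ c hc
    have e1 : asympDist k c (fun z => h (L z + b)) c = 0 :=
      h2.asympDist_eq_zero (Φ.isom k hk) (Φ.isom _ (Φ.comp_mem h hh L hL b)) hc
    rw [asympDist_comp hk hh hL] at e1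
    have e2 := hsame g hg (L c) (by rw [hwv]; exact (map_mem_cone_iff hL).2 hc)
    rw [SameEnd, asympDist_comm, asympDist_comp_linear hk (h𝓖 hg) hL,
      asympDist_congr_right hk (h𝓖 hg) hh e2]
    exact e1

end ChartSystem

end Galleries

section Flows

open Filter Topology
open scoped RealInnerProductSpace

namespace ChartSystem

variable {V X : Type*} [NormedAddCommGroup V] [InnerProductSpace ℝ V] [MetricSpace X]
  {Φ : ChartSystem V X} {f g h k : V → X} {u v w m a p : V} {x x' : X}

/-- The union of the ranges of the charts. -/
def space (Φ : ChartSystem V X) : Set X := {x | ∃ f ∈ Φ.charts, x ∈ range f}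

theorem apply_mem_space (hf : f ∈ Φ.charts) (y : V) : f y ∈ Φ.space := ⟨f, hf, y, rfl⟩

theorem exists_chart_sameEnd (hk : k ∈ Φ.charts) (hv : Φ.Reg v) (hx : x ∈ Φ.space) :
    ∃ g ∈ Φ.charts, ∃ y, (∀ c ∈ Φ.cone v, SameEnd g k c) ∧ g y = x := by
  obtain ⟨f, hf, y, rfl⟩ := hx
  obtain ⟨𝓖, -, h𝓖, hcov, hs⟩ := exists_finite_cover hf hk hv
  obtain ⟨g, hg, z, hz⟩ := hcov y
  exact ⟨g, h𝓖 hg, z, hs g hg, hz⟩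

theorem exists_chart_eqOnSubcone (hk : k ∈ Φ.charts) (hv : Φ.Reg v) (hx : x ∈ Φ.space) :
    ∃ g ∈ Φ.charts, ∃ y, EqOnSubcone Φ.roots v g k ∧ g y = x := by
  obtain ⟨g, hg, y, hs, rfl⟩ := exists_chart_sameEnd hk hv hx
  obtain ⟨b, hb⟩ := exists_eqOnSubcone_translate hk hg hv fun c hc => (hs c hc).symm
  exact ⟨_, translate_mem hg b, y - b, hb.symm, by simp⟩

/-- A map that does not increase distances on the apartments containing a given chamber at
infinity does not increase distances. -/
theorem dist_le_of_forall_sameEnd {Y : Type*} [PseudoMetricSpace Y] {φ : X → Y}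
    (hk : k ∈ Φ.charts) (hv : Φ.Reg v)
    (hφ : ∀ g ∈ Φ.charts, (∀ c ∈ Φ.cone v, SameEnd g k c) →
      ∀ y y', dist (φ (g y)) (φ (g y')) ≤ dist y y')
    (hx : x ∈ Φ.space) (hx' : x' ∈ Φ.space) : dist (φ x) (φ x') ≤ dist x x' := by
  obtain ⟨f₁, hf₁, y₁, rfl⟩ := hx
  obtain ⟨f₂, hf₂, y₂, rfl⟩ := hx'
  obtain ⟨f, hf, ⟨y, hy⟩, y', hy'⟩ := Φ.exists_joint f₁ hf₁ f₂ hf₂ y₁ y₂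
  rw [← hy, ← hy', (Φ.isom f hf).dist_eq]
  obtain ⟨𝓖, h𝓖f, h𝓖, hcov, hs⟩ := exists_finite_cover hf hk hv
  have key := rel_of_finite_closed_cover
    (fun s t => dist (φ (f (AffineMap.lineMap y y' s))) (φ (f (AffineMap.lineMap y y' t))) ≤
      (t - s) * dist y y')
    (fun r s t h1 h2 => (dist_triangle _ _ _).trans (by linarith)) h𝓖f.toFinset
    (fun g => {s | f (AffineMap.lineMap y y' s) ∈ range g})
    (fun g hg => (Φ.isClosed_preimage f hf g (h𝓖 (by simpa using hg))).preimage
      AffineMap.lineMap_continuous) zero_le_one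
    (fun s _ => by simpa using hcov _) ?_
  · simpa using key
  · rintro g hg s - t - ⟨z, hz⟩ ⟨z', hz'⟩ hst
    rw [Finite.mem_toFinset] at hg
    rw [← hz, ← hz']
    refine (hφ g (h𝓖 hg) (hs g hg) z z').trans ?_
    rw [← (Φ.isom g (h𝓖 hg)).dist_eq, hz, hz', (Φ.isom f hf).dist_eq, dist_lineMap_lineMap,
      dist_comm, Real.dist_eq, abs_of_nonneg (sub_nonneg.2 hst)]

open Classical in
/-- Translation by `u`, an element of the Weyl cone of `v`, in the apartments containing the
chamber at infinity of the chart `k` corresponding to `v`. -/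
def flow (Φ : ChartSystem V X) (k : V → X) (v u : V) (x : X) : X :=
  if h : ∃ z : (V → X) × V, z.1 ∈ Φ.charts ∧ (∀ c ∈ Φ.cone v, SameEnd z.1 k c) ∧ z.1 z.2 = x then
    h.choose.1 (h.choose.2 + u) else x

theorem flow_apply (hk : k ∈ Φ.charts) (hv : Φ.Reg v) (hu : u ∈ Φ.cone v) (hg : g ∈ Φ.charts)
    (hs : ∀ c ∈ Φ.cone v, SameEnd g k c) (y : V) : Φ.flow k v u (g y) = g (y + u) := by
  have h : ∃ z : (V → X) × V, z.1 ∈ Φ.charts ∧ (∀ c ∈ Φ.cone v, SameEnd z.1 k c) ∧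
      z.1 z.2 = g y := ⟨(g, y), hg, hs, rfl⟩
  rw [flow, dif_pos h]
  obtain ⟨h1, h2, h3⟩ := h.choose_spec
  exact apply_add_eq h1 hg hv
    (fun c hc => sameEnd_trans h1 hk hg (h2 c hc) (hs c hc).symm) h3 hu

theorem flow_mem_space (hk : k ∈ Φ.charts) (hv : Φ.Reg v) (hu : u ∈ Φ.cone v)
    (hx : x ∈ Φ.space) : Φ.flow k v u x ∈ Φ.space := by
  obtain ⟨g, hg, y, hs, rfl⟩ := exists_chart_sameEnd hk hv hx
  rw [flow_apply hk hv hu hg hs]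
  exact apply_mem_space hg _

theorem dist_flow_le (hk : k ∈ Φ.charts) (hv : Φ.Reg v) (hu : u ∈ Φ.cone v)
    (hx : x ∈ Φ.space) (hx' : x' ∈ Φ.space) :
    dist (Φ.flow k v u x) (Φ.flow k v u x') ≤ dist x x' :=
  dist_le_of_forall_sameEnd hk hv (fun g hg hs y y' => by
    rw [flow_apply hk hv hu hg hs, flow_apply hk hv hu hg hs, (Φ.isom g hg).dist_eq,
      dist_add_right]) hx hx'

theorem flow_flow (hk : k ∈ Φ.charts) (hv : Φ.Reg v) (hu : u ∈ Φ.cone v) (hw : w ∈ Φ.cone v)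
    (hx : x ∈ Φ.space) : Φ.flow k v u (Φ.flow k v w x) = Φ.flow k v (w + u) x := by
  obtain ⟨g, hg, y, hs, rfl⟩ := exists_chart_sameEnd hk hv hx
  rw [flow_apply hk hv hw hg hs, flow_apply hk hv hu hg hs,
    flow_apply hk hv (add_mem_weylCone hw hu) hg hs, add_assoc]

/-- Flowing in the direction of a panel is determined by that panel. -/
theorem flow_apply_of_isPanelVector (hk : k ∈ Φ.charts) (hv : Φ.Reg v)
    (hp : IsPanelVector Φ.roots a p) (hpv : p ∈ Φ.cone v) (hg : g ∈ Φ.charts)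
    (hs : ∀ q ∈ Φ.cone v, ⟪a, q⟫ = 0 → SameEnd g k q) {t : ℝ} (ht : 0 ≤ t) (y : V) :
    Φ.flow k v (t • p) (g y) = g (y + t • p) := by
  wlog hav : ⟪a, v⟫ < 0 generalizing a
  · refine this (hp.neg_root (neg_mem_roots hp.mem)) (fun q hq haq => hs q hq ?_) ?_
    · simpa using haq
    · rw [inner_neg_left, neg_lt_zero]
      exact lt_of_le_of_ne (not_lt.1 hav) (hv a hp.mem).symm
  obtain ⟨𝓖, -, h𝓖, hcov, h𝓖s⟩ := exists_cover_pair hg hk hp hv hav hpv hs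
  obtain ⟨g', hg', z, hz⟩ := hcov y
  obtain ⟨h1, h2⟩ := h𝓖s g' hg'
  rw [← hz, flow_apply hk hv (smul_mem_weylCone ht hpv) (h𝓖 hg') h1]
  exact (h2 y z _ (by rw [inner_smul_right, hp.inner_eq_zero, mul_zero]) hz.symm).symm

open Classical in
/-- The retraction onto the chart `f` centred at the chamber at infinity of `f` corresponding
to `v`. -/
def ret (Φ : ChartSystem V X) (f : V → X) (v : V) (x : X) : V :=
  if h : ∃ z, ∃ g ∈ Φ.charts, EqOnSubcone Φ.roots v g f ∧ g z = x then h.choose else 0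

theorem ret_apply (hv : Φ.Reg v) (hg : g ∈ Φ.charts)
    (hs : EqOnSubcone Φ.roots v g f) (z : V) : Φ.ret f v (g z) = z := by
  have h : ∃ z', ∃ g' ∈ Φ.charts, EqOnSubcone Φ.roots v g' f ∧ g' z' = g z :=
    ⟨z, g, hg, hs, rfl⟩
  rw [ret, dif_pos h]
  obtain ⟨g', hg', hs', hz⟩ := h.choose_spec
  generalize h.choose = z' at hz ⊢
  have hgg := eqOnSubcone_trans hv hs' hs.symm
  obtain ⟨y, hy⟩ := id hgg
  obtain ⟨w, hw1, hw2⟩ := exists_sub_mem_cone hv z y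
  have e1 := apply_add_eq hg' hg hv
    (fun c hc => hgg.asympDist_eq_zero (Φ.isom _ hg') (Φ.isom _ hg) hc) hz hw1
  have e2 := hy _ hw2
  rw [add_sub_cancel] at e1 e2
  rw [← e2] at e1
  have e3 := (Φ.isom g' hg').injective e1
  rw [add_sub_left_comm, add_eq_left, sub_eq_zero] at e3
  exact e3

theorem dist_ret_le (hf : f ∈ Φ.charts) (hv : Φ.Reg v)
    (hx : x ∈ Φ.space) (hx' : x' ∈ Φ.space) :
    dist (Φ.ret f v x) (Φ.ret f v x') ≤ dist x x' :=
  dist_le_of_forall_sameEnd hf hv (fun g hg hs y y' => by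
    obtain ⟨b, hb⟩ := exists_eqOnSubcone_translate hf hg hv fun c hc => (hs c hc).symm
    have e : ∀ y, Φ.ret f v (g y) = y - b := fun y => by
      have := ret_apply hv (translate_mem hg b) hb.symm (y - b)
      rwa [sub_add_cancel] at this
    rw [e, e, dist_sub_right]) hx hx'

theorem ret_flow (hf : f ∈ Φ.charts) (hv : Φ.Reg v) (hu : u ∈ Φ.cone v) (hx : x ∈ Φ.space) :
    Φ.ret f v (Φ.flow f v u x) = Φ.ret f v x + u := by
  obtain ⟨g, hg, y, hs, rfl⟩ := exists_chart_eqOnSubcone hf hv hx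
  rw [flow_apply hf hv hu hg
    (fun c hc => hs.asympDist_eq_zero (Φ.isom _ hg) (Φ.isom _ hf) hc), ret_apply hv hg hs,
    ret_apply hv hg hs]

theorem ret_trans (hg : g ∈ Φ.charts) (hv : Φ.Reg v) {b : V}
    (hs : EqOnSubcone Φ.roots v g fun z => h (z + b)) (hx : x ∈ Φ.space) :
    Φ.ret h v x = Φ.ret g v x + b := by
  obtain ⟨g', hg', y, hs', rfl⟩ := exists_chart_eqOnSubcone hg hv hx
  have e1 := (eqOnSubcone_trans hv hs' hs).translate (-b)
  simp only [neg_add_cancel_right] at e1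
  have e2 := ret_apply hv (translate_mem hg' (-b)) e1 (y + b)
  rw [add_neg_cancel_right] at e2
  rw [e2, ret_apply hv hg' hs']

end ChartSystem

end Flows

section WallUnions

open Filter Topology
open scoped RealInnerProductSpace

theorem isComplete_of_forall_cauchySeq {X : Type*} [MetricSpace X] {S : Set X}
    (h : ∀ x : ℕ → X, (∀ n, x n ∈ S) → CauchySeq x → ∃ y ∈ S, Tendsto x atTop (𝓝 y)) :
    IsComplete S := by
  rw [← completeSpace_coe_iff_isComplete]
  refine Metric.complete_of_cauchySeq_tendsto fun x hx => ?_
  obtain ⟨y, hy, hxy⟩ := h (fun n => x n) (fun n => (x n).2)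
    (hx.map uniformContinuous_subtype_val)
  exact ⟨⟨y, hy⟩, tendsto_subtype_rng.2 hxy⟩

namespace ChartSystem

variable {V X : Type*} [NormedAddCommGroup V] [InnerProductSpace ℝ V] [MetricSpace X]
  {Φ : ChartSystem V X} {f g h k : V → X} {u v v' w m a p : V} {x x' : X}

/-- The union of the apartments that contain the points at infinity of the wall with normal
vector `a` of the chart `k`. -/
def wallUnion (Φ : ChartSystem V X) (k : V → X) (a : V) : Set X :=
  {x | ∃ g ∈ Φ.charts, x ∈ range g ∧ ∀ q, ⟪a, q⟫ = 0 → SameEnd g k q}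

theorem wallUnion_subset_space (k : V → X) (a : V) : Φ.wallUnion k a ⊆ Φ.space :=
  fun _ ⟨g, hg, hx, _⟩ => ⟨g, hg, hx⟩

theorem flow_mem_wallUnion (hk : k ∈ Φ.charts) (hv : Φ.Reg v)
    (hp : IsPanelVector Φ.roots a p) (hpv : p ∈ Φ.cone v) {t : ℝ} (ht : 0 ≤ t)
    (hx : x ∈ Φ.wallUnion k a) : Φ.flow k v (t • p) x ∈ Φ.wallUnion k a := by
  obtain ⟨g, hg, ⟨y, rfl⟩, hs⟩ := hx
  rw [flow_apply_of_isPanelVector hk hv hp hpv hg (fun q _ => hs q) ht]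
  exact ⟨g, hg, mem_range_self _, hs⟩

theorem flow_neg_flow (hk : k ∈ Φ.charts) (hv : Φ.Reg v) (hv' : Φ.Reg v')
    (hp : IsPanelVector Φ.roots a p) (hpv : p ∈ Φ.cone v) (hpv' : -p ∈ Φ.cone v') {t : ℝ}
    (ht : 0 ≤ t) (hx : x ∈ Φ.wallUnion k a) :
    Φ.flow k v' (t • -p) (Φ.flow k v (t • p) x) = x := by
  obtain ⟨g, hg, ⟨y, rfl⟩, hs⟩ := hx
  rw [flow_apply_of_isPanelVector hk hv hp hpv hg (fun q _ => hs q) ht,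
    flow_apply_of_isPanelVector hk hv' hp.neg hpv' hg (fun q _ => hs q) ht]
  simp

theorem flow_flow_neg (hk : k ∈ Φ.charts) (hv : Φ.Reg v) (hv' : Φ.Reg v')
    (hp : IsPanelVector Φ.roots a p) (hpv : p ∈ Φ.cone v) (hpv' : -p ∈ Φ.cone v') {t : ℝ}
    (ht : 0 ≤ t) (hx : x ∈ Φ.wallUnion k a) :
    Φ.flow k v (t • p) (Φ.flow k v' (t • -p) x) = x := by
  have := flow_neg_flow hk hv' hv hp.neg hpv' (by rwa [neg_neg]) ht hx
  rwa [neg_neg] at this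

theorem exists_forall_flow_mem_wallUnion (hk : k ∈ Φ.charts) (hv : Φ.Reg v)
    (hp : IsPanelVector Φ.roots a p) (hpv : p ∈ Φ.cone v) (hx : x ∈ Φ.space) :
    ∃ T : ℝ, 0 ≤ T ∧ ∀ t, T ≤ t → Φ.flow k v (t • p) x ∈ Φ.wallUnion k a := by
  wlog hav : 0 < ⟪a, v⟫ generalizing a
  · obtain ⟨T, hT, h⟩ := this (hp.neg_root (neg_mem_roots hp.mem)) (by
      rw [inner_neg_left, Left.neg_pos_iff]
      exact lt_of_le_of_ne (not_lt.1 hav) (hv a hp.mem))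
    refine ⟨T, hT, fun t ht => ?_⟩
    simpa [wallUnion] using h t ht
  have hn := Φ.norm_root a hp.mem
  obtain ⟨g, hg, y, hs, rfl⟩ := exists_chart_sameEnd hk hv hx
  obtain ⟨g₁, hg₁, h1, h2⟩ := exists_fold_of_sameEnd hk hg hp hv hav hpv
    fun q hq => (hs q hq).symm
  have hcone : ∀ c ∈ Φ.cone v, 0 ≤ ⟪a, c⟫ := fun c hc =>
    nonneg_of_mul_nonneg_right (hc a hp.mem) hav
  have h3 : ∀ c ∈ Φ.cone v, SameEnd g g₁ c := fun c hc =>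
    sameEnd_trans hg hk hg₁ (hs c hc) (h1 c (hcone c hc))
  obtain ⟨b, z, hz⟩ := exists_eqOnSubcone_translate hg hg₁ hv h3
  have hz0 : g z = g₁ (z + b) := by simpa using hz 0 (zero_mem_weylCone v)
  have hZ : ∀ c, c ∈ Φ.cone v ∨ c ∈ Φ.cone (hyperplaneReflection a v) →
      g (z + c) ∈ range g₁ := by
    rintro c (hc | hc)
    · exact ⟨_, (apply_add_eq hg hg₁ hv h3 hz0 hc).symm⟩
    · exact ⟨_, (apply_add_eq hg hg₁ (reg_reflection hp.mem hv)
        (fun c hc => (h2 c hc).symm) hz0 hc).symm⟩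
  have hT : ∃ T : ℝ, 0 ≤ T ∧ ∀ t, T ≤ t → (y - z) + t • p ∈ Φ.cone v ∨
      (y - z) + t • p ∈ Φ.cone (hyperplaneReflection a v) := by
    rcases le_total 0 ⟪a, y - z⟫ with h | h
    · obtain ⟨T, hT, h4⟩ := hp.exists_forall_add_smul_mem Φ.finite_roots hv hpv
        (mul_nonneg hav.le h)
      exact ⟨T, hT, fun t ht => Or.inl (h4 t ht)⟩
    · obtain ⟨T, hT, h4⟩ := hp.exists_forall_add_smul_mem (u := y - z) Φ.finite_roots
        (reg_reflection hp.mem hv)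
        ((mem_cone_reflection_of_inner_eq_zero hp.mem hp.inner_eq_zero).2 hpv)
        (by rw [inner_hyperplaneReflection hn]; nlinarith)
      exact ⟨T, hT, fun t ht => Or.inr (h4 t ht)⟩
  obtain ⟨T, hT, h4⟩ := hT
  refine ⟨T, hT, fun t ht => ?_⟩
  rw [flow_apply hk hv (smul_mem_weylCone (hT.trans ht) hpv) hg hs]
  refine ⟨g₁, hg₁, ?_, fun q hq => (h1 q hq.ge).symm⟩
  have := hZ _ (h4 t ht)
  rwa [← add_assoc, add_sub_cancel] at this

/-- In a complete building the union of the apartments containing a given wall at infinity is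
complete. -/
theorem isComplete_wallUnion (hΦ : IsComplete Φ.space) (hk : k ∈ Φ.charts)
    (ha : a ∈ Φ.roots) : IsComplete (Φ.wallUnion k a) := by
  obtain ⟨p, hp⟩ := exists_isPanelVector Φ.finite_roots Φ.norm_root ha
  obtain ⟨v, hv, hpv⟩ := Φ.exists_reg_mem_cone p
  obtain ⟨v', hv', hpv'⟩ := Φ.exists_reg_mem_cone (-p)
  refine isComplete_of_forall_cauchySeq fun x hxK hx => ?_
  have hsub := Φ.wallUnion_subset_space k a
  obtain ⟨y, hy, hxy⟩ := cauchySeq_tendsto_of_isComplete hΦ (fun n => hsub (hxK n)) hx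
  refine ⟨y, ?_, hxy⟩
  obtain ⟨T, hT, h⟩ := exists_forall_flow_mem_wallUnion hk hv hp hpv hy
  have hTv := smul_mem_weylCone hT hpv
  have hTv' := smul_mem_weylCone hT hpv'
  have e : Φ.flow k v' (T • -p) (Φ.flow k v (T • p) y) = y := by
    refine tendsto_nhds_unique (?_ : Tendsto x atTop _) hxy
    refine tendsto_iff_dist_tendsto_zero.2 (squeeze_zero (fun _ => dist_nonneg) (fun n => ?_)
      (tendsto_iff_dist_tendsto_zero.1 hxy))
    nth_rw 1 [← flow_neg_flow hk hv hv' hp hpv hpv' hT (hxK n)]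
    exact (dist_flow_le hk hv' hTv' (flow_mem_space hk hv hTv (hsub (hxK n)))
      (flow_mem_space hk hv hTv hy)).trans (dist_flow_le hk hv hTv (hsub (hxK n)) hy)
  rw [← e]
  exact flow_mem_wallUnion hk hv' hp.neg hpv' hT (h T le_rfl)

theorem flow_eq_flow (hk : k ∈ Φ.charts) (hg : g ∈ Φ.charts) (hv : Φ.Reg v) (hw : Φ.Reg w)
    (hs : ∀ c ∈ Φ.cone v, SameEnd g k c)
    (hp : IsPanelVector Φ.roots a p) (hpv : p ∈ Φ.cone v)
    (hwv : ∀ q, ⟪a, q⟫ = 0 → (q ∈ Φ.cone w ↔ q ∈ Φ.cone v)) {t : ℝ} (ht : 0 ≤ t)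
    (hx : x ∈ Φ.space) : Φ.flow g w (t • p) x = Φ.flow k v (t • p) x := by
  obtain ⟨g', hg', y, hs', rfl⟩ := exists_chart_sameEnd hg hw hx
  rw [flow_apply hg hw (smul_mem_weylCone ht ((hwv p hp.inner_eq_zero).2 hpv)) hg' hs',
    flow_apply_of_isPanelVector hk hv hp hpv hg' _ ht]
  exact fun q hq haq => sameEnd_trans hg' hg hk (hs' q ((hwv q haq).2 hq)) (hs q hq)

/-- If the union of the apartments containing a wall at infinity is complete, then the
retractions of a Cauchy sequence centred at two chambers at infinity adjacent along a panel of
that wall have the same limit in a suitable apartment. -/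
theorem exists_chart_tendsto_ret (hk : k ∈ Φ.charts) (hv : Φ.Reg v)
    (hp : IsPanelVector Φ.roots a p) (hpv : p ∈ Φ.cone v)
    (hK : IsComplete (Φ.wallUnion k a)) {x : ℕ → X} (hx : CauchySeq x)
    (hxΦ : ∀ n, x n ∈ Φ.space) :
    ∃ g ∈ Φ.charts, (∀ c ∈ Φ.cone v, SameEnd g k c) ∧ ∃ y,
      Tendsto (fun n => Φ.ret g v (x n)) atTop (𝓝 y) ∧
      Tendsto (fun n => Φ.ret g (hyperplaneReflection a v) (x n)) atTop (𝓝 y) := by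
  obtain ⟨v', hv', hpv'⟩ := Φ.exists_reg_mem_cone (-p)
  have hsub := Φ.wallUnion_subset_space k a
  have hz : ∀ n, ∃ T : ℝ, 0 ≤ T ∧ ∃ z ∈ Φ.wallUnion k a,
      ∀ t, T ≤ t → Φ.flow k v (t • p) z = Φ.flow k v (t • p) (x n) := fun n => by
    obtain ⟨T, hT, h⟩ := exists_forall_flow_mem_wallUnion hk hv hp hpv (hxΦ n)
    have hTK := h T le_rfl
    have hzK := flow_mem_wallUnion hk hv' hp.neg hpv' hT hTK
    refine ⟨T, hT, _, hzK, fun t ht => ?_⟩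
    have ht' : t • p = T • p + (t - T) • p := by module
    have e := flow_flow_neg hk hv hv' hp hpv hpv' hT hTK
    have h1 := smul_mem_weylCone hT hpv
    have h2 := smul_mem_weylCone (sub_nonneg.2 ht) hpv
    rw [ht', ← flow_flow hk hv h2 h1 (hsub hzK), e, flow_flow hk hv h2 h1 (hxΦ n)]
  choose T hT z hzK hzx using hz
  have hd : ∀ i j, dist (z i) (z j) ≤ dist (x i) (x j) := fun i j => by
    have hM : 0 ≤ max (T i) (T j) := (hT i).trans (le_max_left _ _)
    have h1 := smul_mem_weylCone hM hpv
    have h2 := smul_mem_weylCone hM hpv'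
    rw [← flow_neg_flow hk hv hv' hp hpv hpv' hM (hzK i),
      ← flow_neg_flow hk hv hv' hp hpv hpv' hM (hzK j), hzx i _ (le_max_left _ _),
      hzx j _ (le_max_right _ _)]
    exact (dist_flow_le hk hv' h2 (flow_mem_space hk hv h1 (hxΦ i))
      (flow_mem_space hk hv h1 (hxΦ j))).trans (dist_flow_le hk hv h1 (hxΦ i) (hxΦ j))
  have hzc : CauchySeq z := by
    rw [Metric.cauchySeq_iff] at hx ⊢
    intro ε hε
    obtain ⟨N, hN⟩ := hx ε hε
    exact ⟨N, fun i hi j hj => (hd i j).trans_lt (hN i hi j hj)⟩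
  obtain ⟨z₀, hz₀, hlim⟩ := cauchySeq_tendsto_of_isComplete hK hzK hzc
  obtain ⟨g, hg, y, hs, hy⟩ := exists_chart_sameEnd hk hv (hsub hz₀)
  have key : ∀ w, Φ.Reg w → (∀ q, ⟪a, q⟫ = 0 → (q ∈ Φ.cone w ↔ q ∈ Φ.cone v)) →
      Tendsto (fun n => Φ.ret g w (x n)) atTop (𝓝 y) := fun w hw hwv => by
    have hpw := (hwv p hp.inner_eq_zero).2 hpv
    have e : ∀ n, Φ.ret g w (x n) = Φ.ret g w (z n) := fun n => by
      have h1 := smul_mem_weylCone (hT n) hpw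
      have h2 := hzx n (T n) le_rfl
      rw [← flow_eq_flow hk hg hv hw hs hp hpv hwv (hT n) (hsub (hzK n)),
        ← flow_eq_flow hk hg hv hw hs hp hpv hwv (hT n) (hxΦ n)] at h2
      have h3 := congrArg (Φ.ret g w) h2
      rw [ret_flow hg hw h1 (hsub (hzK n)), ret_flow hg hw h1 (hxΦ n)] at h3
      exact (add_right_cancel h3).symm
    simp_rw [e]
    have e0 : Φ.ret g w z₀ = y := by rw [← hy, ret_apply hw hg (eqOnSubcone_refl _ _ _)]
    rw [← e0]
    exact tendsto_iff_dist_tendsto_zero.2 (squeeze_zero (fun _ => dist_nonneg)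
      (fun n => dist_ret_le hg hw (hsub (hzK n)) (hsub hz₀))
      (tendsto_iff_dist_tendsto_zero.1 hlim))
  exact ⟨g, hg, hs, y, key v hv fun _ _ => Iff.rfl, key _ (reg_reflection hp.mem hv)
    fun q hq => mem_cone_reflection_of_inner_eq_zero hp.mem hq⟩

end ChartSystem

end WallUnions

section Completeness

open Filter Topology
open scoped RealInnerProductSpace

namespace ChartSystem

variable {V X : Type*} [NormedAddCommGroup V] [InnerProductSpace ℝ V] [MetricSpace X]
  {Φ : ChartSystem V X} {f g h k : V → X} {u v v' w m a p : V} {x x' : X}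

theorem exists_eqOnSubcone_translate_pair (hf : f ∈ Φ.charts) (hg : g ∈ Φ.charts)
    (hv : Φ.Reg v) (hw : Φ.Reg w) (hsv : ∀ c ∈ Φ.cone v, SameEnd f g c)
    (hsw : ∀ c ∈ Φ.cone w, SameEnd f g c) :
    ∃ b, EqOnSubcone Φ.roots v f (fun z => g (z + b)) ∧
      EqOnSubcone Φ.roots w f fun z => g (z + b) := by
  obtain ⟨b, hb, x, hx⟩ := exists_transition_translate hf hg hv hsv
  obtain ⟨b', hb', x', hx'⟩ := exists_transition_translate hf hg hw hsw
  have h0 := hx 0 (zero_mem_weylCone v)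
  have h1 := hb' (x + 0) ⟨_, h0.symm⟩
  rw [h0] at h1
  have h2 : b = b' := add_left_cancel ((Φ.isom g hg).injective h1)
  exact ⟨b, ⟨x, hx⟩, x', by rw [h2]; exact hx'⟩

theorem ret_congr_cone (hf : f ∈ Φ.charts) (hv : Φ.Reg v) (hw : Φ.Reg w)
    (h : Φ.cone v = Φ.cone w) (hx : x ∈ Φ.space) : Φ.ret f v x = Φ.ret f w x := by
  obtain ⟨g, hg, y, hs, rfl⟩ := exists_chart_eqOnSubcone hf hv hx
  rw [ret_apply hv hg hs, ret_apply hw hg (by rwa [EqOnSubcone, ← show _ = weylCone Φ.roots w from h])]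

theorem exists_chart_tendsto_ret_neg [CompleteSpace V]
    (hK : ∀ k ∈ Φ.charts, ∀ a ∈ Φ.roots, IsComplete (Φ.wallUnion k a)) {x : ℕ → X}
    (hx : CauchySeq x) (hxΦ : ∀ n, x n ∈ Φ.space) (hv : Φ.Reg v) :
    ∃ f ∈ Φ.charts, ∃ y, Tendsto (fun n => Φ.ret f v (x n)) atTop (𝓝 y) ∧
      Tendsto (fun n => Φ.ret f (-v) (x n)) atTop (𝓝 y) := by
  let P : V → Prop := fun w => ∃ f ∈ Φ.charts, ∃ y,
    Tendsto (fun n => Φ.ret f v (x n)) atTop (𝓝 y) ∧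
      Tendsto (fun n => Φ.ret f w (x n)) atTop (𝓝 y)
  have step : ∀ w a p, Φ.Reg w → IsPanelVector Φ.roots a p → 0 < ⟪a, w⟫ → ⟪a, -v⟫ < 0 →
      p ∈ Φ.cone w → P w → P (hyperplaneReflection a w) := by
    rintro w a p hw hp haw hav hpw ⟨f, hf, y, h1, h2⟩
    rw [inner_neg_right, neg_lt_zero] at hav
    have hw' := reg_reflection hp.mem hw
    obtain ⟨g, hg, hgf, z, h3, h4⟩ :=
      exists_chart_tendsto_ret hf hw hp hpw (hK f hf a hp.mem) hx hxΦ
    obtain ⟨g₁, hg₁, h5, h6⟩ := exists_fold_of_sameEnd hf hg hp hw haw hpw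
      fun q hq => (hgf q hq).symm
    have hhalf : ∀ w, 0 < ⟪a, w⟫ → ∀ c ∈ Φ.cone w, SameEnd f g₁ c := fun w hw c hc =>
      h5 c (nonneg_of_mul_nonneg_right (hc a hp.mem) hw)
    obtain ⟨b, hbv, hbw⟩ := exists_eqOnSubcone_translate_pair hf hg₁ hv hw (hhalf v hav)
      (hhalf w haw)
    have hg₂ := translate_mem hg₁ b
    have e1 : ∀ n, Φ.ret (fun z => g₁ (z + b)) v (x n) = Φ.ret f v (x n) := fun n => by
      simpa using ret_trans (b := 0) hf hv (by simpa using hbv) (hxΦ n)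
    have e2 : ∀ n, Φ.ret (fun z => g₁ (z + b)) w (x n) = Φ.ret f w (x n) := fun n => by
      simpa using ret_trans (b := 0) hf hw (by simpa using hbw) (hxΦ n)
    obtain ⟨c, hcw, hcw'⟩ := exists_eqOnSubcone_translate_pair hg₂ hg hw hw'
      (fun q hq => (sameEnd_translate_left hg₁ hg b).2
        (sameEnd_trans hg₁ hf hg (hhalf w haw q hq).symm (hgf q hq).symm))
      (fun q hq => (sameEnd_translate_left hg₁ hg b).2 (h6 q hq))
    have e3 := fun n => ret_trans hg₂ hw hcw (hxΦ n)
    have e4 := fun n => ret_trans hg₂ hw' hcw' (hxΦ n)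
    simp_rw [e3, e2] at h3
    simp_rw [e4] at h4
    have hz : z = y + c := tendsto_nhds_unique h3 (h2.add_const c)
    refine ⟨_, hg₂, y, by simpa only [e1] using h1, ?_⟩
    simpa [hz] using h4.sub_const c
  obtain ⟨f, hf, -⟩ := hxΦ 0
  have h0 : P v := by
    have hc : CauchySeq fun n => Φ.ret f v (x n) := by
      rw [Metric.cauchySeq_iff] at hx ⊢
      intro ε hε
      obtain ⟨N, hN⟩ := hx ε hε
      exact ⟨N, fun i hi j hj => (dist_ret_le hf hv (hxΦ i) (hxΦ j)).trans_lt (hN i hi j hj)⟩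
    obtain ⟨y, hy⟩ := cauchySeq_tendsto_of_complete hc
    exact ⟨f, hf, y, hy, hy⟩
  obtain ⟨w, hw, hwv, f, hf, y, h1, h2⟩ := gallery_induction hv.neg step hv h0
  refine ⟨f, hf, y, h1, ?_⟩
  simpa only [ret_congr_cone hf hw hv.neg hwv (hxΦ _)] using h2

theorem exists_norm_le_mul_inner (Φ : ChartSystem V X) (v : V) :
    ∃ K : ℝ, 0 ≤ K ∧ ∀ L ∈ Φ.G, L v ≠ v → ‖v‖ ≤ K * (⟪v, v⟫ - ⟪L v, v⟫) := by
  have := Φ.finite_G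
  obtain ⟨K, hK⟩ := (finite_range fun L : Φ.G => ‖v‖ / (⟪v, v⟫ - ⟪L.1 v, v⟫)).bddAbove
  refine ⟨max K 0, le_max_right _ _, fun L hL hLv => ?_⟩
  have hpos : 0 < ⟪v, v⟫ - ⟪L v, v⟫ := by
    have h1 := norm_sub_sq_real (L v) v
    rw [L.norm_map] at h1
    have h2 : 0 < ‖L v - v‖ ^ 2 := by have := norm_pos_iff.2 (sub_ne_zero.2 hLv); positivity
    rw [real_inner_self_eq_norm_sq]
    linarith
  rw [← div_le_iff₀ hpos]
  exact (hK ⟨⟨L, hL⟩, rfl⟩).trans (le_max_left _ _)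

/-- The distance to an apartment is controlled by the two retractions centred at opposite
chambers at infinity. -/
theorem exists_infDist_le (Φ : ChartSystem V X) (hv : Φ.Reg v) :
    ∃ K : ℝ, 0 ≤ K ∧ ∀ f ∈ Φ.charts, ∀ x ∈ Φ.space,
      Metric.infDist x (range f) ≤ K * ⟪Φ.ret f (-v) x - Φ.ret f v x, v⟫ := by
  obtain ⟨K, hK, hKL⟩ := Φ.exists_norm_le_mul_inner v
  refine ⟨K, hK, fun f hf x hx => ?_⟩
  obtain ⟨k, hk, z, hkf, rfl⟩ := exists_chart_eqOnSubcone hf hv hx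
  rw [ret_apply hv hk hkf]
  obtain ⟨z₀, hz₀⟩ := hkf
  obtain ⟨S, hS, hSc⟩ := hv.exists_forall_add_smul_mem Φ.finite_roots (z - z₀)
  obtain ⟨𝓖, h𝓖f, h𝓖, hcov, hs⟩ := exists_finite_cover hk hf hv.neg
  have key := rel_of_finite_closed_cover
    (fun s t => Metric.infDist (k (z + s • v)) (range f) - Metric.infDist (k (z + t • v)) (range f)
      ≤ K * (⟪Φ.ret f (-v) (k (z + s • v)), v⟫ - ⟪Φ.ret f (-v) (k (z + t • v)), v⟫ +
        (t - s) * ⟪v, v⟫))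
    (fun r s t h1 h2 => by nlinarith) h𝓖f.toFinset
    (fun g => {s | k (z + s • v) ∈ range g})
    (fun g hg => (Φ.isClosed_preimage k hk g (h𝓖 (by simpa using hg))).preimage (by fun_prop)) hS
    (fun s _ => by simpa using hcov _) ?_
  · have e1 : k (z + S • v) = f (z + S • v) := by
      have := hz₀ _ (hSc S le_rfl)
      rwa [show z₀ + (z - z₀ + S • v) = z + S • v by abel] at this
    have e2 : Φ.ret f (-v) (f (z + S • v)) = z + S • v :=
      ret_apply hv.neg hf (eqOnSubcone_refl _ _ _) _
    rw [e1, e2, Metric.infDist_zero_of_mem (mem_range_self _), zero_smul, add_zero,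
      inner_add_left, inner_smul_left] at key
    rw [inner_sub_left]
    simp only [sub_zero, conj_trivial] at key
    linarith
  · rintro g hg s - t - hsg htg hst
    rw [Finite.mem_toFinset] at hg
    have hgf := hs g hg
    have hg := h𝓖 hg
    have hst' : 0 ≤ t - s := sub_nonneg.2 hst
    obtain ⟨L, hL, b, hLb⟩ := Φ.exists_transition k hk g hg
    obtain ⟨b', hb'⟩ := exists_eqOnSubcone_translate hg hf hv.neg hgf
    have e1 : ∀ y, Φ.ret f (-v) (g y) = y + b' := fun y => by
      rw [ret_trans hg hv.neg hb' (apply_mem_space hg y),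
        ret_apply hv.neg hg (eqOnSubcone_refl _ _ _)]
    have e2 : ⟪Φ.ret f (-v) (k (z + s • v)), v⟫ - ⟪Φ.ret f (-v) (k (z + t • v)), v⟫ =
        -((t - s) * ⟪L v, v⟫) := by
      rw [hLb _ hsg, hLb _ htg, e1, e1]
      simp only [map_add, map_smul, inner_add_left, real_inner_smul_left]
      ring
    rw [e2]
    have hfne := range_nonempty f
    by_cases hLv : L v = v
    · rw [hLv, neg_add_cancel, mul_zero, sub_nonpos]
      have hc : (t - s) • -v ∈ Φ.cone (-v) := smul_mem_weylCone hst' (self_mem_weylCone _)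
      have e3 : k (z + s • v) = Φ.flow f (-v) ((t - s) • -v) (k (z + t • v)) := by
        rw [hLb _ hsg, hLb _ htg, flow_apply hf hv.neg hc hg hgf]
        congr 1
        simp only [map_add, map_smul, hLv]
        module
      refine (Metric.le_infDist hfne).2 ?_
      rintro _ ⟨y, rfl⟩
      have e4 : Φ.flow f (-v) ((t - s) • -v) (f y) = f (y + (t - s) • -v) :=
        flow_apply hf hv.neg hc hf (fun c _ => sameEnd_refl (Φ.isom f hf) c) y
      calc Metric.infDist (k (z + s • v)) (range f)
          ≤ dist (k (z + s • v)) (f (y + (t - s) • -v)) :=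
            Metric.infDist_le_dist_of_mem (mem_range_self _)
        _ ≤ dist (k (z + t • v)) (f y) := by
            rw [e3, ← e4]
            exact dist_flow_le hf hv.neg hc (apply_mem_space hk _) (apply_mem_space hf _)
    · have h1 := Metric.infDist_le_infDist_add_dist (s := range f) (x := k (z + s • v))
        (y := k (z + t • v))
      have h2 : dist (k (z + s • v)) (k (z + t • v)) = (t - s) * ‖v‖ := by
        rw [(Φ.isom k hk).dist_eq, dist_add_left, dist_eq_norm, ← sub_smul, norm_smul,
          Real.norm_eq_abs, abs_sub_comm, abs_of_nonneg hst']
      have h3 := mul_le_mul_of_nonneg_left (hKL L hL hLv) hst'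
      nlinarith

theorem isComplete_space [CompleteSpace V]
    (hK : ∀ k ∈ Φ.charts, ∀ a ∈ Φ.roots, IsComplete (Φ.wallUnion k a)) :
    IsComplete Φ.space := by
  refine isComplete_of_forall_cauchySeq fun x hxΦ hx => ?_
  obtain ⟨v, hv, -⟩ := Φ.exists_reg_mem_cone 0
  obtain ⟨f, hf, y, h1, h2⟩ := exists_chart_tendsto_ret_neg hK hx hxΦ hv
  obtain ⟨K, hK0, hbound⟩ := Φ.exists_infDist_le hv
  refine ⟨f y, apply_mem_space hf y, ?_⟩
  have hd : ∀ n, dist (x n) (f y) ≤ 2 * (K * ⟪Φ.ret f (-v) (x n) - Φ.ret f v (x n), v⟫) +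
      dist (Φ.ret f v (x n)) y := fun n => by
    have e1 : dist (x n) (f (Φ.ret f v (x n))) / 2 ≤ Metric.infDist (x n) (range f) := by
      refine (Metric.le_infDist (range_nonempty f)).2 ?_
      rintro _ ⟨z, rfl⟩
      have e2 := dist_ret_le hf hv (hxΦ n) (apply_mem_space hf z)
      rw [ret_apply hv hf (eqOnSubcone_refl _ _ _)] at e2
      have e3 := dist_triangle (x n) (f z) (f (Φ.ret f v (x n)))
      rw [(Φ.isom f hf).dist_eq, dist_comm z] at e3
      linarith
    have e4 := hbound f hf (x n) (hxΦ n)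
    have e5 := dist_triangle (x n) (f (Φ.ret f v (x n))) (f y)
    rw [(Φ.isom f hf).dist_eq] at e5
    linarith
  refine tendsto_iff_dist_tendsto_zero.2 (squeeze_zero (fun _ => dist_nonneg) hd ?_)
  have h3 := (((h2.sub h1).inner (tendsto_const_nhds (x := v))).const_mul K).const_mul 2
  have h4 := h3.add (tendsto_iff_dist_tendsto_zero.1 h1)
  simpa using h4

end ChartSystem

end Completeness

section Model

open Filter Topology
open scoped RealInnerProductSpace

theorem hyperplaneReflection_map {V : Type*} [NormedAddCommGroup V] [InnerProductSpace ℝ V]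
    {a : V} (ha : ‖a‖ = 1) (L : V ≃ₗᵢ[ℝ] V) (x : V) :
    hyperplaneReflection (L a) x = L (hyperplaneReflection a (L.symm x)) := by
  rw [hyperplaneReflection_apply (by rwa [L.norm_map]), hyperplaneReflection_apply ha, map_sub,
    map_smul, L.apply_symm_apply, ← L.inner_map_map a, L.apply_symm_apply]

theorem eq_or_eq_neg_of_norm_eq_one {V : Type*} [NormedAddCommGroup V] [InnerProductSpace ℝ V]
    {a b : V} (ha : ‖a‖ = 1) (hb : ‖b‖ = 1) (h : ∀ w, ⟪a, w⟫ = 0 → ⟪b, w⟫ = 0) :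
    b = a ∨ b = -a := by
  have haa : ⟪a, a⟫ = 1 := by rw [real_inner_self_eq_norm_sq, ha]; norm_num
  have hbb : ⟪b, b⟫ = 1 := by rw [real_inner_self_eq_norm_sq, hb]; norm_num
  have h1 := h (b - ⟪a, b⟫ • a) (by
    rw [inner_sub_right, inner_smul_right, haa, mul_one, sub_self])
  rw [inner_sub_right, inner_smul_right, hbb, real_inner_comm] at h1
  have h2 : b = ⟪a, b⟫ • a := by
    rw [← sub_eq_zero, ← inner_self_eq_zero (𝕜 := ℝ)]
    simp only [inner_sub_left, inner_sub_right, inner_smul_left, inner_smul_right, haa, hbb,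
      real_inner_comm a b, conj_trivial]
    rw [real_inner_comm] at h1
    linarith
  rw [real_inner_comm] at h1
  rcases mul_self_eq_one_iff.1 (show ⟪a, b⟫ * ⟪a, b⟫ = 1 by linarith) with h3 | h3
  · left; rw [h2, h3, one_smul]
  · right; rw [h2, h3, neg_one_smul]

namespace SphericalCoxeterSystem

variable {n : ℕ} {cs : SphericalCoxeterSystem n} {a v x y : ModelSpace n}

/-- Linear isometries as isometries. -/
def toIsometryHom (n : ℕ) :
    (ModelSpace n ≃ₗᵢ[ℝ] ModelSpace n) →* (ModelSpace n ≃ᵢ ModelSpace n) where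
  toFun L := L.toIsometryEquiv
  map_one' := rfl
  map_mul' _ _ := rfl

@[simp]
theorem toIsometryHom_apply (L : ModelSpace n ≃ₗᵢ[ℝ] ModelSpace n) (x : ModelSpace n) :
    toIsometryHom n L x = L x := rfl

theorem toIsometryHom_injective : Function.Injective (toIsometryHom n) := fun L M h => by
  ext1 x
  simpa using DFunLike.congr_fun h x

/-- The finite reflection group as a group of linear isometries. -/
def linearGroup (cs : SphericalCoxeterSystem n) :
    Subgroup (ModelSpace n ≃ₗᵢ[ℝ] ModelSpace n) :=
  cs.Wbar.comap (toIsometryHom n)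

/-- The unit normal vectors of the reflecting hyperplanes. -/
def rootSet (cs : SphericalCoxeterSystem n) : Set (ModelSpace n) :=
  {a | ∃ b, ‖b‖ = 1 ∧ toIsometryHom n (hyperplaneReflection b) ∈ cs.S ∧
    ∃ L ∈ cs.linearGroup, L b = a}

theorem norm_of_mem_rootSet (ha : a ∈ cs.rootSet) : ‖a‖ = 1 := by
  obtain ⟨b, hb, -, L, -, rfl⟩ := ha
  rwa [L.norm_map]

theorem hyperplaneReflection_mem_linearGroup (ha : a ∈ cs.rootSet) :
    hyperplaneReflection a ∈ cs.linearGroup := by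
  obtain ⟨b, hb, hs, L, hL, rfl⟩ := ha
  have e : hyperplaneReflection (L b) = L * hyperplaneReflection b * L⁻¹ := by
    ext1 x
    exact hyperplaneReflection_map hb L x
  rw [e]
  exact mul_mem (mul_mem hL (Subgroup.subset_closure hs)) (inv_mem hL)

theorem finite_linearGroup (cs : SphericalCoxeterSystem n) : Finite cs.linearGroup := by
  have := cs.finiteW
  exact Finite.of_injective (β := ↥(Subgroup.closure cs.S))
    (fun L => ⟨toIsometryHom n L.1, L.2⟩)
    fun L M h => Subtype.ext (toIsometryHom_injective (congrArg Subtype.val h))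

theorem finite_rootSet (cs : SphericalCoxeterSystem n) : cs.rootSet.Finite := by
  have := cs.finite_linearGroup
  have h : cs.rootSet ⊆ ⋃ L : cs.linearGroup, {a | ‖a‖ = 1 ∧ hyperplaneReflection a = L.1} :=
    fun a ha => mem_iUnion.2 ⟨⟨_, hyperplaneReflection_mem_linearGroup ha⟩,
      norm_of_mem_rootSet ha, rfl⟩
  refine (finite_iUnion fun L => ?_).subset h
  rcases eq_empty_or_nonempty {a | ‖a‖ = 1 ∧ hyperplaneReflection a = L.1} with h0 | ⟨a, ha, haL⟩
  · rw [h0]; exact finite_empty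
  · refine ((finite_singleton (-a)).insert a).subset ?_
    rintro b ⟨hb, hbL⟩
    refine eq_or_eq_neg_of_norm_eq_one ha hb fun w hw => ?_
    have h1 := inner_hyperplaneReflection hb w
    rw [hbL, ← haL, hyperplaneReflection_of_inner_eq_zero ha hw] at h1
    linarith

theorem exists_eq_hyperplaneReflection {s : ModelSpace n ≃ᵢ ModelSpace n}
    (hs : IsLinearReflection s) :
    ∃ a, ‖a‖ = 1 ∧ s = toIsometryHom n (hyperplaneReflection a) := by
  obtain ⟨-, hs1, p, hp, hfix⟩ := hs
  have hfix' : ∀ x, s x = x ↔ p x = 0 := fun x => Set.ext_iff.1 hfix x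
  have hs0 : s 0 = 0 := (hfix' 0).2 (map_zero p)
  let L := s.toRealLinearIsometryEquivOfMapZero hs0
  have hL : ∀ x, L x = s x := fun x => rfl
  obtain ⟨b, hb⟩ := (InnerProductSpace.toDual ℝ (ModelSpace n)).surjective
    (LinearMap.toContinuousLinearMap p)
  have hpb : ∀ x, p x = ⟪b, x⟫ := fun x => by
    rw [← InnerProductSpace.toDual_apply_apply, hb]; rfl
  have hb0 : b ≠ 0 := by
    rintro rfl
    exact hp (LinearMap.ext fun x => by simp [hpb])
  have hn : ‖(‖b‖⁻¹ • b)‖ = 1 := by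
    rw [norm_smul, norm_inv, norm_norm, inv_mul_cancel₀ (norm_ne_zero_iff.2 hb0)]
  refine ⟨_, hn, ?_⟩
  have hLw : ∀ w, ⟪‖b‖⁻¹ • b, w⟫ = 0 → L w = w := fun w hw => by
    rw [hL, hfix', hpb]
    rw [real_inner_smul_left] at hw
    exact (mul_eq_zero.1 hw).resolve_left (inv_ne_zero (norm_ne_zero_iff.2 hb0))
  rcases eq_id_or_eq_hyperplaneReflection hn L hLw with h | h
  · exact (hs1 (IsometryEquiv.ext h)).elim
  · exact IsometryEquiv.ext h

theorem toIsometryHom_mem_W {L : ModelSpace n ≃ₗᵢ[ℝ] ModelSpace n} (hL : L ∈ cs.linearGroup) :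
    toIsometryHom n L ∈ cs.W :=
  Subgroup.closure_mono subset_union_left hL

theorem exists_mem_W {L : ModelSpace n ≃ₗᵢ[ℝ] ModelSpace n} (hL : L ∈ cs.linearGroup)
    (b : ModelSpace n) : ∃ w ∈ cs.W, ∀ x, w x = L x + b :=
  ⟨IsometryEquiv.addRight b * toIsometryHom n L,
    mul_mem (Subgroup.subset_closure (Or.inr ⟨b, fun _ => rfl⟩)) (toIsometryHom_mem_W hL),
    fun _ => rfl⟩

theorem exists_linear_of_mem_W {w : ModelSpace n ≃ᵢ ModelSpace n} (hw : w ∈ cs.W) :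
    ∃ L ∈ cs.linearGroup, ∃ b, ∀ x, w x = L x + b := by
  induction hw using Subgroup.closure_induction with
  | mem w hw =>
    rcases hw with hw | ⟨b, hb⟩
    · obtain ⟨a, -, rfl⟩ := exists_eq_hyperplaneReflection (cs.refl w hw)
      exact ⟨hyperplaneReflection a, Subgroup.subset_closure hw, 0, fun x => by simp⟩
    · exact ⟨1, one_mem _, b, hb⟩
  | one => exact ⟨1, one_mem _, 0, fun x => by simp⟩
  | mul w w' _ _ h h' =>
    obtain ⟨L, hL, b, hb⟩ := h
    obtain ⟨L', hL', b', hb'⟩ := h'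
    refine ⟨L * L', mul_mem hL hL', L b' + b, fun x => ?_⟩
    rw [IsometryEquiv.mul_apply, hb', hb, map_add, add_assoc]
    rfl
  | inv w _ h =>
    obtain ⟨L, hL, b, hb⟩ := h
    refine ⟨L⁻¹, inv_mem hL, -(L⁻¹ b), fun x => w.injective ?_⟩
    rw [IsometryEquiv.apply_inv_self, hb, map_add, map_neg]
    change x = L (L.symm x) + -L (L.symm b) + b
    simp

theorem isAffineReflection_iff {r : ModelSpace n ≃ᵢ ModelSpace n} :
    cs.IsAffineReflection r ↔
      ∃ a ∈ cs.rootSet, ∃ c : ℝ, ∀ x, r x = x - (2 * (⟪a, x⟫ - c)) • a := by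
  have key : ∀ (b : ModelSpace n) (hb : ‖b‖ = 1) (L : ModelSpace n ≃ₗᵢ[ℝ] ModelSpace n)
      (w : ModelSpace n ≃ᵢ ModelSpace n) (t : ModelSpace n) (hw : ∀ x, w x = L x + t) (x),
      (w * toIsometryHom n (hyperplaneReflection b) * w⁻¹) x =
        x - (2 * (⟪L b, x⟫ - ⟪L b, t⟫)) • L b := by
    intro b hb L w t hw x
    obtain ⟨y, rfl⟩ := w.surjective x
    rw [IsometryEquiv.mul_apply, IsometryEquiv.mul_apply, IsometryEquiv.inv_apply_self, hw, hw,
      toIsometryHom_apply, hyperplaneReflection_apply hb, inner_add_right, L.inner_map_map,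
      map_sub, map_smul]
    module
  constructor
  · rintro ⟨s, hs, w, hw, rfl⟩
    obtain ⟨b, hb, rfl⟩ := exists_eq_hyperplaneReflection (cs.refl s hs)
    obtain ⟨L, hL, t, ht⟩ := exists_linear_of_mem_W hw
    exact ⟨L b, ⟨b, hb, hs, L, hL, rfl⟩, _, key b hb L w t ht⟩
  · rintro ⟨a, ⟨b, hb, hs, L, hL, rfl⟩, c, hr⟩
    obtain ⟨w, hw, hwL⟩ := exists_mem_W hL (c • L b)
    refine ⟨_, hs, w, hw, IsometryEquiv.ext fun x => ?_⟩
    rw [key b hb L w _ hwL, hr, inner_smul_right, real_inner_self_eq_norm_sq, L.norm_map, hb]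
    norm_num

theorem fixed_iff (ha : ‖a‖ = 1) {c : ℝ} : x - (2 * (⟪a, x⟫ - c)) • a = x ↔ ⟪a, x⟫ = c := by
  have ha0 : a ≠ 0 := by rintro rfl; simp at ha
  rw [sub_eq_self, smul_eq_zero_iff_left ha0, mul_eq_zero_iff_left two_ne_zero, sub_eq_zero]

theorem isModelWall_iff {M : Set (ModelSpace n)} :
    cs.IsModelWall M ↔ ∃ a ∈ cs.rootSet, ∃ c : ℝ, M = {x | ⟪a, x⟫ = c} := by
  constructor
  · rintro ⟨r, hr, rfl⟩
    obtain ⟨a, ha, c, hc⟩ := isAffineReflection_iff.1 hr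
    exact ⟨a, ha, c, by ext x; simp only [mem_ofPred_eq, hc, fixed_iff (norm_of_mem_rootSet ha)]⟩
  · rintro ⟨a, ha, c, rfl⟩
    obtain ⟨w, hw, hwL⟩ := exists_mem_W (hyperplaneReflection_mem_linearGroup ha) ((2 * c) • a)
    have hr : ∀ x, w x = x - (2 * (⟪a, x⟫ - c)) • a := fun x => by
      rw [hwL, hyperplaneReflection_apply (norm_of_mem_rootSet ha)]; module
    refine ⟨w, isAffineReflection_iff.2 ⟨a, ha, c, hr⟩, ?_⟩
    ext x
    simp only [mem_ofPred_eq, hr, fixed_iff (norm_of_mem_rootSet ha)]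

theorem isModelHalf_halfSpace (ha : a ∈ cs.rootSet) (c : ℝ) :
    cs.IsModelHalf {x | ⟪a, x⟫ = c} {x | c ≤ ⟪a, x⟫} := by
  have hn := norm_of_mem_rootSet ha
  have haa : ⟪a, a⟫ = 1 := by rw [real_inner_self_eq_norm_sq, hn]; norm_num
  obtain ⟨w, hw, hwL⟩ := exists_mem_W (hyperplaneReflection_mem_linearGroup ha) ((2 * c) • a)
  have hr : ∀ x, w x = x - (2 * (⟪a, x⟫ - c)) • a := fun x => by
    rw [hwL, hyperplaneReflection_apply hn]; module
  have hin : ∀ x, ⟪a, w x⟫ = 2 * c - ⟪a, x⟫ := fun x => by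
    rw [hr, inner_sub_right, inner_smul_right, haa]; ring
  have hww : ∀ x, w (w x) = x := fun x => by
    rw [hr (w x), hin, hr]; module
  have himg : ⇑w '' {x | c ≤ ⟪a, x⟫} = {x | ⟪a, x⟫ ≤ c} := by
    ext x
    constructor
    · rintro ⟨y, hy, rfl⟩
      rw [mem_ofPred_eq] at hy ⊢
      rw [hin]; linarith
    · intro hx
      rw [mem_ofPred_eq] at hx
      exact ⟨w x, by rw [mem_ofPred_eq, hin]; linarith, hww x⟩
  refine ⟨w, isAffineReflection_iff.2 ⟨a, ha, c, hr⟩, ?_, ?_, ?_, ?_, ?_⟩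
  · ext x
    simp only [mem_ofPred_eq, hr, fixed_iff hn]
  · exact isClosed_le continuous_const (by fun_prop)
  · exact convex_halfSpace_ge (IsLinearMap.mk (fun x y => inner_add_right _ _ _)
      fun r x => inner_smul_right _ _ _) c
  · rw [himg]
    exact eq_univ_of_forall fun x => le_total c ⟪a, x⟫
  · rw [himg]
    ext x
    exact ⟨fun h => le_antisymm h.2 h.1, fun h => ⟨h.ge, h.le⟩⟩

end SphericalCoxeterSystem

end Model

section ModelSectors

open Filter Topology
open scoped RealInnerProductSpace

theorem eq_or_eq_neg_of_hyperplane_eq {V : Type*} [NormedAddCommGroup V] [InnerProductSpace ℝ V]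
    {a b : V} (ha : ‖a‖ = 1) (hb : ‖b‖ = 1) {c d : ℝ}
    (h : {x | ⟪a, x⟫ = c} = {x | ⟪b, x⟫ = d}) : b = a ∧ d = c ∨ b = -a ∧ d = -c := by
  have haa : ⟪a, a⟫ = 1 := by rw [real_inner_self_eq_norm_sq, ha]; norm_num
  have h' : ∀ x, ⟪a, x⟫ = c → ⟪b, x⟫ = d := fun x hx => (Set.ext_iff.1 h x).1 hx
  have h0 := h' (c • a) (by rw [inner_smul_right, haa, mul_one])
  have hw : ∀ w, ⟪a, w⟫ = 0 → ⟪b, w⟫ = 0 := fun w hw => by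
    have h1 := h' (c • a + w) (by rw [inner_add_right, inner_smul_right, haa, hw]; simp)
    rw [inner_add_right] at h1
    linarith
  rcases eq_or_eq_neg_of_norm_eq_one ha hb hw with rfl | rfl
  · left; rw [← h0, inner_smul_right, haa]; simp
  · right; rw [← h0, inner_smul_right, inner_neg_left, haa]; simp

namespace SphericalCoxeterSystem

variable {n : ℕ} {cs : SphericalCoxeterSystem n} {a v x y : ModelSpace n}

theorem neg_mem_rootSet (ha : a ∈ cs.rootSet) : -a ∈ cs.rootSet := by
  have hn := norm_of_mem_rootSet ha
  obtain ⟨b, hb, hs, L, hL, rfl⟩ := id ha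
  refine ⟨b, hb, hs, hyperplaneReflection (L b) * L,
    mul_mem (hyperplaneReflection_mem_linearGroup ha) hL, ?_⟩
  change hyperplaneReflection (L b) (L b) = _
  rw [hyperplaneReflection_apply hn, real_inner_self_eq_norm_sq, hn]
  module

theorem eq_halfSpace_of_isModelHalf {H : Set (ModelSpace n)} (ha : a ∈ cs.rootSet) {c : ℝ}
    (hH : cs.IsModelHalf {x | ⟪a, x⟫ = c} H) :
    H = {x | c ≤ ⟪a, x⟫} ∨ H = {x | ⟪a, x⟫ ≤ c} := by
  obtain ⟨r, hr, hM, -, hconv, huniv, hinter⟩ := hH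
  have hn := norm_of_mem_rootSet ha
  have haa : ⟪a, a⟫ = 1 := by rw [real_inner_self_eq_norm_sq, hn]; norm_num
  have hr' : ∀ x, r x = x - (2 * (⟪a, x⟫ - c)) • a := by
    obtain ⟨b, hb, d, hbd⟩ := isAffineReflection_iff.1 hr
    have hM' : {x | ⟪a, x⟫ = c} = {x | ⟪b, x⟫ = d} := by
      rw [hM]
      ext x
      simp only [mem_ofPred_eq, hbd, fixed_iff (norm_of_mem_rootSet hb)]
    intro x
    rcases eq_or_eq_neg_of_hyperplane_eq hn (norm_of_mem_rootSet hb) hM' with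
      ⟨rfl, rfl⟩ | ⟨rfl, rfl⟩
    · exact hbd x
    · rw [hbd, inner_neg_left]; module
  have hin : ∀ x, ⟪a, r x⟫ = 2 * c - ⟪a, x⟫ := fun x => by
    rw [hr', inner_sub_right, inner_smul_right, haa]; ring
  have hrr : ∀ x, r (r x) = x := fun x => by
    rw [hr' (r x), hin, hr']; module
  have hMH : ∀ x, ⟪a, x⟫ = c → x ∈ H := fun x hx => (hinter.ge hx).1
  have hseg : ∀ x ∈ H, ∀ τ : ℝ, 0 < τ → τ < 1 → (c + τ * (⟪a, x⟫ - c)) • a ∈ H := by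
    intro x hx τ h0 h1
    have h1' : 0 < 1 - τ := sub_pos.2 h1
    have hm : (1 - τ)⁻¹ • ((c + τ * (⟪a, x⟫ - c)) • a - τ • x) ∈ H := hMH _ (by
      rw [inner_smul_right, inner_sub_right, inner_smul_right, inner_smul_right, haa,
        inv_mul_eq_iff_eq_mul₀ h1'.ne']
      ring)
    have h2 := hconv hm hx h1'.le h0.le (by ring)
    rwa [smul_smul, mul_inv_cancel₀ h1'.ne', one_smul, sub_add_cancel] at h2
  have hno : ∀ x ∈ H, ∀ y ∈ H, c < ⟪a, x⟫ → c ≤ ⟪a, y⟫ := by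
    intro x hx y hy hxc
    by_contra! hyc
    have hα : 0 < ⟪a, x⟫ - c := sub_pos.2 hxc
    have hβ : 0 < c - ⟪a, y⟫ := sub_pos.2 hyc
    set α := ⟪a, x⟫ - c with hαd
    set β := c - ⟪a, y⟫ with hβd
    have hβ' : ⟪a, y⟫ - c = -β := by rw [hβd]; ring
    have hαβ : 0 < α + β := add_pos hα hβ
    have e1 := hseg x hx (β / (α + β)) (by positivity) ((div_lt_one hαβ).2 (by linarith))
    have e2 := hseg y hy (α / (α + β)) (by positivity) ((div_lt_one hαβ).2 (by linarith))
    rw [← hαd] at e1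
    rw [hβ'] at e2
    set ε := β / (α + β) * α with hε
    have hε0 : 0 < ε := by positivity
    have hε' : α / (α + β) * -β = -ε := by rw [hε]; ring
    rw [hε'] at e2
    have e3 : r ((c + -ε) • a) = (c + ε) • a := by
      rw [hr', inner_smul_right, haa]; module
    have e4 := hinter.le ⟨e1, ⟨_, e2, e3⟩⟩
    rw [mem_ofPred_eq, inner_smul_right, haa] at e4
    linarith
  have hcov : ∀ x, x ∈ H ∨ r x ∈ H := fun x => by
    rcases huniv.ge (mem_univ x) with h | ⟨y, hy, hyx⟩
    · exact Or.inl h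
    · exact Or.inr (by rwa [← hyx, hrr])
  by_cases hex : ∃ x ∈ H, c < ⟪a, x⟫
  · obtain ⟨x, hx, hxc⟩ := hex
    have hsub := fun y hy => hno x hx y hy hxc
    refine Or.inl (Subset.antisymm hsub fun y hy => ?_)
    rcases eq_or_lt_of_le (show c ≤ ⟪a, y⟫ from hy) with h | h
    · exact hMH y h.symm
    · refine (hcov y).resolve_right fun h1 => ?_
      have := hsub _ h1
      rw [hin] at this
      linarith
  · push Not at hex
    refine Or.inr (Subset.antisymm hex fun y hy => ?_)
    rcases eq_or_lt_of_le (show ⟪a, y⟫ ≤ c from hy) with h | h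
    · exact hMH y h
    · refine (hcov y).resolve_right fun h1 => ?_
      have := hex _ h1
      rw [hin] at this
      linarith

theorem isModelHalf_halfSpace_mul (ha : a ∈ cs.rootSet) {s : ℝ} (hs : s ≠ 0)
    (x : ModelSpace n) :
    cs.IsModelHalf {z | ⟪a, z⟫ = ⟪a, x⟫} {z | 0 ≤ s * ⟪a, z - x⟫} := by
  rcases lt_or_gt_of_ne hs with h | h
  · have e1 : {z | ⟪a, z⟫ = ⟪a, x⟫} = {z | ⟪-a, z⟫ = -⟪a, x⟫} := by
      ext z
      rw [mem_ofPred_eq, mem_ofPred_eq, inner_neg_left, neg_inj]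
    have e2 : {z | 0 ≤ s * ⟪a, z - x⟫} = {z | -⟪a, x⟫ ≤ ⟪-a, z⟫} := by
      ext z
      rw [mem_ofPred_eq, mem_ofPred_eq, inner_neg_left, neg_le_neg_iff, inner_sub_right,
        ← neg_mul_neg, mul_nonneg_iff_of_pos_left (neg_pos.2 h), neg_sub, sub_nonneg]
    rw [e1, e2]
    exact isModelHalf_halfSpace (neg_mem_rootSet ha) (-⟪a, x⟫)
  · have e2 : {z | 0 ≤ s * ⟪a, z - x⟫} = {z | ⟪a, x⟫ ≤ ⟪a, z⟫} := by
      ext z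
      rw [mem_ofPred_eq, mem_ofPred_eq, inner_sub_right, mul_nonneg_iff_of_pos_left h,
        sub_nonneg]
    rw [e2]
    exact isModelHalf_halfSpace ha ⟪a, x⟫

theorem isModelSectorFace_cone (hv : RegularVector cs.rootSet v) (x : ModelSpace n) :
    cs.IsModelSectorFace x {z | z - x ∈ weylCone cs.rootSet v} := by
  refine ⟨⟨x, by simpa using zero_mem_weylCone v⟩, fun M => {z | ∀ a ∈ cs.rootSet,
    M = {y | ⟪a, y⟫ = ⟪a, x⟫} → 0 ≤ ⟪a, v⟫ * ⟪a, z - x⟫}, fun M hM hx => Or.inr ?_, ?_⟩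
  · obtain ⟨a, ha, c, rfl⟩ := isModelWall_iff.1 hM
    obtain rfl : ⟪a, x⟫ = c := hx
    have h := isModelHalf_halfSpace_mul ha (hv a ha) x
    convert h using 1
    ext z
    refine ⟨fun h1 => h1 a ha rfl, fun h1 b hb hab => ?_⟩
    rcases eq_or_eq_neg_of_hyperplane_eq (norm_of_mem_rootSet ha) (norm_of_mem_rootSet hb) hab
      with ⟨rfl, -⟩ | ⟨rfl, -⟩
    · exact h1
    · rw [inner_neg_left, inner_neg_left, neg_mul_neg]; exact h1
  · ext z
    rw [mem_iInter₂]
    constructor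
    · rintro h M - a ha -
      exact h a ha
    · intro h a ha
      exact h {y | ⟪a, y⟫ = ⟪a, x⟫} ⟨isModelWall_iff.2 ⟨a, ha, _, rfl⟩, rfl⟩ a ha rfl

/-- A sector-face lies on one side of every wall through its base point. -/
theorem IsModelSectorFace.exists_wall_or_half {F : Set (ModelSpace n)}
    (hF : cs.IsModelSectorFace x F) :
    ∃ τ : ModelSpace n → Set ℝ,
      (∀ a ∈ cs.rootSet, τ a = {0} ∨ τ a = Ici 0 ∨ τ a = Iic 0) ∧
        ∀ z, z ∈ F ↔ ∀ a ∈ cs.rootSet, ⟪a, z - x⟫ ∈ τ a := by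
  obtain ⟨-, σ, hσ, rfl⟩ := hF
  have key : ∀ a ∈ cs.rootSet, ∃ T : Set ℝ, (T = {0} ∨ T = Ici 0 ∨ T = Iic 0) ∧
      ∀ z, z ∈ σ {z | ⟪a, z⟫ = ⟪a, x⟫} ↔ ⟪a, z - x⟫ ∈ T := by
    intro a ha
    rcases hσ _ (isModelWall_iff.2 ⟨a, ha, ⟪a, x⟫, rfl⟩) rfl with h | h
    · refine ⟨{0}, Or.inl rfl, fun z => ?_⟩
      rw [h, mem_ofPred_eq, inner_sub_right, mem_singleton_iff, sub_eq_zero]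
    · rcases eq_halfSpace_of_isModelHalf ha h with h | h
      · refine ⟨Ici 0, Or.inr (Or.inl rfl), fun z => ?_⟩
        rw [h, mem_ofPred_eq, inner_sub_right, mem_Ici, sub_nonneg]
      · refine ⟨Iic 0, Or.inr (Or.inr rfl), fun z => ?_⟩
        rw [h, mem_ofPred_eq, inner_sub_right, mem_Iic, sub_nonpos]
  choose! τ hτ hτσ using key
  refine ⟨τ, hτ, fun z => ?_⟩
  rw [mem_iInter₂]
  constructor
  · intro h a ha
    exact (hτσ a ha z).1 (h _ ⟨isModelWall_iff.2 ⟨a, ha, _, rfl⟩, rfl⟩)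
  · rintro h M ⟨hM, hx⟩
    obtain ⟨a, ha, c, rfl⟩ := isModelWall_iff.1 hM
    obtain rfl : ⟪a, x⟫ = c := hx
    exact (hτσ a ha z).2 (h a ha)

theorem isModelSector_cone (hv : RegularVector cs.rootSet v) (x : ModelSpace n) :
    cs.IsModelSector x {z | z - x ∈ weylCone cs.rootSet v} := by
  refine ⟨isModelSectorFace_cone hv x, fun F' hF' hsub => Subset.antisymm (fun z hz a ha => ?_)
    hsub⟩
  obtain ⟨τ, hτ, hτF⟩ := hF'.exists_wall_or_half
  have h1 := (hτF z).1 hz a ha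
  have h2 := (hτF (x + v)).1 (hsub (by simpa using self_mem_weylCone v)) a ha
  rw [add_sub_cancel_left] at h2
  have h3 := hv a ha
  rcases hτ a ha with h | h | h <;> rw [h] at h1 h2
  · exact (h3 h2).elim
  · exact mul_nonneg h2 h1
  · exact mul_nonneg_of_nonpos_of_nonpos h2 h1

theorem exists_regularVector_of_isModelSector {F : Set (ModelSpace n)}
    (hF : cs.IsModelSector x F) :
    ∃ v, RegularVector cs.rootSet v ∧ F = {z | z - x ∈ weylCone cs.rootSet v} := by
  obtain ⟨hF, hmax⟩ := hF
  obtain ⟨τ, hτ, hτF⟩ := hF.exists_wall_or_half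
  let N : ModelSpace n → Set (ModelSpace n) := fun z => {a ∈ cs.rootSet | ⟪a, z - x⟫ ≠ 0}
  have hfin : (N '' F).Finite := cs.finite_rootSet.finite_subsets.subset (by
    rintro _ ⟨z, -, rfl⟩
    exact sep_subset _ _)
  obtain ⟨z, hz, hzmax⟩ := hfin.exists_maximalFor' N F hF.1
  obtain ⟨v, hv, hzv⟩ := exists_regularVector_mem_weylCone cs.finite_rootSet
    (fun a ha h0 => by simpa [h0] using norm_of_mem_rootSet ha) (z - x)
  refine ⟨v, hv, (hmax _ (isModelSectorFace_cone hv x) fun y hy a ha => ?_).symm⟩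
  have hz' := (hτF z).1 hz
  have hy' := (hτF y).1 hy
  have hsum : ∀ a ∈ cs.rootSet, (0 ≤ ⟪a, z - x⟫ ∧ 0 ≤ ⟪a, y - x⟫) ∨
      (⟪a, z - x⟫ ≤ 0 ∧ ⟪a, y - x⟫ ≤ 0) := fun a ha => by
    have h1 := hz' a ha
    have h2 := hy' a ha
    rcases hτ a ha with h | h | h <;> rw [h] at h1 h2
    · rw [mem_singleton_iff] at h1 h2
      exact Or.inl ⟨h1.ge, h2.ge⟩
    · exact Or.inl ⟨h1, h2⟩
    · exact Or.inr ⟨h1, h2⟩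
  have hw : z + (y - x) ∈ F := (hτF _).2 fun a ha => by
    have h1 := hz' a ha
    have h2 := hy' a ha
    rw [show z + (y - x) - x = (z - x) + (y - x) by abel, inner_add_right]
    rcases hτ a ha with h | h | h <;> rw [h] at h1 h2 ⊢
    · rw [mem_singleton_iff] at *
      rw [h1, h2, add_zero]
    · exact mem_Ici.2 (add_nonneg h1 h2)
    · exact mem_Iic.2 (add_nonpos h1 h2)
  have hNw : ∀ b ∈ cs.rootSet, ⟪b, z + (y - x) - x⟫ = ⟪b, z - x⟫ + ⟪b, y - x⟫ := fun b _ => by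
    rw [show z + (y - x) - x = (z - x) + (y - x) by abel, inner_add_right]
  have hle : N z ≤ N (z + (y - x)) := fun b hb => by
    refine ⟨hb.1, fun h => hb.2 ?_⟩
    rw [hNw b hb.1] at h
    rcases hsum b hb.1 with ⟨h1, h2⟩ | ⟨h1, h2⟩ <;> linarith
  have hge := hzmax hw hle
  have hva := hzv a ha
  by_cases h0 : ⟪a, z - x⟫ = 0
  · have h1 : ⟪a, y - x⟫ = 0 := by
      by_contra h1
      refine (hge ⟨ha, ?_⟩ : a ∈ N z).2 h0
      rwa [hNw a ha, h0, zero_add]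
    rw [h1, mul_zero]
  · rcases hsum a ha with ⟨h1, h2⟩ | ⟨h1, h2⟩
    · exact mul_nonneg (nonneg_of_mul_nonneg_left hva (lt_of_le_of_ne h1 (Ne.symm h0))) h2
    · refine mul_nonneg_of_nonpos_of_nonpos ?_ h2
      have h3 := lt_of_le_of_ne h1 h0
      by_contra! h4
      nlinarith

end SphericalCoxeterSystem

end ModelSectors

section BuildingCharts

open Filter Topology
open scoped RealInnerProductSpace

namespace RBuilding

variable {n : ℕ} {cs : SphericalCoxeterSystem n} {X : Type*} [MetricSpace X] {Λ : Set X}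

theorem exists_transition (B : RBuilding cs X Λ) {f g : ModelSpace n → X} (hf : f ∈ B.charts)
    (hg : g ∈ B.charts) :
    ∃ L ∈ cs.linearGroup, ∃ b, ∀ z, f z ∈ range g → f z = g (L z + b) := by
  obtain ⟨-, -, w, hw, h⟩ := B.A2 f hf g hg
  obtain ⟨L, hL, b, hb⟩ := SphericalCoxeterSystem.exists_linear_of_mem_W hw
  exact ⟨L, hL, b, fun z hz => by rw [h z hz, hb]⟩

theorem map_mem_rootSet {L : ModelSpace n ≃ₗᵢ[ℝ] ModelSpace n} (hL : L ∈ cs.linearGroup)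
    {a : ModelSpace n} (ha : a ∈ cs.rootSet) : L a ∈ cs.rootSet := by
  obtain ⟨b, hb, hs, M, hM, rfl⟩ := ha
  exact ⟨b, hb, hs, L * M, mul_mem hL hM, rfl⟩

theorem exists_translate_cone_subset (B : RBuilding cs X Λ) {f : ModelSpace n → X}
    (hf : f ∈ B.charts) {v : ModelSpace n} (hv : RegularVector cs.rootSet v) {T : Set X}
    (hT : IsSector cs B.charts T) (hTf : T ⊆ f '' {z | z - 0 ∈ weylCone cs.rootSet v}) :
    ∃ x, ∀ c ∈ weylCone cs.rootSet v, f (x + c) ∈ T := by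
  obtain ⟨-, g, hg, y, s, hs, -, rfl⟩ := hT
  obtain ⟨u, hu, rfl⟩ := SphericalCoxeterSystem.exists_regularVector_of_isModelSector hs
  obtain ⟨L, hL, b, hLb⟩ := B.exists_transition hg hf
  have hL' : ∀ a ∈ cs.rootSet, L a ∈ cs.rootSet := fun a => map_mem_rootSet hL
  have hLs : ∀ a ∈ cs.rootSet, L.symm a ∈ cs.rootSet := fun a =>
    map_mem_rootSet (cs.linearGroup.inv_mem hL)
  have key : ∀ c ∈ weylCone cs.rootSet u, g (y + c) = f (L y + b + L c) ∧
      L y + b + L c ∈ weylCone cs.rootSet v := fun c hc => by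
    have hyc : y + c ∈ {z | z - y ∈ weylCone cs.rootSet u} := by simpa using hc
    obtain ⟨z, hz, hzc⟩ := hTf (mem_image_of_mem g hyc)
    have h := hLb (y + c) ⟨z, hzc⟩
    have e : L (y + c) + b = L y + b + L c := by rw [map_add]; abel
    rw [e] at h
    refine ⟨h, ?_⟩
    rw [← (B.isom f hf).injective (hzc.trans h)]
    simpa using hz
  have hray : ∀ t : ℝ, 0 ≤ t → L y + b + t • L u ∈ weylCone cs.rootSet v := fun t ht => by
    rw [← map_smul]
    exact (key _ (smul_mem_weylCone ht (self_mem_weylCone u))).2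
  have hmem : L u ∈ weylCone cs.rootSet v := by
    simpa using add_mem_of_ray_subset (isClosed_weylCone v) (convex_weylCone v) hray
      (zero_mem_weylCone v)
  have hcone := weylCone_eq_of_pos fun a ha => hv.mul_pos (hu.map hLs) hmem ha
  refine ⟨L y + b, fun c hc => ?_⟩
  rw [hcone, ← L.apply_symm_apply c, map_mem_weylCone_iff hLs hL'] at hc
  have h := (key _ hc).1
  rw [L.apply_symm_apply] at h
  exact ⟨_, by simpa using hc, h⟩

theorem isHalfApartment_inter (B : RBuilding cs X Λ) {f g : ModelSpace n → X}
    (hf : f ∈ B.charts)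
    (h : ∃ a ∈ cs.rootSet, ∃ c : ℝ, {x | f x ∈ range g} = {x | c ≤ ⟪a, x⟫}) :
    IsHalfApartment cs B.charts (range f ∩ range g) := by
  obtain ⟨a, ha, c, h⟩ := h
  refine ⟨f, hf, _, _, SphericalCoxeterSystem.isModelHalf_halfSpace ha c, ?_⟩
  rw [← h]
  exact (image_preimage_eq_range_inter).symm

/-- The charts of an ℝ-building, together with the roots of its Coxeter system. -/
def chartSystem (B : RBuilding cs X Λ) : ChartSystem (ModelSpace n) X where
  roots := cs.rootSet
  finite_roots := cs.finite_rootSet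
  norm_root _ ha := SphericalCoxeterSystem.norm_of_mem_rootSet ha
  G := cs.linearGroup
  finite_G := cs.finite_linearGroup
  map_root _ hL _ ha := map_mem_rootSet hL ha
  reflection_mem _ ha := SphericalCoxeterSystem.hyperplaneReflection_mem_linearGroup ha
  charts := B.charts
  isom := B.isom
  comp_mem f hf L hL b := by
    obtain ⟨w, hw, h⟩ := SphericalCoxeterSystem.exists_mem_W hL b
    have := B.A1 f hf w hw
    rwa [show f ∘ w = fun x => f (L x + b) from funext fun x => congrArg f (h x)] at this
  isClosed_preimage f hf g hg := (B.A2 f hf g hg).1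
  convex_preimage f hf g hg := (B.A2 f hf g hg).2.1
  exists_transition f hf g hg := B.exists_transition hf hg
  exists_joint f hf g hg x y :=
    B.A3 _ (B.into f hf (mem_range_self x)) _ (B.into g hg (mem_range_self y))
  exists_subsectors f hf g hg v u hv hu := by
    obtain ⟨T₁, T₂, h, hh, hT₁, hT₂, hs₁, hs₂, hr₁, hr₂⟩ := B.A4 _ _
      ⟨_, f, hf, 0, _, SphericalCoxeterSystem.isModelSector_cone hv 0, rfl, rfl⟩
      ⟨_, g, hg, 0, _, SphericalCoxeterSystem.isModelSector_cone hu 0, rfl, rfl⟩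
    obtain ⟨x, hx⟩ := B.exists_translate_cone_subset hf hv hT₁ hs₁
    obtain ⟨y, hy⟩ := B.exists_translate_cone_subset hg hu hT₂ hs₂
    exact ⟨h, hh, x, y, fun c hc => hr₁ (hx c hc), fun c hc => hr₂ (hy c hc)⟩
  exists_common_point f hf g hg h hh h₁ h₂ h₃ :=
    B.A5 f hf g hg h hh (B.isHalfApartment_inter hf h₁) (B.isHalfApartment_inter hg h₂)
      (B.isHalfApartment_inter hf h₃)

theorem space_chartSystem (B : RBuilding cs X Λ) : B.chartSystem.space = Λ := by
  ext x
  refine ⟨fun ⟨f, hf, hx⟩ => B.into f hf hx, fun hx => ?_⟩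
  obtain ⟨f, hf, hxf, -⟩ := B.A3 x hx x hx
  exact ⟨f, hf, hxf⟩

end RBuilding

end BuildingCharts

section ParallelWalls

open Filter Topology
open scoped RealInnerProductSpace

theorem IsPanelVector.exists_ball_inter_subset {V : Type*} [NormedAddCommGroup V]
    [InnerProductSpace ℝ V] {R : Set V} {a p v : V} (h : IsPanelVector R a p) (hR : R.Finite)
    (hv : RegularVector R v) (hp : p ∈ weylCone R v) :
    ∃ ε : ℝ, 0 < ε ∧ ∀ q, ⟪a, q⟫ = 0 → dist q p < ε → q ∈ weylCone R v := by
  have hev : ∀ᶠ q in 𝓝 p, ∀ b ∈ R, b ≠ a → b ≠ -a → 0 < ⟪b, v⟫ * ⟪b, q⟫ := by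
    rw [eventually_all_finite hR]
    intro b hb
    by_cases h1 : b = a
    · exact Eventually.of_forall fun _ h => (h h1).elim
    by_cases h2 : b = -a
    · exact Eventually.of_forall fun _ _ h => (h h2).elim
    have hc : Continuous fun q : V => ⟪b, v⟫ * ⟪b, q⟫ := by fun_prop
    filter_upwards [hc.continuousAt.eventually (lt_mem_nhds (h.mul_pos hv hp hb h1 h2))]
      with q hq _ _ using hq
  obtain ⟨ε, hε, hball⟩ := Metric.eventually_nhds_iff.1 hev
  refine ⟨ε, hε, fun q hq hqp b hb => ?_⟩
  by_cases h1 : b = a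
  · rw [h1, hq, mul_zero]
  by_cases h2 : b = -a
  · rw [h2, inner_neg_left, inner_neg_left, hq]; simp
  exact (hball hqp b hb h1 h2).le

namespace ChartSystem

variable {V X : Type*} [NormedAddCommGroup V] [InnerProductSpace ℝ V] [MetricSpace X]
  {Φ : ChartSystem V X} {f g k : V → X} {a b p q x y x' y' : V} {c d : ℝ}

theorem dist_eq_of_asympDist_eq_zero (hf : f ∈ Φ.charts) (hk : k ∈ Φ.charts)
    (hx : asympDist k x f x' = 0) (hy : asympDist k y f y' = 0) : dist x y = dist x' y' := by
  rw [← asympDist_self (Φ.isom k hk), ← asympDist_self (Φ.isom f hf),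
    asympDist_congr_right hk hk hf hy, asympDist_comm, asympDist_congr_right hf hk hf hx,
    asympDist_comm]

theorem exists_dist_le_of_sameEnd (hf : f ∈ Φ.charts) (hk : k ∈ Φ.charts) :
    ∃ C, ∀ q, SameEnd f k q → dist (f q) (k q) ≤ C := by
  obtain ⟨F, hF, hcov⟩ := Φ.exists_cone_cover
  have key : ∀ v ∈ F, ∃ C, ∀ q ∈ Φ.cone v, SameEnd f k q → dist (f q) (k q) ≤ C := fun v hv => by
    obtain ⟨L, -, C, hC⟩ := exists_abs_dist_sub_le hf hk (hF v hv) (hF v hv)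
    refine ⟨C, fun q hq hs => ?_⟩
    have h1 : Tendsto (fun t : ℝ => dist (f (t • q)) (k (t • q)) / t) atTop (𝓝 (dist q (L q))) :=
      tendsto_div_of_abs_sub_le (C := C) fun t ht => by
        have := hC _ (smul_mem_weylCone ht hq) _ (smul_mem_weylCone ht hq)
        rwa [map_smul, dist_smul₀, Real.norm_of_nonneg ht] at this
    have h2 : dist q (L q) = 0 := (tendsto_nhds_unique h1 (tendsto_asympDist hf hk q q)).trans hs
    have h3 := hC q hq q hq
    rw [h2, sub_zero] at h3
    exact (le_abs_self _).trans h3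
  choose! C hC using key
  refine ⟨∑ v ∈ F, |C v|, fun q hq => ?_⟩
  obtain ⟨v, hv, hqv⟩ := hcov q
  exact (hC v hv q hqv hq).trans ((le_abs_self _).trans
    (Finset.single_le_sum (f := fun v => |C v|) (fun _ _ => abs_nonneg _) hv))

theorem hausdorffEDist_ne_top_of_sameEnd (hf : f ∈ Φ.charts) (hk : k ∈ Φ.charts)
    (ha : a ∈ Φ.roots) (c : ℝ) (hs : ∀ q, ⟪a, q⟫ = 0 → SameEnd f k q) :
    Metric.hausdorffEDist (f '' {x | ⟪a, x⟫ = 0}) (k '' {x | ⟪a, x⟫ = c}) ≠ ⊤ := by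
  obtain ⟨C, hC⟩ := exists_dist_le_of_sameEnd hf hk
  have haa : ⟪a, a⟫ = 1 := by rw [real_inner_self_eq_norm_sq, Φ.norm_root a ha]; norm_num
  have key : ∀ q, ⟪a, q⟫ = 0 →
      edist (f q) (k (q + c • a)) ≤ ENNReal.ofReal (C + ‖c • a‖) := fun q hq => by
    rw [edist_dist]
    refine ENNReal.ofReal_le_ofReal ((dist_triangle _ (k q) _).trans
      (add_le_add (hC q (hs q hq)) ?_))
    rw [(Φ.isom k hk).dist_eq]
    simp
  refine ne_top_of_le_ne_top (ENNReal.ofReal_ne_top (r := C + ‖c • a‖))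
    (Metric.hausdorffEDist_le_of_mem_edist ?_ ?_)
  · rintro _ ⟨q, hq, rfl⟩
    refine ⟨_, ⟨q + c • a, ?_, rfl⟩, key q hq⟩
    rw [mem_ofPred_eq, inner_add_right, inner_smul_right, haa, hq]
    ring
  · rintro _ ⟨q, hq, rfl⟩
    have h0 : ⟪a, q - c • a⟫ = 0 := by
      rw [inner_sub_right, inner_smul_right, haa, hq]; ring
    refine ⟨_, ⟨q - c • a, h0, rfl⟩, ?_⟩
    rw [edist_comm]
    simpa using key _ h0

theorem exists_asympDist_eq_zero [ProperSpace V] (hf : f ∈ Φ.charts) (hk : k ∈ Φ.charts)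
    (ha : a ∈ Φ.roots)
    (h : Metric.hausdorffEDist (f '' {x | ⟪b, x⟫ = d}) (k '' {x | ⟪a, x⟫ = c}) ≠ ⊤)
    (hq : ⟪a, q⟫ = 0) : ∃ q', ⟪b, q'⟫ = 0 ∧ asympDist k q f q' = 0 := by
  have haa : ⟪a, a⟫ = 1 := by rw [real_inner_self_eq_norm_sq, Φ.norm_root a ha]; norm_num
  obtain ⟨C, hC⟩ := exists_gt (Metric.hausdorffDist (f '' {x | ⟪b, x⟫ = d})
    (k '' {x | ⟪a, x⟫ = c}))
  have hC0 : 0 < C := Metric.hausdorffDist_nonneg.trans_lt hC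
  have hex : ∀ t : ℝ, ∃ y, ⟪b, y⟫ = d ∧ dist (k (t • q)) (f y) ≤ ‖c • a‖ + C := fun t => by
    have hmem : k (t • q + c • a) ∈ k '' {x | ⟪a, x⟫ = c} := ⟨_, by
      rw [mem_ofPred_eq, inner_add_right, inner_smul_right, inner_smul_right, haa, hq]
      ring, rfl⟩
    obtain ⟨_, ⟨y, hy, rfl⟩, hlt⟩ := Metric.exists_dist_lt_of_hausdorffDist_lt' hmem hC h
    refine ⟨y, hy, (dist_triangle _ (k (t • q + c • a)) _).trans (add_le_add ?_ ?_)⟩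
    · rw [(Φ.isom k hk).dist_eq]
      simp
    · rw [dist_comm]
      exact hlt.le
  choose y hyb hyd using hex
  let t : ℕ → ℝ := fun j => j + 1
  have ht : ∀ j, 1 ≤ t j := fun j => by simp [t]
  have ht0 : ∀ j, 0 < t j := fun j => one_pos.trans_le (ht j)
  have htop : Tendsto t atTop atTop :=
    tendsto_atTop_add_const_right _ _ tendsto_natCast_atTop_atTop
  let D : ℝ := ‖c • a‖ + C + dist (k 0) (f 0)
  have hD : 0 ≤ D := by positivity
  have hbdd : ∀ j, (t j)⁻¹ • y (t j) ∈ Metric.closedBall (0 : V) (‖q‖ + D) := fun j => by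
    have h1 : ‖y (t j)‖ ≤ t j * ‖q‖ + D := by
      have e1 : dist (f (y (t j))) (f 0) = ‖y (t j)‖ := by
        rw [(Φ.isom f hf).dist_eq, dist_zero_right]
      have e2 : dist (k (t j • q)) (k 0) = t j * ‖q‖ := by
        rw [(Φ.isom k hk).dist_eq, dist_zero_right, norm_smul, Real.norm_of_nonneg (ht0 j).le]
      have e3 := dist_triangle4 (f (y (t j))) (k (t j • q)) (k 0) (f 0)
      have e4 := hyd (t j)
      rw [dist_comm] at e4
      simp only [D]
      linarith
    rw [mem_closedBall_zero_iff, norm_smul, norm_inv, Real.norm_of_nonneg (ht0 j).le,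
      inv_mul_le_iff₀ (ht0 j)]
    nlinarith [ht j]
  obtain ⟨q', -, φ, hφ, hlim⟩ := tendsto_subseq_of_bounded Metric.isBounded_closedBall hbdd
  have htφ : Tendsto (fun j => t (φ j)) atTop atTop := htop.comp hφ.tendsto_atTop
  refine ⟨q', ?_, ?_⟩
  · have hc : Continuous fun x : V => ⟪b, x⟫ := by fun_prop
    refine tendsto_nhds_unique ((hc.tendsto q').comp hlim) ?_
    have : Tendsto (fun j => d / t (φ j)) atTop (𝓝 0) := tendsto_const_nhds.div_atTop htφ
    refine this.congr fun j => ?_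
    simp only [Function.comp_apply, inner_smul_right, hyb, div_eq_inv_mul]
  · refine le_antisymm ?_ (asympDist_nonneg hk hf _ _)
    have h1 := (tendsto_asympDist hk hf q q').comp htφ
    have h2 : Tendsto (fun j => (‖c • a‖ + C) / t (φ j) +
        dist ((t (φ j))⁻¹ • y (t (φ j))) q') atTop (𝓝 0) := by
      simpa using (tendsto_const_nhds.div_atTop htφ).add (tendsto_iff_dist_tendsto_zero.1 hlim)
    refine le_of_tendsto_of_tendsto' h1 h2 fun j => ?_
    have hj := ht0 (φ j)
    have e1 : dist (f (y (t (φ j)))) (f (t (φ j) • q')) =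
        t (φ j) * dist ((t (φ j))⁻¹ • y (t (φ j))) q' := by
      rw [(Φ.isom f hf).dist_eq, ← Real.norm_of_nonneg hj.le, ← dist_smul₀,
        Real.norm_of_nonneg hj.le, smul_inv_smul₀ hj.ne']
    have e2 := dist_triangle (k (t (φ j) • q)) (f (y (t (φ j)))) (f (t (φ j) • q'))
    rw [Function.comp_apply, div_le_iff₀ hj, add_mul, div_mul_cancel₀ _ hj.ne']
    linarith [hyd (t (φ j))]

theorem sameEnd_neg_of_asympDist_eq_zero (hf : f ∈ Φ.charts) (hk : k ∈ Φ.charts)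
    (hp : SameEnd k f p) (hx : asympDist k (-p) f x = 0) : SameEnd k f (-p) := by
  have h0 : asympDist k 0 f 0 = 0 :=
    asympDist_eq_zero_of_dist_le (C := dist (k 0) (f 0)) fun t _ => by simp
  have h1 := dist_eq_of_asympDist_eq_zero hf hk hx h0
  have h2 := dist_eq_of_asympDist_eq_zero hf hk hp hx
  rw [dist_zero_right, dist_zero_right, norm_neg] at h1
  rw [dist_eq_norm, dist_eq_norm, sub_neg_eq_add] at h2
  have h3 := parallelogram_law_with_norm ℝ p x
  have h4 : ‖p + p‖ = 2 * ‖p‖ := by rw [← two_smul ℝ p, norm_smul]; norm_num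
  rw [← h2, ← h1, h4] at h3
  have h5 : ‖p + x‖ = 0 := by nlinarith [norm_nonneg (p + x)]
  rw [neg_eq_of_add_eq_zero_right (norm_eq_zero.1 h5)] at hx ⊢
  exact hx

theorem exists_comp_sameEnd_of_sameEnd (hf : f ∈ Φ.charts) (hk : k ∈ Φ.charts)
    (hp : IsPanelVector Φ.roots a p) (hs : SameEnd k f p)
    (h : ∀ q, ⟪a, q⟫ = 0 → ∃ q', ⟪a, q'⟫ = 0 ∧ asympDist k q f q' = 0) :
    ∃ L ∈ Φ.G, ∀ q, ⟪a, q⟫ = 0 → SameEnd k (fun x => f (L x)) q := by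
  obtain ⟨v, hv, hpv⟩ := Φ.exists_reg_mem_cone p
  obtain ⟨ε, hε, hball⟩ := hp.exists_ball_inter_subset Φ.finite_roots hv hpv
  obtain ⟨L, hL, hLd⟩ := exists_asympDist_eq hk hf hv hv
  have hLs := symm_mem hL
  have hLp : L.symm p = p := by
    have := hLd p hpv p hpv
    rw [show asympDist k p f p = 0 from hs, eq_comm, dist_eq_zero] at this
    exact L.symm_apply_eq.2 this
  have hg := comp_linear_mem hf hLs
  have hneg : SameEnd k (fun x => f (L.symm x)) (-p) := by
    obtain ⟨x, -, hx⟩ := h (-p) (by rw [inner_neg_right, hp.inner_eq_zero, neg_zero])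
    rw [SameEnd, asympDist_comp_linear hk hf hLs, map_neg, hLp]
    exact sameEnd_neg_of_asympDist_eq_zero hf hk hs hx
  have hnear : ∀ q, ⟪a, q⟫ = 0 → dist q p < ε → SameEnd k (fun x => f (L.symm x)) q := by
    intro q hq hqp
    obtain ⟨q', hq', hqq⟩ := h q hq
    have hqp' : dist q' p < ε := by rwa [← dist_eq_of_asympDist_eq_zero hf hk hqq hs]
    have := hLd q (hball q hq hqp) q' (hball q' hq' hqp')
    rw [hqq, eq_comm, dist_eq_zero] at this
    rwa [SameEnd, asympDist_comp_linear hk hf hLs, L.symm_apply_eq.2 this]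
  refine ⟨L.symm, hLs, fun q hq => ?_⟩
  obtain ⟨s, hs0, hsε⟩ : ∃ s : ℝ, 0 < s ∧ s * ‖q‖ < ε :=
    ⟨ε / (‖q‖ + 1), by positivity, by
      rw [div_mul_eq_mul_div, div_lt_iff₀ (by positivity)]
      nlinarith⟩
  have h1 := hnear (p + s • q)
    (by rw [inner_add_right, inner_smul_right, hq, hp.inner_eq_zero]; simp)
    (by rwa [dist_eq_norm, add_sub_cancel_left, norm_smul, Real.norm_of_nonneg hs0.le])
  have h2 := sameEnd_smul hk hg (inv_pos.2 hs0).le (sameEnd_add hk hg h1 hneg)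
  rwa [add_neg_cancel_comm, inv_smul_smul₀ hs0.ne'] at h2

theorem exists_comp_sameEnd (hf : f ∈ Φ.charts) (hk : k ∈ Φ.charts) (ha : a ∈ Φ.roots)
    (hb : b ∈ Φ.roots)
    (h : ∀ q, ⟪a, q⟫ = 0 → ∃ q', ⟪b, q'⟫ = 0 ∧ asympDist k q f q' = 0) :
    ∃ L ∈ Φ.G, ∀ q, ⟪a, q⟫ = 0 → SameEnd k (fun x => f (L x)) q := by
  obtain ⟨p, hp⟩ := exists_isPanelVector Φ.finite_roots Φ.norm_root ha
  obtain ⟨p', hbp', hpp'⟩ := h p hp.inner_eq_zero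
  obtain ⟨v, hv, hpv⟩ := Φ.exists_reg_mem_cone p
  obtain ⟨u, hu, hpu⟩ := Φ.exists_reg_mem_cone p'
  obtain ⟨L, hL, hLd⟩ := exists_asympDist_eq hk hf hv hu
  have hLs := symm_mem hL
  have hLp : p = L p' := by
    have := hLd p hpv p' hpu
    rwa [hpp', eq_comm, dist_eq_zero] at this
  have hLb : L b = a ∨ L b = -a := by
    by_contra! hne
    refine hp.inner_ne_zero _ (Φ.map_root L hL b hb) hne.1 hne.2 ?_
    rw [hLp, L.inner_map_map, hbp']
  have haL : ∀ q', ⟪b, q'⟫ = 0 → ⟪a, L q'⟫ = 0 := fun q' hq' => by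
    rw [← L.inner_map_map] at hq'
    rcases hLb with h | h <;> rw [h] at hq'
    · exact hq'
    · simpa using hq'
  obtain ⟨M, hM, hMs⟩ := exists_comp_sameEnd_of_sameEnd (comp_linear_mem hf hLs) hk hp
    (by rwa [SameEnd, asympDist_comp_linear hk hf hLs, hLp, L.symm_apply_apply, ← hLp])
    fun q hq => by
      obtain ⟨q', hq', hqq⟩ := h q hq
      exact ⟨L q', haL q' hq', by
        rwa [asympDist_comp_linear hk hf hLs, L.symm_apply_apply]⟩
  exact ⟨M.trans L.symm, trans_mem hM hLs, hMs⟩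

end ChartSystem

namespace RBuilding

variable {n : ℕ} {cs : SphericalCoxeterSystem n} {X : Type*} [MetricSpace X] {Λ : Set X}

/-- The union of the apartments containing a wall parallel to a given wall, in terms of
asymptotic charts. -/
theorem iUnion_par_eq_wallUnion (B : RBuilding cs X Λ) {k : ModelSpace n → X}
    (hk : k ∈ B.charts) {a : ModelSpace n} (ha : a ∈ cs.rootSet) (c : ℝ) :
    (⋃ f ∈ {f ∈ B.charts | ∃ m, cs.IsModelWall m ∧ Par (f '' m) (k '' {x | ⟪a, x⟫ = c})},
      range f) = B.chartSystem.wallUnion k a := by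
  ext x
  simp only [mem_iUnion, exists_prop]
  constructor
  · rintro ⟨f, ⟨hf, m, hm, hpar⟩, hx⟩
    obtain ⟨b, hb, d, rfl⟩ := SphericalCoxeterSystem.isModelWall_iff.1 hm
    obtain ⟨L, hL, hs⟩ := ChartSystem.exists_comp_sameEnd (Φ := B.chartSystem) hf hk ha hb
      fun q => ChartSystem.exists_asympDist_eq_zero (Φ := B.chartSystem) hf hk ha hpar
    refine ⟨_, ChartSystem.comp_linear_mem (Φ := B.chartSystem) hf hL, ?_, fun q hq =>
      (hs q hq).symm⟩
    obtain ⟨y, rfl⟩ := hx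
    exact ⟨L.symm y, by simp⟩
  · rintro ⟨f, hf, hx, hs⟩
    exact ⟨f, ⟨hf, _, SphericalCoxeterSystem.isModelWall_iff.2 ⟨a, ha, 0, rfl⟩,
      ChartSystem.hausdorffEDist_ne_top_of_sameEnd (Φ := B.chartSystem) hf hk ha c hs⟩, hx⟩

end RBuilding

end ParallelWalls

/-- **Main Result 2.** An ℝ-building is metrically complete if and only
if, for every direction `m` of a wall (represented by a wall `M₀` of the building), the
union of all apartments containing a wall with direction `m` is a complete metric
subspace (this union is isometric to the product of the wall tree `T(m)` with a
Euclidean space). -/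
theorem complete_iff_wallTrees_complete
    {n : ℕ} (cs : SphericalCoxeterSystem n) {X : Type*} [MetricSpace X]
    {Λ : Set X} (B : RBuilding cs X Λ) :
    IsComplete Λ ↔
      ∀ M₀ : Set X, IsWall cs B.charts M₀ →
        IsComplete (⋃ f ∈ {f ∈ B.charts | ∃ m, cs.IsModelWall m ∧ Par (f '' m) M₀},
          range f) := by
  constructor
  · rintro h _ ⟨k, hk, m, hm, rfl⟩
    obtain ⟨a, ha, c, rfl⟩ := SphericalCoxeterSystem.isModelWall_iff.1 hm
    rw [B.iUnion_par_eq_wallUnion hk ha c]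
    rw [← B.space_chartSystem] at h
    exact ChartSystem.isComplete_wallUnion h hk ha
  · intro h
    rw [← B.space_chartSystem]
    refine ChartSystem.isComplete_space fun k hk a ha => ?_
    rw [← B.iUnion_par_eq_wallUnion hk ha 0]
    exact h _ ⟨k, hk, _, SphericalCoxeterSystem.isModelWall_iff.2 ⟨a, ha, 0, rfl⟩, rfl⟩
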